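/- Assume that I_q^3 F = 0. Let (A, σ, f) be an F-algebra with quadratic pair such that deg A is divisible by 4, ind A ≤ 2, and disc(σ, f) is trivial, with Clifford algebra C(A, σ, f) ≅ C⁺ × C⁻. If C⁺ or C⁻ is split, then (A, σ, f) is hyperbolic. -/

import Mathlib

/-!  Common definitions for formalizing results of
"Triality over fields with I³ = 0" (F. K. Bingöl, A. Quéguiner-Mathieu).

We model an algebra with quadratic pair `(A, σ, f)` by the data of the reduced trace
`T` of `A` (given together with the property `IsReducedTrace` characterising it via a
splitting field), the involution `σ`, and an element `ℓ ∈ A` with `ℓ + σ(ℓ) = 1`; the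
semi-trace is `f = f_ℓ : s ↦ T(ℓ s)`.  By [KMRT, (5.7)] every semi-trace is of this
form, so this is an equivalent description of quadratic pairs.  -/

open scoped TensorProduct
open Module

noncomputable section

namespace Triality

variable (F : Type) [CommRing F]

/-- A (finite-dimensional) central simple algebra. -/
def IsCSA (A : Type) [Ring A] [Algebra F A] : Prop :=
  Algebra.IsCentral F A ∧ IsSimpleRing A ∧ Module.Finite F A

/-- The degree of a central simple algebra: the square root of its dimension. -/
def deg (A : Type) [Ring A] [Algebra F A] : ℕ := Nat.sqrt (Module.finrank F A)

/-- Brauer equivalence of two algebras. -/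
def BrauerEquiv (A B : Type) [Ring A] [Algebra F A] [Ring B] [Algebra F B] : Prop :=
  ∃ n m : ℕ, 0 < n ∧ 0 < m ∧
    Nonempty (Matrix (Fin n) (Fin n) A ≃ₐ[F] Matrix (Fin m) (Fin m) B)

/-- An algebra is split if it is isomorphic to a matrix algebra over the base. -/
def IsSplit (A : Type) [Ring A] [Algebra F A] : Prop :=
  ∃ n : ℕ, 0 < n ∧ Nonempty (A ≃ₐ[F] Matrix (Fin n) (Fin n) F)

/-- The Schur index of a central simple algebra: the smallest degree of a central
simple algebra in its Brauer class (realised by the underlying division algebra). -/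
def schurIndex (A : Type) [Ring A] [Algebra F A] : ℕ :=
  sInf { d : ℕ | 0 < d ∧ ∃ (D : Type) (_ : Ring D) (_ : Algebra F D),
    IsCSA F D ∧ Module.finrank F D = d * d ∧ BrauerEquiv F A D }

/-- A linear involution (anti-automorphism of period 2) on an algebra. -/
def IsInvolution {A : Type} [Ring A] [Algebra F A] (σ : A →ₗ[F] A) : Prop :=
  (∀ x y : A, σ (x * y) = σ y * σ x) ∧ (∀ x : A, σ (σ x) = x)

/-- `T` is the reduced trace of the central simple algebra `A`: over some splitting field
it is given by the trace of matrices. -/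
def IsReducedTrace (A : Type) [Ring A] [Algebra F A] (T : A →ₗ[F] F) : Prop :=
  ∃ (E : Type) (_ : Field E) (_ : Algebra F E) (n : ℕ)
    (e : E ⊗[F] A ≃ₐ[E] Matrix (Fin n) (Fin n) E),
    ∀ a : A, algebraMap F E (T a) = Matrix.trace (e ((1 : E) ⊗ₜ[F] a))

/-- The submodule of symmetric elements of an involution. -/
def symSet {A : Type} [Ring A] [Algebra F A] (σ : A →ₗ[F] A) : Submodule F A :=
  LinearMap.ker (σ - LinearMap.id)

/-- A quadratic pair on a central simple algebra `A` with reduced trace `T`, encoded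
by the involution `σ` together with an element `ℓ` with `ℓ + σ(ℓ) = 1`; the semi-trace of
the pair is `f_ℓ : s ↦ T(ℓ s)` on symmetric elements. -/
def IsQuadraticPair (A : Type) [Ring A] [Algebra F A] (T : A →ₗ[F] F)
    (σ : A →ₗ[F] A) (ℓ : A) : Prop :=
  IsInvolution F σ ∧
  2 * Module.finrank F (symSet F σ) = deg F A * (deg F A + 1) ∧
  (∀ x : A, σ x = -x → T x = 0) ∧
  ℓ + σ ℓ = 1

/-- A right ideal of `A`, as a submodule over the base. -/
def IsRightIdeal (A : Type) [Ring A] [Algebra F A] (I : Submodule F A) : Prop :=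
  ∀ x ∈ I, ∀ a : A, x * a ∈ I

/-- An isotropic right ideal for the quadratic pair `(σ, f_ℓ)`:
`σ(I)·I = 0` and the semi-trace `f_ℓ = T(ℓ·)` vanishes on `I ∩ Sym(A,σ)`. -/
def IsIsotropicIdeal (A : Type) [Ring A] [Algebra F A] (T : A →ₗ[F] F)
    (σ : A →ₗ[F] A) (ℓ : A) (I : Submodule F A) : Prop :=
  IsRightIdeal F A I ∧
  (∀ x ∈ I, ∀ y ∈ I, σ x * y = 0) ∧
  (∀ x ∈ I, σ x = x → T (ℓ * x) = 0)

/-- The algebra with quadratic pair `(A, σ, f_ℓ)` is isotropic. -/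
def QPIsotropic (A : Type) [Ring A] [Algebra F A] (T : A →ₗ[F] F)
    (σ : A →ₗ[F] A) (ℓ : A) : Prop :=
  ∃ I : Submodule F A, IsIsotropicIdeal F A T σ ℓ I ∧ I ≠ ⊥

/-- The algebra with quadratic pair `(A, σ, f_ℓ)` is hyperbolic. -/
def QPHyperbolic (A : Type) [Ring A] [Algebra F A] (T : A →ₗ[F] F)
    (σ : A →ₗ[F] A) (ℓ : A) : Prop :=
  ∃ I : Submodule F A, IsIsotropicIdeal F A T σ ℓ I ∧
    2 * Module.finrank F I = Module.finrank F A

/-- The index of an algebra with quadratic pair: the set of reduced dimensions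
`dim_F I / deg A` of isotropic right ideals `I`. -/
def qpIndexSet (A : Type) [Ring A] [Algebra F A] (T : A →ₗ[F] F)
    (σ : A →ₗ[F] A) (ℓ : A) : Set ℕ :=
  { r : ℕ | ∃ I : Submodule F A, IsIsotropicIdeal F A T σ ℓ I ∧
      Module.finrank F I = r * deg F A }

/-- A symplectic involution, characterised characteristic-freely: in characteristic 2,
`1` is an alternating element; in characteristic `≠ 2`, the symmetric elements have
dimension `n(n-1)/2`. -/
def IsSymplectic (A : Type) [Ring A] [Algebra F A] (σ : A →ₗ[F] A) : Prop :=
  IsInvolution F σ ∧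
    ((ringChar F = 2 ∧ ∃ y : A, 1 = y + σ y) ∨
     (ringChar F ≠ 2 ∧ 2 * Module.finrank F (symSet F σ) = deg F A * (deg F A - 1)))

/-- The sandwich map `Sand : A ⊗ A → End_F(A)`, `Sand(a ⊗ b)(x) = a x b`. -/
def sand (A : Type) [Ring A] [Algebra F A] : A ⊗[F] A →ₗ[F] A →ₗ[F] A :=
  TensorProduct.lift
    (LinearMap.mk₂ F (fun a b => (LinearMap.mulRight F b).comp (LinearMap.mulLeft F a))
      (fun a a' b => by ext x; simp [add_mul])
      (fun c a b => by ext x; simp [smul_mul_assoc])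
      (fun a b b' => by ext x; simp [mul_add])
      (fun c a b => by ext x; simp [mul_smul_comm]))

/-- The degree-two part map `A ⊗ A → T(A)`, `a ⊗ b ↦ ι a * ι b`. -/
def mu2 (A : Type) [Ring A] [Algebra F A] : A ⊗[F] A →ₗ[F] TensorAlgebra F A :=
  TensorProduct.lift
    (LinearMap.mk₂ F (fun a b => TensorAlgebra.ι F a * TensorAlgebra.ι F b)
      (fun a a' b => by simp [add_mul])
      (fun c a b => by simp [smul_mul_assoc])
      (fun a b b' => by simp [mul_add])
      (fun c a b => by simp [mul_smul_comm]))

/-- The defining relations of the Clifford algebra `C(A, σ, f)` of an algebra with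
quadratic pair, following [KMRT, §8.B]: in the tensor algebra `T(A)`, a symmetric
element `s`, viewed in degree one, is identified with the scalar `f(s) = T(ℓ s)`, and a
`σ₂`-symmetric element `c ∈ A ⊗ A` (i.e. `Sand(c) ∘ σ = Sand(c)`), viewed in degree two,
is identified with the degree-one element `Sand(c)(ℓ)`.  (In the split case
`A = End(V)`, `(σ, f) = ad(q)`, these are the Bichsel–Knus relations presenting
the even Clifford algebra `C₀(q)`.) -/
inductive CliffordRel (A : Type) [Ring A] [Algebra F A] (T : A →ₗ[F] F)
    (σ : A →ₗ[F] A) (ℓ : A) : TensorAlgebra F A → TensorAlgebra F A → Prop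
  | sym (s : A) (hs : σ s = s) :
      CliffordRel A T σ ℓ (TensorAlgebra.ι F s) (algebraMap F _ (T (ℓ * s)))
  | deg2 (c : A ⊗[F] A) (hc : ∀ x : A, sand F A c (σ x) = sand F A c x) :
      CliffordRel A T σ ℓ (mu2 F A c) (TensorAlgebra.ι F (sand F A c ℓ))

/-- The Clifford algebra of an algebra with quadratic pair [KMRT, §8.B]. -/
def CliffordAlg (A : Type) [Ring A] [Algebra F A] (T : A →ₗ[F] F)
    (σ : A →ₗ[F] A) (ℓ : A) : Type :=
  RingQuot (CliffordRel F A T σ ℓ)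

instance (A : Type) [Ring A] [Algebra F A] (T : A →ₗ[F] F) (σ : A →ₗ[F] A) (ℓ : A) :
    Ring (CliffordAlg F A T σ ℓ) := inferInstanceAs (Ring (RingQuot _))

instance (A : Type) [Ring A] [Algebra F A] (T : A →ₗ[F] F) (σ : A →ₗ[F] A) (ℓ : A) :
    Algebra F (CliffordAlg F A T σ ℓ) := inferInstanceAs (Algebra F (RingQuot _))

/-- The canonical image of `a ∈ A` as a degree-one element of the Clifford algebra. -/
def cliffGen (A : Type) [Ring A] [Algebra F A] (T : A →ₗ[F] F)
    (σ : A →ₗ[F] A) (ℓ : A) (a : A) : CliffordAlg F A T σ ℓ :=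
  RingQuot.mkAlgHom F (CliffordRel F A T σ ℓ) (TensorAlgebra.ι F a)

/-- The quadratic pair `(σ, f)` has trivial discriminant: the centre of its Clifford
algebra is the split étale quadratic algebra, i.e. contains a nontrivial idempotent. -/
def HasTrivialDiscriminant (A : Type) [Ring A] [Algebra F A] (T : A →ₗ[F] F)
    (σ : A →ₗ[F] A) (ℓ : A) : Prop :=
  ∃ e : CliffordAlg F A T σ ℓ, e ∈ Subalgebra.center F (CliffordAlg F A T σ ℓ) ∧
    e * e = e ∧ e ≠ 0 ∧ e ≠ 1

/-- `(A, σ)` (an algebra with involution) is a quadratic extension of the algebra with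
unitary involution `(C, σ_C)`, where `uC` is a distinguished generator of the centre `K`
of `C` over `F`:  `C` embeds in `A` compatibly with the involutions, with image the
centralizer of the image of `K`. -/
def IsInvQuadExt (A : Type) [Ring A] [Algebra F A] (σ : A →ₗ[F] A)
    (C : Type) [Ring C] [Algebra F C] (σC : C →ₗ[F] C) (uC : C) : Prop :=
  ∃ j : C →ₐ[F] A, Function.Injective j ∧ (∀ x : C, σ (j x) = j (σC x)) ∧
    (Set.range (j : C → A) = Set.centralizer {j uC})

/-- `(A, σ, f_ℓ)` (an algebra with quadratic pair) is a quadratic extension of the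
algebra with unitary involution `(C, σ_C)`:  in addition to the conditions of
`IsInvQuadExt`, the semi-trace `f_ℓ` coincides on symmetric elements with `f_{ℓK}` for
some generator `ℓK` of the quadratic étale algebra `K = F[j(uC)] ⊆ A` with
`ℓK² - ℓK ∈ F`. -/
def IsQPQuadExt (A : Type) [Ring A] [Algebra F A] (T : A →ₗ[F] F)
    (σ : A →ₗ[F] A) (ℓ : A)
    (C : Type) [Ring C] [Algebra F C] (σC : C →ₗ[F] C) (uC : C) : Prop :=
  ∃ j : C →ₐ[F] A, Function.Injective j ∧ (∀ x : C, σ (j x) = j (σC x)) ∧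
    (Set.range (j : C → A) = Set.centralizer {j uC}) ∧
    ∃ ℓK ∈ Algebra.adjoin F ({j uC} : Set A),
      ℓK ∉ Set.range (algebraMap F A) ∧
      (ℓK * ℓK - ℓK) ∈ Set.range (algebraMap F A) ∧
      ∀ s : A, σ s = s → T (ℓ * s) = T (ℓK * s)

/-- The algebra with unitary involution `(C, σ_C)` is isotropic: there is a nonzero
right ideal `J` with `σ_C(J)·J = 0`. -/
def UnitaryIsotropic (C : Type) [Ring C] [Algebra F C] (σC : C →ₗ[F] C) : Prop :=
  ∃ J : Submodule F C, IsRightIdeal F C J ∧ (∀ x ∈ J, ∀ y ∈ J, σC x * y = 0) ∧ J ≠ ⊥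

/-- The algebra with unitary involution `(C, σ_C)` is hyperbolic: there is a right
ideal `J` with `σ_C(J)·J = 0` of half the dimension (over `F`; equivalently, of half the
dimension over the centre). -/
def UnitaryHyperbolic (C : Type) [Ring C] [Algebra F C] (σC : C →ₗ[F] C) : Prop :=
  ∃ J : Submodule F C, IsRightIdeal F C J ∧ (∀ x ∈ J, ∀ y ∈ J, σC x * y = 0) ∧
    2 * Module.finrank F J = Module.finrank F C

/-- The 3-fold quadratic Pfister form `⟨⟨a, b, c]]` on `F⁸`. -/
def pfister3Form (a b c : F) : (Fin 8 → F) → F := fun v =>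
  (v 0 * v 0 + v 0 * v 1 + c * (v 1 * v 1))
  + a * (v 2 * v 2 + v 2 * v 3 + c * (v 3 * v 3))
  + b * (v 4 * v 4 + v 4 * v 5 + c * (v 5 * v 5))
  + a * b * (v 6 * v 6 + v 6 * v 7 + c * (v 7 * v 7))

/-- `I_q³ F = 0`: every 3-fold quadratic Pfister form over `F` is hyperbolic, i.e.
vanishes on a totally isotropic subspace of half the dimension. -/
def I3Trivial : Prop :=
  ∀ a b c : F, a ≠ 0 → b ≠ 0 → (1 : F) - 4 * c ≠ 0 →
    ∃ W : Submodule F (Fin 8 → F), Module.finrank F W = 4 ∧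
      ∀ v ∈ W, pfister3Form F a b c v = 0

/-- An algebra with quadratic pair, bundled. -/
structure QPAlgebra : Type 1 where
  A : Type
  [ring : Ring A]
  [alg : Algebra F A]
  T : A →ₗ[F] F
  σ : A →ₗ[F] A
  ℓ : A
  csa : IsCSA F A
  trd : IsReducedTrace F A T
  pair : IsQuadraticPair F A T σ ℓ

attribute [instance] QPAlgebra.ring QPAlgebra.alg

/-- A trialitarian triple: three degree-8 algebras with quadratic pair such that the
Clifford algebra of the first, with its canonical quadratic pair, is isomorphic to the
product of the other two.  The isomorphism intertwines the canonical involution of the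
Clifford algebra (which maps the degree-one generator attached to `a` to the one
attached to `σ(a)`) with the product involution; since the degree-one elements generate
the Clifford algebra, this is recorded on generators. -/
def IsTrialitarianTriple (X Y Z : QPAlgebra F) : Prop :=
  Module.finrank F X.A = 64 ∧ Module.finrank F Y.A = 64 ∧ Module.finrank F Z.A = 64 ∧
  ∃ φ : CliffordAlg F X.A X.T X.σ X.ℓ ≃ₐ[F] (Y.A × Z.A),
    ∀ a : X.A,
      φ (cliffGen F X.A X.T X.σ X.ℓ (X.σ a)) =
        (Y.σ (φ (cliffGen F X.A X.T X.σ X.ℓ a)).1,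
         Z.σ (φ (cliffGen F X.A X.T X.σ X.ℓ a)).2)

/-- A trialitarian triple is isotropic if one of its three members is isotropic
(equivalently, by triality, each of them is). -/
def TripleIsotropic (X Y Z : QPAlgebra F) : Prop :=
  QPIsotropic F X.A X.T X.σ X.ℓ ∨ QPIsotropic F Y.A Y.T Y.σ Y.ℓ ∨
    QPIsotropic F Z.A Z.T Z.σ Z.ℓ

/-- The (unordered) triple of Schur indices of a trialitarian triple; the index
`ind T = (a, b, c)` with `a ≤ b ≤ c` of the paper corresponds to this multiset being
`{a, b, c}`. -/
def indexMultiset (X Y Z : QPAlgebra F) : Multiset ℕ :=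
  {schurIndex F X.A, schurIndex F Y.A, schurIndex F Z.A}

/-- The relations of the quaternion algebra `[a, b)_F = F⟨i, j⟩` with
`i² - i = a`, `j² = b`, `ji = (1 - i)j`. -/
inductive QuatRel (a b : F) : FreeAlgebra F (Fin 2) → FreeAlgebra F (Fin 2) → Prop
  | ii : QuatRel a b (FreeAlgebra.ι F 0 * FreeAlgebra.ι F 0)
      (FreeAlgebra.ι F 0 + algebraMap F _ a)
  | jj : QuatRel a b (FreeAlgebra.ι F 1 * FreeAlgebra.ι F 1) (algebraMap F _ b)
  | ji : QuatRel a b (FreeAlgebra.ι F 1 * FreeAlgebra.ι F 0)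
      ((1 - FreeAlgebra.ι F 0) * FreeAlgebra.ι F 1)

/-- The quaternion algebra `[a, b)_F`, presented by generators and relations. -/
def QuatAlg (a b : F) : Type := RingQuot (QuatRel F a b)

instance (a b : F) : Ring (QuatAlg F a b) := inferInstanceAs (Ring (RingQuot _))
instance (a b : F) : Algebra F (QuatAlg F a b) := inferInstanceAs (Algebra F (RingQuot _))

/-- A ring in which every nonzero element is invertible. -/
def IsDivision (A : Type) [Ring A] : Prop := ∀ x : A, x ≠ 0 → IsUnit x

end Triality

end

namespace Triality

/-- The norm form `x² + xy + cy²`. -/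
def nm {L : Type} [Field L] (c x y : L) : L := x * x + x * y + c * (y * y)

/-- `x` is a value of the quadratic form `N_z ⊥ -y N_z`. -/
def Rep {L : Type} [Field L] (y z x : L) : Prop :=
  ∃ p q r s, x = nm z p q - y * nm z r s

/-- All forms `N_z ⊥ -y N_z` (with `y ≠ 0`, `N_z` nonsingular) are universal. -/
def PfisterUniversal (L : Type) [Field L] : Prop :=
  ∀ y z x : L, y ≠ 0 → 1 - 4 * z ≠ 0 → Rep y z x

section Rep

variable {L : Type} [Field L] {y z : L}

lemma nm_mul (z a b c d : L) :
    nm z a b * nm z c d = nm z (a * c - z * b * d) (a * d + b * c + b * d) := by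
  simp only [nm]; ring

lemma nm_zero (z : L) : nm z 0 0 = 0 := by simp [nm]

lemma nm_inv {z a b : L} (h : nm z a b ≠ 0) :
    (nm z a b)⁻¹ = nm z ((a + b) / nm z a b) (-b / nm z a b) := by
  have : nm z ((a + b) / nm z a b) (-b / nm z a b) = nm z a b / (nm z a b * nm z a b) := by
    rw [eq_div_iff (mul_ne_zero h h)]
    generalize hn : nm z a b = n at h
    simp only [nm] at *
    field_simp
    rw [← hn]; ring
  rw [this]; field_simp

lemma nm_universal (hz : 1 - 4 * z ≠ 0) {a b : L} (h : nm z a b = 0) (hab : a ≠ 0 ∨ b ≠ 0)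
    (d : L) : ∃ p q, d = nm z p q := by
  have h2 : 2 * a + b ≠ 0 ∨ a + 2 * z * b ≠ 0 := by
    by_contra! hc
    obtain ⟨h1, h2⟩ := hc
    have hb : b = -2 * a := by linear_combination h1
    have : a * (1 - 4 * z) = 0 := by rw [hb] at h2; linear_combination h2
    have ha : a = 0 := by simpa [hz] using this
    simp [ha] at hb
    simp [ha, hb] at hab
  simp only [nm] at h
  rcases h2 with h2 | h2
  · refine ⟨(d - 1) / (2 * a + b) * a + 1, (d - 1) / (2 * a + b) * b, ?_⟩
    simp only [nm]
    generalize ht : (d - 1) / (2 * a + b) = t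
    have : d = t * (2 * a + b) + 1 := by rw [← ht]; field_simp; ring
    rw [this]; linear_combination (-t ^ 2) * h
  · refine ⟨(d - z) / (a + 2 * z * b) * a, (d - z) / (a + 2 * z * b) * b + 1, ?_⟩
    simp only [nm]
    generalize ht : (d - z) / (a + 2 * z * b) = t
    have : d = t * (a + 2 * z * b) + z := by rw [← ht, div_mul_cancel₀ _ h2]; ring
    rw [this]; linear_combination (-t ^ 2) * h

lemma Rep.of_nm_isotropic (hz : 1 - 4 * z ≠ 0) {a b : L} (h : nm z a b = 0)
    (hab : a ≠ 0 ∨ b ≠ 0) (y d : L) : Rep y z d := by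
  obtain ⟨p, q, h⟩ := nm_universal hz h hab d
  exact ⟨p, q, 0, 0, by simp [h, nm_zero]⟩

lemma Rep.nm (y z p q : L) : Rep y z (nm z p q) := ⟨p, q, 0, 0, by simp [nm_zero]⟩

lemma Rep.neg_self (y z : L) : Rep y z (-y) := ⟨0, 0, 1, 0, by simp [Triality.nm]⟩

lemma Rep.mul {x x' : L} (h : Rep y z x) (h' : Rep y z x') : Rep y z (x * x') := by
  obtain ⟨a, b, c, d, rfl⟩ := h
  obtain ⟨a', b', c', d', rfl⟩ := h'
  refine ⟨a * a' - z * b * b' + y * (c * (c' + d') + z * d * d'),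
    a * b' + b * a' + b * b' + y * (d * c' - c * d'),
    a * c' - z * b * d' + c * (a' + b') + z * d * b',
    a * d' + b * c' + b * d' + d * a' - c * b', ?_⟩
  simp only [Triality.nm]; ring

lemma Rep.smul_sq {x : L} (h : Rep y z x) (t : L) : Rep y z (t * t * x) := by
  obtain ⟨a, b, c, d, rfl⟩ := h
  exact ⟨t * a, t * b, t * c, t * d, by simp only [Triality.nm]; ring⟩

lemma Rep.inv {x : L} (h : Rep y z x) : Rep y z x⁻¹ := by
  by_cases hx : x = 0
  · simpa [hx] using h
  have := h.smul_sq x⁻¹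
  rwa [mul_assoc, inv_mul_cancel₀ hx, mul_one] at this

lemma Rep.div {x x' : L} (h : Rep y z x) (h' : Rep y z x') : Rep y z (x / x') := by
  rw [div_eq_mul_inv]; exact h.mul h'.inv

/-- If `N_z(a) = y N_z(b)` nontrivially, `N_z ⊥ -y N_z` is universal. -/
lemma Rep.of_isotropic (hz : 1 - 4 * z ≠ 0) (hy : y ≠ 0) {a b c d : L}
    (h : Triality.nm z a b - y * Triality.nm z c d = 0)
    (hne : (a ≠ 0 ∨ b ≠ 0) ∨ c ≠ 0 ∨ d ≠ 0) (x : L) : Rep y z x := by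
  by_cases hn : Triality.nm z c d = 0
  · have hn' : Triality.nm z a b = 0 := by simpa [hn] using h
    rcases hne with hne | hne
    · exact Rep.of_nm_isotropic hz hn' hne _ _
    · exact Rep.of_nm_isotropic hz hn hne _ _
  · have hy' : y = Triality.nm z a b * (Triality.nm z c d)⁻¹ := by
      field_simp; linear_combination -h
    rw [nm_inv hn, nm_mul] at hy'
    generalize a * ((c + d) / Triality.nm z c d) - z * b * (-d / Triality.nm z c d) = p at hy'
    generalize a * (-d / Triality.nm z c d) + b * ((c + d) / Triality.nm z c d) +
      b * (-d / Triality.nm z c d) = q at hy'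
    have h2 : 2 * p + q ≠ 0 ∨ p + 2 * z * q ≠ 0 := by
      -- now `y = N(p, q)`: the form is `N ⊥ -N` up to isometry, with a hyperbolic polar pairing
      by_contra! hc
      obtain ⟨h1, h2⟩ := hc
      have hb : q = -2 * p := by linear_combination h1
      have : p * (1 - 4 * z) = 0 := by rw [hb] at h2; linear_combination h2
      have ha : p = 0 := by simpa [hz] using this
      simp [ha] at hb
      simp [ha, hb, nm_zero] at hy'
      exact hy hy'
    rcases h2 with h2 | h2
    · obtain ⟨t, ht⟩ : ∃ t, x = t * (2 * p + q) + 1 := ⟨(x - 1) / (2 * p + q), by field_simp; ring⟩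
      exact ⟨t * p + 1, t * q, t, 0, by rw [ht, hy']; simp only [Triality.nm]; ring⟩
    · obtain ⟨t, ht⟩ : ∃ t, x = t * (p + 2 * z * q) + z :=
        ⟨(x - z) / (p + 2 * z * q), by rw [div_mul_cancel₀ _ h2]; ring⟩
      exact ⟨t * p, t * q + 1, t, 0, by rw [ht, hy']; simp only [Triality.nm]; ring⟩

lemma Rep.symm {x : L} (hz : 1 - 4 * z ≠ 0) (hx : x ≠ 0) (h : Rep y z x) : Rep x z y := by
  obtain ⟨a, b, c, d, h⟩ := h
  by_cases hn : Triality.nm z c d = 0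
  · by_cases hcd : c ≠ 0 ∨ d ≠ 0
    · exact Rep.of_nm_isotropic hz hn hcd _ _
    · refine Rep.of_isotropic hz hx (a := a) (b := b) (c := 1) (d := 0) ?_ (by simp) _
      rw [h, hn]; simp only [Triality.nm]; ring
  · have hy' : y = Triality.nm z a b * (Triality.nm z c d)⁻¹ - x * (Triality.nm z c d)⁻¹ := by
      field_simp; linear_combination h
    rw [nm_inv hn, nm_mul] at hy'
    exact ⟨_, _, _, _, hy'⟩

lemma Rep.of_add_eq_one {x y : L} (h : x + y = 1) (z : L) : Rep y z x :=
  ⟨1, 0, 1, 0, by simp [Triality.nm]; linear_combination h⟩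

end Rep

theorem I3Trivial.pfisterUniversal {F : Type} [Field F] (h : I3Trivial F) :
    PfisterUniversal F := by
  intro y z x hy hz
  by_cases hx : x = 0
  · exact ⟨0, 0, 0, 0, by simp [hx, nm_zero]⟩
  obtain ⟨W, hW, hW0⟩ := h (-y) (-x) z (by simpa) (by simpa) hz
  let φ : W →ₗ[F] (Fin 2 → F) :=
    LinearMap.pi ![(LinearMap.proj 6).comp W.subtype, (LinearMap.proj 7).comp W.subtype]
  obtain ⟨w, hw, hw0⟩ := Submodule.exists_mem_ne_zero_of_ne_bot
    (LinearMap.ker_ne_bot_of_finrank_lt (f := φ) (by simp [hW]))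
  have h6 : w.1 6 = 0 := by simpa [φ] using congrFun (LinearMap.mem_ker.mp hw) 0
  have h7 : w.1 7 = 0 := by simpa [φ] using congrFun (LinearMap.mem_ker.mp hw) 1
  have hq := hW0 w.1 w.2
  obtain ⟨v, hv⟩ := w
  simp only [pfister3Form] at hq h6 h7
  rw [h6, h7] at hq
  have hq' : nm z (v 0) (v 1) - y * nm z (v 2) (v 3) = x * nm z (v 4) (v 5) := by
    simp only [nm]; linear_combination hq
  by_cases h45 : v 4 ≠ 0 ∨ v 5 ≠ 0
  · by_cases hn : nm z (v 4) (v 5) = 0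
    · exact Rep.of_nm_isotropic hz hn h45 _ _
    · have : x = (nm z (v 0) (v 1) - y * nm z (v 2) (v 3)) / nm z (v 4) (v 5) := by
        rw [hq']; field_simp
      rw [this]
      exact Rep.div ⟨_, _, _, _, rfl⟩ (Rep.nm _ _ _ _)
  · push Not at h45
    refine Rep.of_isotropic hz hy (a := v 0) (b := v 1) (c := v 2) (d := v 3) ?_ ?_ _
    · rw [hq', h45.1, h45.2, nm_zero, mul_zero]
    · by_contra! hc
      apply hw0
      ext i
      fin_cases i <;> simp [h45, hc, h6, h7]

section QuadExt

lemma Rep.map {F K : Type} [Field F] [Field K] [Algebra F K] {y z x : F} (h : Rep y z x) :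
    Rep (algebraMap F K y) (algebraMap F K z) (algebraMap F K x) := by
  obtain ⟨p, q, r, s, rfl⟩ := h
  exact ⟨algebraMap F K p, algebraMap F K q, algebraMap F K r, algebraMap F K s,
    by simp [Triality.nm]⟩

variable {F K : Type} [Field F] [Field K] [Algebra F K] (hF : PfisterUniversal F)
  {θ : K} {c : F} (hθ : θ * θ = θ - algebraMap F K c)
  (hspan : ∀ x : K, ∃ a b : F, x = algebraMap F K a + algebraMap F K b * θ)

include hF hθ hspan in
lemma rep_of_base {y z : F} (hy : y ≠ 0) (hz : 1 - 4 * z ≠ 0) (x : K) :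
    Rep (algebraMap F K y) (algebraMap F K z) x := by
  have hz' : 1 - 4 * algebraMap F K z ≠ 0 := by
    intro h
    apply hz
    apply (algebraMap F K).injective
    simpa [map_ofNat (algebraMap F K) 4] using h
  have hy' : algebraMap F K y ≠ 0 := by simpa
  by_cases hx : x ∈ Set.range (algebraMap F K)
  · obtain ⟨x, rfl⟩ := hx
    exact (hF y z x hy hz).map
  obtain ⟨a, b, hab⟩ := id (hspan x)
  obtain ⟨x', t, n, ht, hn⟩ : ∃ (x' : K) (t n : F), x + x' = algebraMap F K t ∧
      x * x' = algebraMap F K n :=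
    ⟨algebraMap F K (2 * a + b) - x, 2 * a + b, a * a + a * b + c * (b * b), by ring, by
      rw [hab]
      simp only [map_add, map_mul, map_ofNat]
      linear_combination (-algebraMap F K b ^ 2) * hθ⟩
  have hx0 : x ≠ 0 := by rintro rfl; exact hx ⟨0, by simp⟩
  obtain ⟨p, q, r, s, hv⟩ := hF y z n hy hz
  have hv' := congrArg (algebraMap F K) hv
  simp only [nm, map_sub, map_add, map_mul] at hv'
  have key : x * (nm (algebraMap F K z) (algebraMap F K p + x') (algebraMap F K q) -
      algebraMap F K y * nm (algebraMap F K z) (algebraMap F K r) (algebraMap F K s)) =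
      algebraMap F K (n * (t + 2 * p + q)) := by
    simp only [nm, map_add, map_mul, map_ofNat]
    linear_combination (-x) * hv' + (x' + 2 * algebraMap F K p + algebraMap F K q) * hn
      + algebraMap F K n * ht
  by_cases h0 : nm (algebraMap F K z) (algebraMap F K p + x') (algebraMap F K q) -
      algebraMap F K y * nm (algebraMap F K z) (algebraMap F K r) (algebraMap F K s) = 0
  · refine Rep.of_isotropic hz' hy' h0 (Or.inl (Or.inl ?_)) _
    intro h
    exact hx ⟨t + p, by rw [map_add, ← ht]; linear_combination h⟩
  · rw [eq_div_of_mul_eq h0 key]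
    exact Rep.div ((hF y z _ hy hz).map) ⟨_, _, _, _, rfl⟩

include hspan in
/-- The symbol relation of a quadratic extension: it suffices to treat slots in the base. -/
lemma rep_of_forall_base {z : K} (hz : 1 - 4 * z ≠ 0)
    (h : ∀ f : F, f ≠ 0 → ∀ y : K, y ≠ 0 → Rep y z (algebraMap F K f))
    (x y : K) (hx : x ≠ 0) (hy : y ≠ 0) : Rep y z x := by
  by_cases hxF : x ∈ Set.range (algebraMap F K)
  · obtain ⟨x, rfl⟩ := hxF
    exact h x (by simpa using hx) y hy
  by_cases hyF : y ∈ Set.range (algebraMap F K)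
  · obtain ⟨y, rfl⟩ := hyF
    exact Rep.symm hz hy (h y (by simpa using hy) x hx)
  obtain ⟨g, e, hge⟩ : ∃ g e : F, x = algebraMap F K g + algebraMap F K e * y := by
    obtain ⟨a, b, hab⟩ := hspan x
    obtain ⟨a', b', hab'⟩ := hspan y
    have hb' : b' ≠ 0 := by
      rintro rfl
      exact hyF ⟨a', by simp [hab']⟩
    have hb'' : algebraMap F K b' ≠ 0 := by simpa
    refine ⟨a - b / b' * a', b / b', ?_⟩
    rw [hab, hab']
    simp only [map_sub, map_mul, map_div₀]
    field_simp
    ring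
  have he : e ≠ 0 := by
    rintro rfl
    exact hxF ⟨g, by simp [hge]⟩
  have he' : algebraMap F K e ≠ 0 := by simpa
  by_cases hg : g = 0
  · have : x = algebraMap F K (-e) * -y := by rw [hge, hg]; simp
    rw [this]
    exact (h (-e) (by simpa) y hy).mul (Rep.neg_self y z)
  have hg' : algebraMap F K g ≠ 0 := by simpa
  have hxg : x / algebraMap F K g ≠ 0 := div_ne_zero hx hg'
  have h1 : Rep (x / algebraMap F K g) z y := by
    have : y = algebraMap F K (-g / e) * (-(algebraMap F K e * y) / algebraMap F K g) := by
      simp only [map_div₀, map_neg]; field_simp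
    rw [this]
    refine (h _ (div_ne_zero (by simpa) he) _ hxg).mul (Rep.of_add_eq_one ?_ z)
    rw [← add_div, div_eq_one_iff_eq hg']
    rw [hge]; ring
  have h2 := (Rep.symm hz hy h1).mul (h g hg y hy)
  rwa [div_mul_cancel₀ _ hg'] at h2

lemma rep_iff_diag {L : Type} [Field L] (h2 : (2 : L) ≠ 0) {y z x : L} :
    Rep y z x ↔ ∃ p q r s, x = p * p - (1 - 4 * z) * (q * q) -
      y * (r * r - (1 - 4 * z) * (s * s)) := by
  constructor
  · rintro ⟨p, q, r, s, rfl⟩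
    refine ⟨p + q / 2, q / 2, r + s / 2, s / 2, ?_⟩
    simp only [nm]; field_simp; ring
  · rintro ⟨p, q, r, s, rfl⟩
    refine ⟨p - q, 2 * q, r - s, 2 * s, ?_⟩
    simp only [nm]; ring

lemma rep_swap {L : Type} [Field L] (h2 : (2 : L) ≠ 0) {y z x : L} (h : Rep y z x) :
    Rep (1 - 4 * z) ((1 - y) / 4) x := by
  have h4 : (4 : L) ≠ 0 := by
    have : (4 : L) = 2 * 2 := by norm_num
    rw [this]; exact mul_ne_zero h2 h2
  rw [rep_iff_diag h2] at *
  obtain ⟨p, q, r, s, rfl⟩ := h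
  refine ⟨p, r, q, s, ?_⟩
  field_simp; ring

include hF hθ hspan in
lemma rep_all_of_two_ne_zero (h2 : (2 : K) ≠ 0) (f : F) (hf : f ≠ 0) (y z : K) (hy : y ≠ 0)
    (hz : 1 - 4 * z ≠ 0) : Rep y z (algebraMap F K f) := by
  have h4 : (4 : K) ≠ 0 := by
    have : (4 : K) = 2 * 2 := by norm_num
    rw [this]; exact mul_ne_zero h2 h2
  have hf' : algebraMap F K f ≠ 0 := by simpa
  have hF4 : (4 : F) ≠ 0 := fun h =>
    h4 (by simpa [map_ofNat (algebraMap F K) 4] using congrArg (algebraMap F K) h)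
  apply Rep.symm hz hy
  have hfz : 1 - 4 * ((1 - algebraMap F K f) / 4) ≠ 0 := by
    field_simp; simpa using hf'
  suffices H : Rep (1 - 4 * z) ((1 - algebraMap F K f) / 4) y by
    have := rep_swap h2 H
    have e1 : (1 : K) - 4 * ((1 - algebraMap F K f) / 4) = algebraMap F K f := by
      field_simp; ring
    have e2 : (1 - (1 - 4 * z)) / 4 = z := by field_simp; ring
    rwa [e1, e2] at this
  refine rep_of_forall_base hspan hfz ?_ _ _ hy hz
  intro g hg w hw
  apply Rep.symm hfz hw
  have := rep_of_base hF hθ hspan (y := g) (z := (1 - f) / 4) hg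
    (by field_simp; simpa using hf) w
  simpa [map_ofNat (algebraMap F K) 4] using this

lemma rep_of_rep_neg_mul {L : Type} [Field L] {y z x : L} (hz : 1 - 4 * z ≠ 0) (hx : x ≠ 0)
    (hy : y ≠ 0) (h : Rep (-(x * y)) z x) : Rep y z x := by
  have h1 : Rep (-(x * y)) z y := by
    have := (h.inv.mul (Rep.neg_self (-(x * y)) z))
    rwa [neg_neg, inv_mul_cancel_left₀ hx] at this
  have h2 := (Rep.symm hz hy h1).div (Rep.neg_self y z)
  rwa [neg_div_neg_eq, mul_div_cancel_right₀ _ hy] at h2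

section CharTwo

variable {L : Type} [Field L] (h2 : (2 : L) = 0)

include h2

lemma rep_add_artinSchreier {y z x : L} (α : L) (h : Rep y (z + α * α + α) x) : Rep y z x := by
  obtain ⟨p, q, r, s, rfl⟩ := h
  refine ⟨p + α * q, q, r + α * s, s, ?_⟩
  simp only [nm]
  linear_combination (-α * p * q + y * α * r * s) * h2

lemma rep_add_mul_sq {y z x : L} (β : L) (h : Rep y (z + y * (β * β)) x) : Rep y z x := by
  obtain ⟨p, q, r, s, rfl⟩ := h
  refine ⟨p + β * y * s, q, r + β * q, s, ?_⟩
  simp only [nm]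
  linear_combination (-β * y * p * s + β * y * r * q + β * β * y * q * q
    - β * β * y * y * s * s ) * h2

lemma rep_add_mul_sq' {y z x : L} (hx : x ≠ 0) (hy : y ≠ 0) (β : L)
    (h : Rep y (z + x * (β * β)) x) : Rep y z x := by
  have hz : ∀ z : L, 1 - 4 * z ≠ 0 := fun z => by
    have : 1 - 4 * z = 1 := by linear_combination (-2 * z) * h2
    rw [this]; exact one_ne_zero
  exact Rep.symm (hz _) hy (rep_add_mul_sq h2 β (Rep.symm (hz _) hx h))

lemma rep_add_mul_mul_sq {y z x : L} (hx : x ≠ 0) (hy : y ≠ 0) (β : L)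
    (h : Rep y (z + x * y * (β * β)) x) : Rep y z x := by
  have hz : ∀ z : L, 1 - 4 * z ≠ 0 := fun z => by
    have : 1 - 4 * z = 1 := by linear_combination (-2 * z) * h2
    rw [this]; exact one_ne_zero
  have hneg : ∀ t : L, -t = t := fun t => by linear_combination (-t) * h2
  apply rep_of_rep_neg_mul (hz _) hx hy
  rw [hneg]
  apply rep_add_mul_sq h2 β
  apply rep_of_rep_neg_mul (hz _) hx (mul_ne_zero hx hy)
  rw [← mul_assoc, hneg]
  obtain ⟨p, q, r, s, h⟩ := h
  refine ⟨p, q, r / x, s / x, h.trans ?_⟩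
  simp only [nm]
  field_simp

lemma exists_char_two_eq (hL : PfisterUniversal L) {f g : L} (hf : f ≠ 0) (hg : g ≠ 0) (z : L) :
    ∃ α γ β δ : L, z + α * α + α + f * (γ * γ) + g * (β * β) + f * g * (δ * δ) = 0 := by
  have hz : 1 - 4 * z ≠ 0 := by
    have : 1 - 4 * z = 1 := by linear_combination (-2 * z) * h2
    rw [this]; exact one_ne_zero
  obtain ⟨u0, u1, v0, v1, h⟩ := hL f z g hf hz
  simp only [nm] at h
  by_cases hw : u1 * u1 + f * (v1 * v1) = 0
  · by_cases hv1 : v1 = 0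
    · have hu1 : u1 = 0 := by simpa [hv1] using hw
      subst hu1 hv1
      refine ⟨z, 0, u0 * z / g, v0 * z / g, ?_⟩
      field_simp
      linear_combination (-z * z) * h + (z * g + z * z * g + z * z * f * v0 * v0) * h2
    · refine ⟨z, u1 * z / (v1 * f), 0, 0, ?_⟩
      field_simp
      linear_combination (z * z) * hw + (z * v1 * v1 * f) * h2
  · generalize hW : u1 * u1 + f * (v1 * v1) = w at hw
    refine ⟨(u0 * u1 + f * v0 * v1) / w, (u0 * v1 + v0 * u1) / w, u1 / w, v1 / w, ?_⟩
    field_simp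
    rw [← hW, h]
    linear_combination ((u1 * u1 + f * (v1 * v1)) * (z * u1 * u1 + u0 * u0 + u0 * u1)
      + 2 * f * u0 * u1 * v0 * v1) * h2

end CharTwo

include hF hθ hspan in
lemma rep_all_of_two_eq_zero (h2 : (2 : K) = 0) (f : F) (hf : f ≠ 0) (y z : K) (hy : y ≠ 0) :
    Rep y z (algebraMap F K f) := by
  have hf' : algebraMap F K f ≠ 0 := by simpa
  have h2F : (2 : F) = 0 := by
    apply (algebraMap F K).injective
    rw [map_zero, map_ofNat (algebraMap F K) 2, h2]
  have hz : ∀ z : F, 1 - 4 * z ≠ 0 := fun z => by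
    have : 1 - 4 * z = 1 := by linear_combination (-2 * z) * h2F
    rw [this]; exact one_ne_zero
  have hz' : ∀ z : K, 1 - 4 * z ≠ 0 := fun z => by
    have : 1 - 4 * z = 1 := by linear_combination (-2 * z) * h2
    rw [this]; exact one_ne_zero
  have base : ∀ t : F, Rep y (algebraMap F K t) (algebraMap F K f) := fun t =>
    Rep.symm (hz' _) hy (rep_of_base hF hθ hspan hf (hz t) y)
  suffices ∃ α β γ δ : K, ∃ t : F, z + α * α + α + y * (β * β) + algebraMap F K f * (γ * γ) +
      algebraMap F K f * y * (δ * δ) = algebraMap F K t by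
    obtain ⟨α, β, γ, δ, t, h⟩ := this
    apply rep_add_artinSchreier h2 α
    apply rep_add_mul_sq h2 β
    apply rep_add_mul_sq' h2 hf' hy γ
    apply rep_add_mul_mul_sq h2 hf' hy δ
    rw [h]
    exact base t
  obtain ⟨z0, z1, rfl⟩ := hspan z
  obtain ⟨y0, y1, rfl⟩ := hspan y
  by_cases hy1 : y1 = 0
  · subst hy1
    have hy0 : y0 ≠ 0 := by rintro rfl; simp at hy
    obtain ⟨α, γ, β, δ, h⟩ := exists_char_two_eq h2F hF hf hy0 z1
    have h' := congrArg (algebraMap F K) h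
    simp only [map_add, map_mul, map_zero] at h'
    refine ⟨algebraMap F K α * θ, algebraMap F K β * θ, algebraMap F K γ * θ,
      algebraMap F K δ * θ, z0 - (α * α + f * (γ * γ) + y0 * (β * β) + f * y0 * (δ * δ)) * c, ?_⟩
    simp only [map_add, map_mul, map_sub, map_zero]
    set a := algebraMap F K
    linear_combination θ * h' + (a α * a α + a f * (a γ * a γ) + a y0 * (a β * a β) +
      a f * a y0 * (a δ * a δ)) * hθ
  · obtain ⟨α, γ, β, δ, h⟩ := exists_char_two_eq h2F hF hf hy1 z1
    have h' := congrArg (algebraMap F K) h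
    simp only [map_add, map_mul, map_zero] at h'
    refine ⟨algebraMap F K α * θ, algebraMap F K β, algebraMap F K γ * θ,
      algebraMap F K δ, z0 - (α * α + f * (γ * γ)) * c + y0 * (β * β) + f * y0 * (δ * δ), ?_⟩
    simp only [map_add, map_mul, map_sub]
    set a := algebraMap F K
    linear_combination θ * h' + (a α * a α + a f * (a γ * a γ)) * hθ

include hF hθ hspan in
theorem PfisterUniversal.quadExt : PfisterUniversal K := by
  intro y z x hy hz
  by_cases hx : x = 0
  · exact ⟨0, 0, 0, 0, by simp [hx, nm_zero]⟩
  refine rep_of_forall_base hspan hz (fun f hf w hw => ?_) x y hx hy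
  by_cases h2 : (2 : K) = 0
  · exact rep_all_of_two_eq_zero hF hθ hspan h2 f hf w z hw
  · exact rep_all_of_two_ne_zero hF hθ hspan h2 f hf w z hw hz

end QuadExt

section Hermitian

variable {F W : Type} [Field F] [AddCommGroup W] [Module F W] [FiniteDimensional F W]

/-- Finitely many linear conditions on a large space have a nonzero solution. -/
lemma exists_ne_zero_forall_eq_zero {n : ℕ} (φ : Fin n → W →ₗ[F] F) (h : n < finrank F W) :
    ∃ w : W, w ≠ 0 ∧ ∀ i, φ i w = 0 := by
  obtain ⟨w, hw, hw0⟩ := Submodule.exists_mem_ne_zero_of_ne_bot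
    (LinearMap.ker_ne_bot_of_finrank_lt (f := LinearMap.pi φ) (by simpa using h))
  exact ⟨w, hw0, fun i => congrFun (LinearMap.mem_ker.mp hw) i⟩

/-- A quadratic form which is the trace form of a hermitian form over a separable quadratic
extension is isotropic if its dimension is at least six. -/
theorem exists_isotropic_of_hermitian (hF : PfisterUniversal F) {c : F}
    (hc : ∀ x y : F, nm c x y = 0 → x = 0 ∧ y = 0)
    (P : W →ₗ[F] W →ₗ[F] F) (θ : W →ₗ[F] W)
    (hP : ∀ w, P (θ w) (θ w) = c * P w w)
    (hP' : ∀ w, P w (θ w) + P (θ w) w = P w w)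
    (hdim : 6 ≤ finrank F W) : ∃ w : W, w ≠ 0 ∧ P w w = 0 := by
  by_contra! hani
  have h4 : 1 - 4 * c ≠ 0 := fun h => by
    have := hc (-2) 4 (by simp only [nm]; linear_combination (-4) * h)
    have h2 := this.1
    have h' := hc 1 0
    have h1 : (1 : F) = 0 := by
      have e : (2 : F) = 0 := by linear_combination -h2
      linear_combination h + 2 * c * e
    exact one_ne_zero h1
  let b : W →ₗ[F] W →ₗ[F] F := P + P.flip
  have hb : ∀ u v, b u v = P u v + P v u := fun u v => rfl
  have hbθ : ∀ u v, b u (θ v) + b (θ u) v = b u v := fun u v => by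
    have h1 := hP' u
    have h2 := hP' v
    have h3 := hP' (u + v)
    simp only [map_add, LinearMap.add_apply, hb] at *
    linear_combination h3 - h1 - h2
  have hbθθ : ∀ u v, b (θ u) (θ v) = c * b u v := fun u v => by
    have h1 := hP u
    have h2 := hP v
    have h3 := hP (u + v)
    simp only [map_add, LinearMap.add_apply, hb] at *
    linear_combination h3 - h1 - h2
  have orth : ∀ u v, b u v = 0 → b (θ u) v = 0 → b u (θ v) = 0 ∧ b (θ u) (θ v) = 0 :=
    fun u v h1 h2 => ⟨by have := hbθ u v; rw [h1, h2] at this; simpa using this, by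
      rw [hbθθ, h1, mul_zero]⟩
  obtain ⟨u, hu, -⟩ := exists_ne_zero_forall_eq_zero (F := F) (W := W) ![] (by omega)
  obtain ⟨v, hv, hv'⟩ := exists_ne_zero_forall_eq_zero ![b u, b (θ u)] (by omega)
  obtain ⟨w, hw, hw'⟩ := exists_ne_zero_forall_eq_zero ![b u, b (θ u), b v, b (θ v)] (by omega)
  have uv : b u v = 0 := hv' 0
  have uv₃ : b (θ u) v = 0 := hv' 1
  have uw : b u w = 0 := hw' 0
  have uw₃ : b (θ u) w = 0 := hw' 1
  have vw : b v w = 0 := hw' 2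
  have vw₃ : b (θ v) w = 0 := hw' 3
  have huu := hani u hu
  have hvv := hani v hv
  have hww := hani w hw
  obtain ⟨uv₂, uv₄⟩ := orth u v uv uv₃
  obtain ⟨uw₂, uw₄⟩ := orth u w uw uw₃
  obtain ⟨vw₂, vw₄⟩ := orth v w vw vw₃
  obtain ⟨x1, y1, x2, y2, h⟩ := hF (-(P v v) / P u u) c (-(P w w) / P u u)
    (div_ne_zero (by simpa) huu) h4
  have key : nm c x1 y1 * P u u + nm c x2 y2 * P v v + P w w = 0 := by
    field_simp at h
    linear_combination -h
  refine hani (x1 • u + y1 • θ u + (x2 • v + y2 • θ v) + w) ?_ ?_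
  · intro h0
    have h1 := congrArg (fun t => b t (θ w)) h0
    simp only [map_add, map_smul, LinearMap.add_apply, LinearMap.smul_apply, uw₂, uw₄, vw₂, vw₄,
      map_zero, LinearMap.zero_apply, smul_eq_mul, mul_zero, zero_add] at h1
    rw [hb, hP'] at h1
    exact hww h1
  · have hu1 := hP' u
    have hu2 := hP u
    have hv1 := hP' v
    have hv2 := hP v
    simp only [hb] at uv uv₃ uw uw₃ vw vw₃ uv₂ uv₄
    simp only [map_add, map_smul, LinearMap.add_apply, LinearMap.smul_apply, smul_eq_mul]
    simp only [nm] at key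
    linear_combination key + x1 * y1 * hu1 + y1 * y1 * hu2 + x2 * y2 * hv1 + y2 * y2 * hv2
      + x1 * x2 * uv + y1 * x2 * uv₃ + x1 * y2 * uv₂ + y1 * y2 * uv₄ + x1 * uw + y1 * uw₃
      + x2 * vw + y2 * vw₃

end Hermitian

section Spin

variable {F V S : Type} [Field F] [AddCommGroup V] [Module F V]
  [AddCommGroup S] [Module F S]

/-- The polar form of the quadratic form `v ↦ B v v`. -/
def pol (B : V →ₗ[F] V →ₗ[F] F) : V →ₗ[F] V →ₗ[F] F := B + B.flip

lemma pol_apply (B : V →ₗ[F] V →ₗ[F] F) (u v : V) : pol B u v = B u v + B v u := rfl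

lemma pol_comm (B : V →ₗ[F] V →ₗ[F] F) (u v : V) : pol B u v = pol B v u := by
  simp [pol_apply, add_comm]

/-- A half-spin representation of the even Clifford algebra of `v ↦ B v v`: here `β u v`
is the image of the product `u v`. -/
structure IsSpin (B : V →ₗ[F] V →ₗ[F] F) (β : V →ₗ[F] V →ₗ[F] Module.End F S) : Prop where
  self : ∀ v, β v v = B v v • (1 : Module.End F S)
  mul : ∀ u v w, β u v * β v w = B v v • β u w
  gen : Algebra.adjoin F (Set.range fun p : V × V => β p.1 p.2) = ⊤
  nondeg : ∀ v, (∀ w, pol B v w = 0) → v = 0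

/-- A totally singular subspace of the quadratic form `v ↦ B v v`. -/
def TotSing (B : V →ₗ[F] V →ₗ[F] F) (W : Submodule F V) : Prop := ∀ w ∈ W, B w w = 0

lemma TotSing.pol_eq_zero {B : V →ₗ[F] V →ₗ[F] F} {W : Submodule F V} (h : TotSing B W)
    {u v : V} (hu : u ∈ W) (hv : v ∈ W) : pol B u v = 0 := by
  have h1 := h _ (W.add_mem hu hv)
  simp only [map_add, LinearMap.add_apply, h u hu, h v hv] at h1
  rw [pol_apply]; linear_combination h1

variable {B : V →ₗ[F] V →ₗ[F] F} {β : V →ₗ[F] V →ₗ[F] Module.End F S}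

lemma exists_anisotropic [Nontrivial V] (h : ∀ v, (∀ w, pol B v w = 0) → v = 0) :
    ∃ v, B v v ≠ 0 := by
  by_contra! hq
  obtain ⟨v, hv⟩ := exists_ne (0 : V)
  exact hv (h v fun w => TotSing.pol_eq_zero (W := ⊤) (fun w _ => hq w) trivial trivial)

lemma exists_hyperbolic_partner (h : ∀ v, (∀ w, pol B v w = 0) → v = 0) {e : V} (he : e ≠ 0)
    (hq : B e e = 0) : ∃ f, B f f = 0 ∧ pol B e f = 1 := by
  obtain ⟨f, hf⟩ : ∃ f, pol B e f ≠ 0 := by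
    by_contra! h'
    exact he (h e h')
  obtain ⟨g, hg⟩ : ∃ g, pol B e g = 1 :=
    ⟨(pol B e f)⁻¹ • f, by rw [map_smul, smul_eq_mul, inv_mul_cancel₀ hf]⟩
  refine ⟨g - B g g • e, ?_, ?_⟩
  · simp only [map_sub, map_smul, LinearMap.sub_apply, LinearMap.smul_apply, smul_eq_mul, hq,
      pol_apply] at *
    linear_combination (-B g g) * hg
  · rw [map_sub, hg, map_smul, pol_apply B e e, hq]; simp

namespace IsSpin

variable (h : IsSpin B β)

include h

lemma anti (v w : V) : β v w + β w v = pol B v w • (1 : Module.End F S) := by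
  have h1 := h.self (v + w)
  simp only [map_add, LinearMap.add_apply, add_smul, h.self v, h.self w] at h1
  rw [pol_apply, add_smul]
  linear_combination (norm := module) (1 : F) • h1

lemma mul_add_mul (u v v' w : V) :
    β u v * β v' w + β u v' * β v w = pol B v v' • β u w := by
  have h1 := h.mul u (v + v') w
  simp only [map_add, LinearMap.add_apply, add_smul, mul_add, add_mul, h.mul u v w,
    h.mul u v' w] at h1
  rw [pol_apply, add_smul]
  linear_combination (norm := module) (1 : F) • h1

lemma swap {v w : V} (hvw : pol B v w = 0) : β w v = -β v w := by
  have := h.anti v w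
  rw [hvw, zero_smul] at this
  exact eq_neg_of_add_eq_zero_right this

lemma mul_swap {v v' : V} (hvw : pol B v v' = 0) (u w : V) :
    β u v * β v' w = -(β u v' * β v w) := by
  have := h.mul_add_mul u v v' w
  rw [hvw, zero_smul] at this
  exact eq_neg_of_add_eq_zero_left this

end IsSpin

/-- The orthogonal complement of the plane spanned by `e` and `f`. -/
def orthPair (B : V →ₗ[F] V →ₗ[F] F) (e f : V) : Submodule F V :=
  LinearMap.ker (pol B e) ⊓ LinearMap.ker (pol B f)

lemma mem_orthPair {e f v : V} : v ∈ orthPair B e f ↔ pol B e v = 0 ∧ pol B f v = 0 := by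
  simp [orthPair]

lemma orthPair_comm (e f : V) : orthPair B e f = orthPair B f e := inf_comm _ _

section Reduction

variable {e f : V} (he : B e e = 0) (hf : B f f = 0) (hef : pol B e f = 1)

include he hf hef

lemma sub_mem_orthPair (v : V) : v - pol B f v • e - pol B e v • f ∈ orthPair B e f := by
  rw [mem_orthPair]
  have hfe : pol B f e = 1 := by rw [pol_comm, hef]
  constructor
  · rw [map_sub, map_sub, map_smul, map_smul, hef]; simp [pol_apply, he]
  · rw [map_sub, map_sub, map_smul, map_smul, hfe]; simp [pol_apply, hf]

lemma exists_decomp (v : V) : ∃ a b : F, ∃ u ∈ orthPair B e f, v = a • e + b • f + u :=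
  ⟨pol B f v, pol B e v, _, sub_mem_orthPair he hf hef v, by abel⟩

lemma finrank_orthPair [FiniteDimensional F V] : finrank F (orthPair B e f) + 2 = finrank F V := by
  have hfe : pol B f e = 1 := by rw [pol_comm, hef]
  have he' : pol B e e = 0 := by simp [pol_apply, he]
  have hf' : pol B f f = 0 := by simp [pol_apply, hf]
  let φ : V →ₗ[F] F × F := (pol B e).prod (pol B f)
  have hφ : LinearMap.range φ = ⊤ := by
    rw [LinearMap.range_eq_top]
    rintro ⟨a, b⟩
    refine ⟨b • e + a • f, Prod.ext ?_ ?_⟩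
    · change pol B e (b • e + a • f) = a
      rw [map_add, map_smul, map_smul, hef, he']; simp
    · change pol B f (b • e + a • f) = b
      rw [map_add, map_smul, map_smul, hfe, hf']; simp
  have := LinearMap.finrank_range_add_finrank_ker φ
  rw [hφ, finrank_top, finrank_prod, finrank_self, LinearMap.ker_prod] at this
  rw [orthPair]; omega

lemma orthPair_nondeg (hB : ∀ v, (∀ w, pol B v w = 0) → v = 0) :
    ∀ v, (∀ w, pol (B.domRestrict₁₂ (orthPair B e f) (orthPair B e f)) v w = 0) → v = 0 := by
  intro v hv
  ext
  apply hB v.1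
  intro w
  obtain ⟨a, b, u, hu, rfl⟩ := exists_decomp he hf hef w
  have h1 := mem_orthPair.mp v.2
  have h2 := hv ⟨u, hu⟩
  rw [map_add, map_add, map_smul, map_smul, pol_comm B v.1 e, pol_comm B v.1 f, h1.1, h1.2]
  simpa [pol_apply, LinearMap.domRestrict₁₂_apply] using h2

end Reduction

end Spin

section SpinReduction

variable {F V S : Type} [Field F] [AddCommGroup V] [Module F V]
  [AddCommGroup S] [Module F S] {B : V →ₗ[F] V →ₗ[F] F} {β : V →ₗ[F] V →ₗ[F] Module.End F S}

namespace IsSpin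

variable (h : IsSpin B β) {e f : V} (he : B e e = 0) (hf : B f f = 0) (hef : pol B e f = 1)

include h

lemma mul_orth_left (hef : pol B e f = 1) : β f e = 1 - β e f := by
  have := h.anti e f
  rw [hef, one_smul] at this
  exact eq_sub_of_add_eq' this

lemma proj_mul_left {u : V} (he : B e e = 0) (hef : pol B e f = 1) :
    β e f * β e u = β e u := by
  have h1 := h.mul f e u
  rw [he, zero_smul, h.mul_orth_left hef, sub_mul, one_mul, sub_eq_zero] at h1
  exact h1.symm

lemma proj_mul_right {u : V} (he : B e e = 0) (hu : pol B e u = 0) :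
    β e u * β e f = 0 := by
  have h1 := h.mul u e f
  rw [he, zero_smul, h.swap hu, neg_mul, neg_eq_zero] at h1
  exact h1

lemma proj_mul_zero {u : V} (hf : B f f = 0) : β e f * β f u = 0 := by
  rw [h.mul, hf, zero_smul]

lemma commute_proj {u v : V} (hu : u ∈ orthPair B e f) (hv : v ∈ orthPair B e f) :
    β e f * β u v = β u v * β e f := by
  rw [mem_orthPair] at hu hv
  have h1 := h.mul_swap hu.2 e v
  have h2 := h.mul_swap (v := v) (v' := e) (by rw [pol_comm]; exact hv.1) u f
  rw [h1, h2, h.swap hu.1, h.swap hv.2]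
  simp

lemma mul_proj_eq {u v : V} (hu : u ∈ orthPair B e f) :
    β e u * β f v = -(β e f * β u v) := by
  rw [mem_orthPair] at hu
  rw [h.mul_swap (by rw [pol_comm]; exact hu.2)]

lemma mul_same {u v : V} (he : B e e = 0) (hu : pol B e u = 0) : β e u * β e v = 0 := by
  rw [h.mul_swap (by rw [pol_comm]; exact hu), h.self, he]; simp

lemma isotropic_mul {u v w : V} (hv : v ∈ orthPair B e f)
    (hw : w ∈ orthPair B e f) :
    β e u * β v w = β v w * β e u - pol B u w • β e v + pol B u v • β e w := by
  rw [mem_orthPair] at hv hw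
  have h1 := h.mul_add_mul e u v w
  have h2 := h.mul_swap (v := w) (v' := e) (by rw [pol_comm]; exact hw.1) v u
  rw [h.swap hv.1] at h2
  have h3 := h.anti u w
  have h4 : β w u = pol B u w • 1 - β u w := eq_sub_of_add_eq' h3
  rw [h4, neg_mul, neg_neg, mul_sub, mul_smul_comm, mul_one] at h2
  linear_combination (norm := module) (1 : F) • h1 - (1 : F) • h2

/-- Restriction of a spin representation to the complement of a hyperbolic pair. -/
def restr (e f : V) : (orthPair B e f) →ₗ[F] (orthPair B e f) →ₗ[F]
    Module.End F (LinearMap.range (β e f)) :=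
  LinearMap.mk₂ F (fun u v => (β u v).restrict (p := LinearMap.range (β e f))
      (q := LinearMap.range (β e f)) (by
        rintro _ ⟨s, rfl⟩
        exact ⟨β u v s, DFunLike.congr_fun (h.commute_proj u.2 v.2) s⟩))
    (fun u u' v => by ext; simp [LinearMap.restrict_apply])
    (fun c u v => by ext; simp [LinearMap.restrict_apply])
    (fun u v v' => by ext; simp [LinearMap.restrict_apply])
    (fun c u v => by ext; simp [LinearMap.restrict_apply])

@[simp] lemma restr_apply (u v : orthPair B e f) (s : LinearMap.range (β e f)) :
    ((h.restr e f u v s : LinearMap.range (β e f)) : S) = β u v s := rfl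

include he hf hef in
/-- Every endomorphism is in the left module over the even Clifford algebra of the
complement generated by the two projections and the odd elements. -/
lemma mem_span (x : Module.End F S) :
    x ∈ Submodule.span
      (Algebra.adjoin F (Set.range fun p : orthPair B e f × orthPair B e f => β p.1 p.2))
      ({β e f, β f e} ∪ (Set.range fun u : orthPair B e f => β e u) ∪
        Set.range fun u : orthPair B e f => β f u) := by
  set R := Algebra.adjoin F (Set.range fun p : orthPair B e f × orthPair B e f => β p.1 p.2)
    with hR
  set G : Set (Module.End F S) := {β e f, β f e} ∪ (Set.range fun u : orthPair B e f => β e u) ∪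
        Set.range fun u : orthPair B e f => β f u with hG
  set M := Submodule.span R G with hM
  have hfe : pol B f e = 1 := by rw [pol_comm, hef]
  have hsm : ∀ (c : F) (x : Module.End F S), x ∈ M → c • x ∈ M := fun c x hx => by
    have : c • x = (⟨algebraMap F _ c, R.algebraMap_mem c⟩ : R) • x := by
      rw [Subalgebra.smul_def, Algebra.smul_def]; rfl
    rw [this]; exact M.smul_mem _ hx
  have hR' : ∀ u ∈ orthPair B e f, ∀ v ∈ orthPair B e f, ∀ x ∈ M, β u v * x ∈ M :=
    fun u hu v hv x hx => M.smul_mem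
      (⟨β u v, Algebra.subset_adjoin ⟨(⟨u, hu⟩, ⟨v, hv⟩), rfl⟩⟩ : R) hx
  have m1 : β e f ∈ M := Submodule.subset_span (by simp [G])
  have m2 : β f e ∈ M := Submodule.subset_span (by simp [G])
  have m3 : ∀ u ∈ orthPair B e f, β e u ∈ M := fun u hu =>
    Submodule.subset_span (Or.inl (Or.inr ⟨⟨u, hu⟩, rfl⟩))
  have m4 : ∀ u ∈ orthPair B e f, β f u ∈ M := fun u hu =>
    Submodule.subset_span (Or.inr ⟨⟨u, hu⟩, rfl⟩)
  have m0 : (1 : Module.End F S) ∈ M := by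
    have := M.add_mem m1 m2
    rwa [h.mul_orth_left hef, add_sub_cancel] at this
  have comm' : orthPair B f e = orthPair B e f := orthPair_comm _ _
  -- closure under right multiplication by the generators
  let P : Module.End F S → Prop := fun y => ∀ m ∈ M, m * y ∈ M
  have ofG : ∀ y, (∀ g ∈ G, g * y ∈ M) → P y := by
    intro y hy m hm
    induction hm using Submodule.span_induction with
    | mem x hx => exact hy x hx
    | zero => rw [zero_mul]; exact M.zero_mem
    | add x x' _ _ hx hx' => rw [add_mul]; exact M.add_mem hx hx'
    | smul r x _ hx => rw [smul_mul_assoc]; exact M.smul_mem _ hx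
  have Padd : ∀ y y', P y → P y' → P (y + y') := fun y y' hy hy' m hm => by
    rw [mul_add]; exact M.add_mem (hy m hm) (hy' m hm)
  have Psmul : ∀ (c : F) y, P y → P (c • y) := fun c y hy m hm => by
    rw [mul_smul_comm]; exact hsm _ _ (hy m hm)
  have Pneg : ∀ y, P y → P (-y) := fun y hy => by
    have := Psmul (-1) y hy; rwa [neg_one_smul] at this
  have P0 : P 0 := fun m _ => by rw [mul_zero]; exact M.zero_mem
  have forG : ∀ y, β e f * y ∈ M → β f e * y ∈ M →
      (∀ u ∈ orthPair B e f, β e u * y ∈ M) → (∀ u ∈ orthPair B e f, β f u * y ∈ M) → P y := by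
    intro y h1 h2 h3 h4
    apply ofG
    rintro g (((rfl | rfl) | ⟨u, rfl⟩) | ⟨u, rfl⟩)
    exacts [h1, h2, h3 _ u.2, h4 _ u.2]
  have Pef : P (β e f) := by
    apply forG
    · rw [h.proj_mul_left he hef]; exact m1
    · rw [h.proj_mul_zero he]; exact M.zero_mem
    · intro u hu
      rw [h.proj_mul_right he (mem_orthPair.mp hu).1]; exact M.zero_mem
    · intro u hu
      have : β f u * β e f = β f u * (1 - β f e) := by rw [h.mul_orth_left hef, sub_sub_cancel]
      rw [this, mul_sub, mul_one, h.proj_mul_right hf (mem_orthPair.mp hu).2, sub_zero]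
      exact m4 u hu
  have Pfe : P (β f e) := by
    rw [h.mul_orth_left hef]
    intro m hm
    rw [mul_sub, mul_one]
    exact M.sub_mem hm (Pef m hm)
  have Peu : ∀ u ∈ orthPair B e f, P (β e u) := by
    intro u hu
    apply forG
    · rw [h.proj_mul_left he hef]; exact m3 u hu
    · rw [h.proj_mul_zero he]; exact M.zero_mem
    · intro v hv
      rw [h.mul_same he (mem_orthPair.mp hv).1]; exact M.zero_mem
    · intro v hv
      rw [h.mul_proj_eq (comm' ▸ hv), h.commute_proj (comm' ▸ hv) (comm' ▸ hu)]
      exact M.neg_mem (hR' _ hv _ hu _ m2)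
  have Pfu : ∀ u ∈ orthPair B e f, P (β f u) := by
    intro u hu
    apply forG
    · rw [h.proj_mul_zero hf]; exact M.zero_mem
    · rw [h.proj_mul_left hf hfe]; exact m4 u hu
    · intro v hv
      rw [h.mul_proj_eq hv, h.commute_proj hv hu]
      exact M.neg_mem (hR' _ hv _ hu _ m1)
    · intro v hv
      rw [h.mul_same hf (mem_orthPair.mp hv).2]; exact M.zero_mem
  have Puv : ∀ u ∈ orthPair B e f, ∀ v ∈ orthPair B e f, P (β u v) := by
    intro u hu v hv
    apply forG
    · rw [h.commute_proj hu hv]; exact hR' _ hu _ hv _ m1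
    · rw [h.commute_proj (comm' ▸ hu) (comm' ▸ hv)]; exact hR' _ hu _ hv _ m2
    · intro w hw
      rw [h.isotropic_mul hu hv]
      exact M.add_mem (M.sub_mem (hR' _ hu _ hv _ (m3 w hw)) (hsm _ _ (m3 u hu)))
        (hsm _ _ (m3 v hv))
    · intro w hw
      rw [h.isotropic_mul (comm' ▸ hu) (comm' ▸ hv)]
      exact M.add_mem (M.sub_mem (hR' _ hu _ hv _ (m4 w hw)) (hsm _ _ (m4 u hu)))
        (hsm _ _ (m4 v hv))
  have Palg : ∀ c : F, P (algebraMap F _ c) := fun c m hm => by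
    rw [← Algebra.commutes, ← Algebra.smul_def]
    exact hsm _ _ hm
  have Pmul : ∀ y y', P y → P y' → P (y * y') := fun y y' hy hy' m hm => by
    rw [← mul_assoc]; exact hy' _ (hy _ hm)
  have PM : ∀ y, P y → y ∈ M := fun y hy => by simpa using hy 1 m0
  clear_value P
  have Pall : ∀ v w, P (β v w) := by
    intro v w
    obtain ⟨a, b, u, hu, rfl⟩ := exists_decomp he hf hef v
    obtain ⟨a', b', u', hu', rfl⟩ := exists_decomp he hf hef w
    simp only [map_add, map_smul, LinearMap.add_apply, LinearMap.smul_apply, h.self e, h.self f,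
      he, hf, zero_smul, h.swap (mem_orthPair.mp hu).1, h.swap (mem_orthPair.mp hu).2]
    repeat' first
      | exact P0
      | exact Pef
      | exact Pfe
      | exact Peu _ hu
      | exact Peu _ hu'
      | exact Pfu _ hu
      | exact Pfu _ hu'
      | exact Puv _ hu _ hu'
      | apply Padd
      | apply Psmul
      | apply Pneg
  have hx : x ∈ (⊤ : Subalgebra F (Module.End F S)) := trivial
  rw [← h.gen] at hx
  have : P x := by
    induction hx using Algebra.adjoin_induction with
    | mem x hx => obtain ⟨p, rfl⟩ := hx; exact Pall _ _
    | algebraMap r => exact Palg r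
    | add x y _ _ hx hy => exact Padd _ _ hx hy
    | mul x y _ _ hx hy => exact Pmul _ _ hx hy
  exact PM _ this

include he hf hef in
/-- The restriction of a spin representation is again one. -/
theorem restr_isSpin : IsSpin (B.domRestrict₁₂ (orthPair B e f) (orthPair B e f))
    (h.restr e f) where
  self v := by
    ext s
    simp [h.self, LinearMap.domRestrict₁₂_apply]
  mul u v w := by
    ext s
    have := DFunLike.congr_fun (h.mul u v w) (s : S)
    simpa [LinearMap.domRestrict₁₂_apply] using this
  gen := by
    set R := Algebra.adjoin F (Set.range fun p : orthPair B e f × orthPair B e f => β p.1 p.2)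
    set R' := Algebra.adjoin F
      (Set.range fun p : orthPair B e f × orthPair B e f => h.restr e f p.1 p.2)
    have hfe : pol B f e = 1 := by rw [pol_comm, hef]
    have hpp : β e f * β e f = β e f := h.proj_mul_left he hef
    have hfix : ∀ s : LinearMap.range (β e f), β e f s = s := by
      rintro ⟨_, s, rfl⟩
      exact DFunLike.congr_fun hpp s
    -- elements of `R` restrict to elements of `R'`
    have hR : ∀ r ∈ R, ∃ r' ∈ R', (∀ s : LinearMap.range (β e f), (r' s : S) = r s) := by
      intro r hr
      induction hr using Algebra.adjoin_induction with
      | mem x hx =>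
        obtain ⟨p, rfl⟩ := hx
        exact ⟨h.restr e f p.1 p.2, Algebra.subset_adjoin ⟨p, rfl⟩, fun s => rfl⟩
      | algebraMap c => exact ⟨algebraMap F _ c, R'.algebraMap_mem c, fun s => rfl⟩
      | add x y _ _ hx hy =>
        obtain ⟨x', hx', hx⟩ := hx
        obtain ⟨y', hy', hy⟩ := hy
        exact ⟨x' + y', R'.add_mem hx' hy', fun s => by simp [hx, hy]⟩
      | mul x y _ _ hx hy =>
        obtain ⟨x', hx', hx⟩ := hx
        obtain ⟨y', hy', hy⟩ := hy
        exact ⟨x' * y', R'.mul_mem hx' hy', fun s => by simp [hx, hy]⟩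
    -- compression of an arbitrary endomorphism
    have key : ∀ x : Module.End F S, ∃ r ∈ R, ∀ s : LinearMap.range (β e f),
        β e f (x s) = r s := by
      intro x
      have hx := h.mem_span he hf hef x
      induction hx using Submodule.span_induction with
      | mem x hx =>
        rcases hx with ((rfl | rfl) | ⟨u, rfl⟩) | ⟨u, rfl⟩
        · exact ⟨1, R.one_mem, fun s => by rw [hfix, hfix]; simp⟩
        · refine ⟨0, R.zero_mem, fun s => ?_⟩
          have := DFunLike.congr_fun (h.proj_mul_zero (e := e) (u := e) hf) (s : S)
          simpa using this
        · refine ⟨0, R.zero_mem, fun s => ?_⟩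
          have := DFunLike.congr_fun (h.proj_mul_right he (f := f)
            (mem_orthPair.mp u.2).1) (s : S)
          rw [Module.End.mul_apply, hfix] at this
          change β e f (β e u s) = 0
          rw [this]; simp
        · refine ⟨0, R.zero_mem, fun s => ?_⟩
          have := DFunLike.congr_fun (h.proj_mul_zero (e := e) (u := u.1) hf) (s : S)
          simpa using this
      | zero => exact ⟨0, R.zero_mem, fun s => by simp⟩
      | add x y _ _ hx hy =>
        obtain ⟨x', hx', hx⟩ := hx
        obtain ⟨y', hy', hy⟩ := hy
        exact ⟨x' + y', R.add_mem hx' hy', fun s => by simp [hx, hy]⟩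
      | smul r x _ hx =>
        obtain ⟨x', hx', hx⟩ := hx
        refine ⟨r.1 * x', R.mul_mem r.2 hx', fun s => ?_⟩
        have hc : r.1 ∈ Subalgebra.centralizer F {β e f} := by
          have : R ≤ Subalgebra.centralizer F {β e f} := by
            apply Algebra.adjoin_le
            rintro _ ⟨p, rfl⟩
            rw [SetLike.mem_coe, Subalgebra.mem_centralizer_iff]
            rintro _ rfl
            exact h.commute_proj p.1.2 p.2.2
          exact this r.2
        rw [Subalgebra.mem_centralizer_iff] at hc
        have := DFunLike.congr_fun (hc _ rfl) (x s)
        rw [Module.End.mul_apply, Module.End.mul_apply, hx s] at this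
        exact this
    rw [eq_top_iff]
    intro x _
    obtain ⟨r, hr, hrx⟩ := key ((LinearMap.range (β e f)).subtype ∘ₗ x ∘ₗ
      (β e f).rangeRestrict)
    obtain ⟨r', hr', hrr⟩ := hR r hr
    have : x = r' := by
      ext s
      rw [hrr, ← hrx]
      have hs : (β e f).rangeRestrict (s : S) = s := Subtype.ext (hfix s)
      simp only [LinearMap.comp_apply, hs, Submodule.subtype_apply]
      rw [hfix]
    rwa [this]
  nondeg := orthPair_nondeg he hf hef h.nondeg

include he hef in
lemma range_nontrivial [Nontrivial S] {u : V} (hu : u ∈ orthPair B e f) (hqu : B u u ≠ 0) :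
    Nontrivial (LinearMap.range (β e f)) := by
  rw [Submodule.nontrivial_iff_ne_bot, Ne, LinearMap.range_eq_bot]
  intro h0
  have hfe : pol B f e = 1 := by rw [pol_comm, hef]
  have h1 : β f e = 1 := by rw [h.mul_orth_left hef, h0, sub_zero]
  have h2 : β e u = 0 := by rw [← h.proj_mul_left he hef, h0, zero_mul]
  have h3 := h.mul_proj_eq (e := f) (f := e) (v := u) (orthPair_comm (B := B) e f ▸ hu)
  rw [h2, mul_zero, h1, one_mul, h.self] at h3
  have : B u u • (1 : Module.End F S) = 0 := by rw [← neg_eq_zero, ← h3]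
  rw [smul_eq_zero] at this
  exact this.elim hqu one_ne_zero

end IsSpin

end SpinReduction

section Lagrangian

variable {F V S : Type} [Field F] [AddCommGroup V] [Module F V]
  [AddCommGroup S] [Module F S] {B : V →ₗ[F] V →ₗ[F] F} {β : V →ₗ[F] V →ₗ[F] Module.End F S}
  {e f : V}

lemma TotSing.comap {W : Submodule F V} (hW : TotSing B W) (U : Submodule F V) :
    TotSing (B.domRestrict₁₂ U U) (W.comap U.subtype) := fun w hw => hW w.1 hw

lemma TotSing.exists_sub_mem {W : Submodule F V} (he : B e e = 0) (hf : B f f = 0)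
    (hef : pol B e f = 1) (hW : TotSing B W) (heW : e ∈ W) {w : V}
    (hw : w ∈ W) : w - pol B f w • e ∈ W ⊓ orthPair B e f := by
  have h1 := sub_mem_orthPair he hf hef w
  rw [hW.pol_eq_zero heW hw, zero_smul, sub_zero] at h1
  exact ⟨W.sub_mem hw (W.smul_mem _ heW), h1⟩

section FiniteDimensional

variable [FiniteDimensional F V]

lemma TotSing.finrank_le_comap {W : Submodule F V} (he : B e e = 0) (hf : B f f = 0)
    (hef : pol B e f = 1) (hW : TotSing B W) (heW : e ∈ W) :
    finrank F W ≤ finrank F (W.comap (orthPair B e f).subtype) + 1 := by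
  have h1 : W ≤ (W.comap (orthPair B e f).subtype).map (orthPair B e f).subtype ⊔
      Submodule.span F {e} := by
    intro w hw
    have := hW.exists_sub_mem he hf hef heW hw
    rw [← sub_add_cancel w (pol B f w • e)]
    exact Submodule.add_mem_sup ⟨⟨_, this.2⟩, this.1, rfl⟩
      (Submodule.smul_mem _ _ (Submodule.mem_span_singleton_self e))
  calc finrank F W ≤ _ := Submodule.finrank_mono h1
    _ ≤ _ := Submodule.finrank_add_le_finrank_add_finrank _ _
    _ ≤ _ := by
      refine add_le_add (Submodule.finrank_map_le _ _) ?_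
      simpa using finrank_span_le_card (R := F) ({e} : Set V)

lemma finrank_map_sup_span (he : B e e = 0) (hef : pol B e f = 1)
    (W : Submodule F (orthPair B e f)) :
    finrank F ↥(W.map (orthPair B e f).subtype ⊔ Submodule.span F {e}) = finrank F W + 1 := by
  have he0 : e ≠ 0 := by rintro rfl; simp at hef
  have h0 : W.map (orthPair B e f).subtype ⊓ Submodule.span F {e} = ⊥ := by
    rw [eq_bot_iff]
    rintro _ ⟨⟨w, hw, rfl⟩, h2⟩
    obtain ⟨c, hc⟩ := Submodule.mem_span_singleton.mp h2
    have h3 := (mem_orthPair.mp w.2).2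
    change c • e = w.1 at hc
    rw [← hc, map_smul, pol_comm, hef, smul_eq_mul, mul_one] at h3
    rw [Submodule.mem_bot, Submodule.subtype_apply, ← hc, h3, zero_smul]
  have h1 := Submodule.finrank_sup_add_finrank_inf_eq (W.map (orthPair B e f).subtype)
    (Submodule.span F {e})
  rw [h0, finrank_bot, add_zero, finrank_span_singleton he0,
    Submodule.finrank_map_subtype_eq] at h1
  exact h1

omit [FiniteDimensional F V] in
lemma TotSing.map_sup_span (he : B e e = 0)
    {W : Submodule F (orthPair B e f)} (hW : TotSing (B.domRestrict₁₂ _ _) W) :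
    TotSing B (W.map (orthPair B e f).subtype ⊔ Submodule.span F {e}) := by
  intro w hw
  obtain ⟨_, ⟨w, hw', rfl⟩, _, h2, rfl⟩ := Submodule.mem_sup.mp hw
  obtain ⟨c, rfl⟩ := Submodule.mem_span_singleton.mp h2
  have h1 := (mem_orthPair.mp w.2).1
  have h3 := hW w hw'
  rw [LinearMap.domRestrict₁₂_apply] at h3
  rw [pol_apply] at h1
  simp only [map_add, map_smul, LinearMap.add_apply, LinearMap.smul_apply, smul_eq_mul, he,
    Submodule.subtype_apply, h3]
  linear_combination c * h1

end FiniteDimensional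

namespace IsSpin

/-- A space with commuting endomorphisms is at most one-dimensional. -/
lemma _root_.Module.finrank_le_one_of_commute_end (hc : ∀ x y : Module.End F S, x * y = y * x) :
    finrank F S ≤ 1 := by
  by_cases hS : ∀ s : S, s = 0
  · exact finrank_le_one 0 fun s => ⟨0, by simp [hS s]⟩
  · push Not at hS
    obtain ⟨s, hs⟩ := hS
    obtain ⟨φ, hφ⟩ : ∃ φ : S →ₗ[F] F, φ s = 1 := by
      obtain ⟨φ, hφ⟩ := Module.Projective.exists_dual_ne_zero F hs
      exact ⟨(φ s)⁻¹ • φ, by simp [inv_mul_cancel₀ hφ]⟩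
    refine finrank_le_one s fun t => ⟨φ t, ?_⟩
    have := DFunLike.congr_fun (hc (φ.smulRight t) (φ.smulRight s)) s
    simpa [hφ] using this.symm

variable (h : IsSpin B β)

include h

lemma finrank_le_one [FiniteDimensional F V] (hV : finrank F V = 2) (he0 : e ≠ 0)
    (he : B e e = 0) : finrank F S ≤ 1 := by
  obtain ⟨f, hf, hef⟩ := exists_hyperbolic_partner h.nondeg he0 he
  have h0 : ∀ u ∈ orthPair B e f, u = 0 := by
    have := finrank_orthPair he hf hef
    have h1 : orthPair B e f = ⊥ := Submodule.finrank_eq_zero.mp (by omega)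
    intro u hu
    rwa [h1] at hu
  have hc : ∀ v w, ∃ a b : F, β v w = a • β e f + b • 1 := by
    intro v w
    obtain ⟨a, b, u, hu, rfl⟩ := exists_decomp he hf hef v
    obtain ⟨a', b', u', hu', rfl⟩ := exists_decomp he hf hef w
    rw [h0 u hu, h0 u' hu']
    refine ⟨a * b' - b * a', b * a', ?_⟩
    simp only [add_zero, map_add, map_smul, LinearMap.add_apply, LinearMap.smul_apply, h.self, he,
      hf, h.mul_orth_left hef]
    module
  set G := Set.range fun p : V × V => β p.1 p.2
  have hG : ∀ x ∈ G, ∀ y ∈ G, x * y = y * x := by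
    rintro _ ⟨p, rfl⟩ _ ⟨p', rfl⟩
    obtain ⟨a, b, hab⟩ := hc p.1 p.2
    obtain ⟨a', b', hab'⟩ := hc p'.1 p'.2
    change β p.1 p.2 * β p'.1 p'.2 = β p'.1 p'.2 * β p.1 p.2
    rw [hab, hab']
    simp only [add_mul, mul_add, smul_mul_assoc, mul_smul_comm, one_mul, mul_one]
    module
  have h1 : (⊤ : Subalgebra F (Module.End F S)) ≤ Subalgebra.centralizer F G := by
    rw [← h.gen]
    refine Algebra.adjoin_le fun x hx => ?_
    rw [SetLike.mem_coe, Subalgebra.mem_centralizer_iff]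
    exact fun y hy => hG y hy x hx
  have h2 : (⊤ : Subalgebra F (Module.End F S)) ≤ Subalgebra.centralizer F ⊤ := by
    nth_rewrite 1 [← h.gen]
    refine Algebra.adjoin_le fun x hx => ?_
    rw [SetLike.mem_coe, Subalgebra.mem_centralizer_iff]
    intro y _
    have := h1 (trivial : y ∈ _)
    rw [Subalgebra.mem_centralizer_iff] at this
    exact (this x hx).symm
  refine Module.finrank_le_one_of_commute_end fun x y => ?_
  have := h2 (trivial : y ∈ _)
  rw [Subalgebra.mem_centralizer_iff] at this
  exact this x trivial

lemma finrank_le_two [FiniteDimensional F V] [FiniteDimensional F S] (hV : finrank F V = 4)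
    {W : Submodule F V} (hW : TotSing B W) (hW2 : 2 ≤ finrank F W) : finrank F S ≤ 2 := by
  have : W ≠ ⊥ := by rintro rfl; simp at hW2
  obtain ⟨e, heW, he0⟩ := Submodule.exists_mem_ne_zero_of_ne_bot this
  have he := hW e heW
  obtain ⟨f, hf, hef⟩ := exists_hyperbolic_partner h.nondeg he0 he
  have hfe : pol B f e = 1 := by rw [pol_comm, hef]
  have h1 := hW.finrank_le_comap he hf hef heW
  have h2 := finrank_orthPair he hf hef
  have h2' := finrank_orthPair hf he hfe
  have : W.comap (orthPair B e f).subtype ≠ ⊥ := by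
    intro h'
    rw [h', finrank_bot] at h1; omega
  obtain ⟨w, hw, hw0⟩ := Submodule.exists_mem_ne_zero_of_ne_bot this
  have hqw : B w w = 0 := hW _ hw
  have h3 := (h.restr_isSpin he hf hef).finrank_le_one (by omega) hw0 hqw
  have h4 := (h.restr_isSpin hf he hfe).finrank_le_one
    (e := (⟨w.1, orthPair_comm (B := B) e f ▸ w.2⟩ : orthPair B f e))
    (by omega) (fun h' => hw0 (by
      have := congrArg Subtype.val h'
      exact Subtype.ext this)) hqw
  have h5 : LinearMap.range (β e f) ⊔ LinearMap.range (β f e) = ⊤ := by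
    rw [eq_top_iff]
    intro s _
    have : s = β e f s + β f e s := by rw [h.mul_orth_left hef]; simp
    rw [this]
    exact Submodule.add_mem_sup ⟨s, rfl⟩ ⟨s, rfl⟩
  have h6 := Submodule.finrank_add_le_finrank_add_finrank (LinearMap.range (β e f))
    (LinearMap.range (β f e))
  rw [h5, finrank_top] at h6
  omega

end IsSpin

/-- The spinors annihilated by a subspace. -/
def spinKer (β : V →ₗ[F] V →ₗ[F] Module.End F S) (X : Submodule F V) : Submodule F S where
  carrier := {s | ∀ v, ∀ x ∈ X, β v x s = 0}
  zero_mem' := by simp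
  add_mem' := fun ha hb v x hx => by rw [map_add, ha v x hx, hb v x hx, add_zero]
  smul_mem' := fun c s hs v x hx => by rw [map_smul, hs v x hx, smul_zero]

/-- The vectors annihilating a spinor. -/
def spinAnn (β : V →ₗ[F] V →ₗ[F] Module.End F S) (s : S) : Submodule F V where
  carrier := {w | ∀ v, β v w s = 0}
  zero_mem' := by simp
  add_mem' := fun ha hb v => by rw [map_add, LinearMap.add_apply, ha v, hb v, add_zero]
  smul_mem' := fun c w hw v => by rw [map_smul, LinearMap.smul_apply, hw v, smul_zero]

lemma mem_spinAnn {s : S} {w : V} : w ∈ spinAnn β s ↔ ∀ v, β v w s = 0 := Iff.rfl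

namespace IsSpin

variable (h : IsSpin B β)

include h

lemma ker_le_spinAnn {v : V} (hv : B v v ≠ 0) (s : S) {w : V} (hw : β v w s = 0) :
    w ∈ spinAnn β s := by
  intro u
  have := DFunLike.congr_fun (h.mul u v w) s
  rw [Module.End.mul_apply, hw, map_zero, LinearMap.smul_apply, eq_comm, smul_eq_zero] at this
  exact this.resolve_left hv

lemma finrank_le_spinAnn [FiniteDimensional F V] [FiniteDimensional F S] [Nontrivial V] (s : S) :
    finrank F V ≤ finrank F (spinAnn β s) + finrank F S := by
  obtain ⟨v, hv⟩ := exists_anisotropic h.nondeg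
  let φ : V →ₗ[F] S := (LinearMap.applyₗ s).comp (β v)
  have h1 := LinearMap.finrank_range_add_finrank_ker φ
  have h2 : LinearMap.ker φ ≤ spinAnn β s := fun w hw => h.ker_le_spinAnn hv s hw
  have h3 := Submodule.finrank_mono h2
  have h4 := Submodule.finrank_le (LinearMap.range φ)
  omega

lemma mem_spinAnn_of_orthPair (he : B e e = 0) (hf : B f f = 0) (hef : pol B e f = 1) {u : V}
    (hu : u ∈ orthPair B e f) (hqu : B u u ≠ 0) {s : S} (hs : β e f s = s)
    {y : V} (hy : y ∈ orthPair B e f) (hys : ∀ v ∈ orthPair B e f, β v y s = 0) :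
    y ∈ spinAnn β s := by
  have h1 : β e y s = 0 := by
    have := DFunLike.congr_fun (h.proj_mul_right (f := f) he (mem_orthPair.mp hy).1) s
    rwa [Module.End.mul_apply, hs] at this
  have h2 : β f y s = 0 := by
    set t := β f y s with ht
    have h3 : β e f t = 0 := by
      have := DFunLike.congr_fun (h.proj_mul_zero (e := e) (u := y) hf) s
      rwa [Module.End.mul_apply, ← ht] at this
    have h4 : β e u t = 0 := by
      have := DFunLike.congr_fun (h.mul_proj_eq (v := y) hu) s
      rw [Module.End.mul_apply, ← ht] at this
      rw [this, LinearMap.neg_apply, Module.End.mul_apply, hys u hu, map_zero, neg_zero]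
    have h5 : β f e t = t := by rw [h.mul_orth_left hef]; simp [h3]
    have h6 := DFunLike.congr_fun (h.mul f u e) t
    rw [Module.End.mul_apply, h.swap (mem_orthPair.mp hu).1, LinearMap.neg_apply, h4, neg_zero,
      map_zero, LinearMap.smul_apply, h5, eq_comm, smul_eq_zero] at h6
    exact h6.resolve_left hqu
  intro v
  obtain ⟨a, b, w, hw, rfl⟩ := exists_decomp he hf hef v
  simp [h1, h2, hys w hw]

lemma left_mem_spinAnn (he : B e e = 0) (hf : B f f = 0) (hef : pol B e f = 1)
    {s : S} (hs : β e f s = s) : e ∈ spinAnn β s := by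
  intro v
  obtain ⟨a, b, w, hw, rfl⟩ := exists_decomp he hf hef v
  have h1 : β w e s = 0 := by
    have := DFunLike.congr_fun (h.proj_mul_right (f := f) he (mem_orthPair.mp hw).1) s
    rw [Module.End.mul_apply, hs] at this
    rw [h.swap (mem_orthPair.mp hw).1, LinearMap.neg_apply, this]; simp
  simp [h1, h.self, he, h.mul_orth_left hef, hs]

end IsSpin

/-- Given a totally singular subspace `X` of codimension two in a Lagrangian, there are nonzero
spinors annihilated by `X`, and they are all pure. -/
theorem IsSpin.pure (k : ℕ) : ∀ (V S : Type) [AddCommGroup V] [Module F V]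
    [AddCommGroup S] [Module F S] [FiniteDimensional F V] [FiniteDimensional F S] [Nontrivial S]
    (B : V →ₗ[F] V →ₗ[F] F) (β : V →ₗ[F] V →ₗ[F] Module.End F S)
    (_ : IsSpin B β) (_ : finrank F V = 2 * k + 4) (W X : Submodule F V) (_ : TotSing B W)
    (_ : k + 2 ≤ finrank F W) (_ : X ≤ W) (_ : finrank F X = k),
    (∃ s ∈ spinKer β X, s ≠ 0) ∧
      ∀ s ∈ spinKer β X, s ≠ 0 → k + 2 ≤ finrank F (spinAnn β s) := by
  induction k with
  | zero =>
    intro V S _ _ _ _ _ _ _ B β h hV W X hW hWk hXW hX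
    have : Nontrivial V := Module.nontrivial_of_finrank_pos (R := F) (by omega)
    rw [Submodule.finrank_eq_zero] at hX
    obtain ⟨s, hs⟩ := exists_ne (0 : S)
    refine ⟨⟨s, ?_, hs⟩, fun s _ _ => ?_⟩
    · subst hX
      intro v x hx
      rw [(Submodule.mem_bot _).mp hx]; simp
    · have h1 := h.finrank_le_two (by omega) hW (by omega)
      have h2 := h.finrank_le_spinAnn s
      omega
  | succ k ih =>
    intro V S _ _ _ _ _ _ _ B β h hV W X hW hWk hXW hX
    have : X ≠ ⊥ := by rintro rfl; simp at hX
    obtain ⟨e, heX, he0⟩ := Submodule.exists_mem_ne_zero_of_ne_bot this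
    have he := hW e (hXW heX)
    have hXs : TotSing B X := fun x hx => hW x (hXW hx)
    obtain ⟨f, hf, hef⟩ := exists_hyperbolic_partner h.nondeg he0 he
    have hV1 := finrank_orthPair he hf hef
    have : Nontrivial (orthPair B e f) := Module.nontrivial_of_finrank_pos (R := F) (by omega)
    obtain ⟨u, hu⟩ := exists_anisotropic (orthPair_nondeg he hf hef h.nondeg)
    have := h.range_nontrivial he hef u.2 hu
    have hX1 : finrank F (X.comap (orthPair B e f).subtype) = k := by
      have h1 := hXs.finrank_le_comap he hf hef heX
      have h2 := finrank_map_sup_span he hef (X.comap (orthPair B e f).subtype)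
      have h3 : (X.comap (orthPair B e f).subtype).map (orthPair B e f).subtype ⊔
          Submodule.span F {e} ≤ X :=
        sup_le (Submodule.map_comap_le _ _) (by rwa [Submodule.span_singleton_le_iff_mem])
      have h4 := Submodule.finrank_mono h3
      omega
    obtain ⟨⟨s, hs, hs0⟩, hpure⟩ := ih _ _ _ _ (h.restr_isSpin he hf hef) (by omega) _ _
      (hW.comap _) (by have := hW.finrank_le_comap he hf hef (hXW heX); omega)
      (Submodule.comap_mono hXW) hX1
    have hpp : β e f * β e f = β e f := h.proj_mul_left he hef
    refine ⟨⟨s, fun v x hx => ?_, fun h' => hs0 (Subtype.ext h')⟩, fun s hs hs0 => ?_⟩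
    · have hps : β e f s = s := by
        obtain ⟨_, t, rfl⟩ := s
        exact DFunLike.congr_fun hpp t
      have h1 := hXs.exists_sub_mem he hf hef heX hx
      have h2 := h.mem_spinAnn_of_orthPair he hf hef u.2 hu hps h1.2 fun v hv =>
        congrArg Subtype.val (hs ⟨v, hv⟩ ⟨_, h1.2⟩ h1.1)
      have h3 := (spinAnn β (s : S)).add_mem h2
        ((spinAnn β (s : S)).smul_mem (pol B f x) (h.left_mem_spinAnn he hf hef hps))
      rw [sub_add_cancel] at h3
      exact h3 v
    · have hps : β e f s = s := by
        have := hs f e heX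
        rw [h.mul_orth_left hef, LinearMap.sub_apply, sub_eq_zero] at this
        exact this.symm
      have h1 := hpure ⟨s, s, hps⟩ (fun v x hx => Subtype.ext (hs v x hx))
        (fun h' => hs0 (congrArg Subtype.val h'))
      have h2 := finrank_map_sup_span he hef (spinAnn (h.restr e f) ⟨s, s, hps⟩)
      have h3 : (spinAnn (h.restr e f) ⟨s, s, hps⟩).map (orthPair B e f).subtype ⊔
          Submodule.span F {e} ≤ spinAnn β s := by
        refine sup_le ?_ ?_
        · rintro _ ⟨y, hy, rfl⟩
          exact h.mem_spinAnn_of_orthPair he hf hef u.2 hu hps y.2 fun v hv =>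
            congrArg Subtype.val (hy ⟨v, hv⟩)
        · rw [Submodule.span_singleton_le_iff_mem]
          exact h.left_mem_spinAnn he hf hef hps
      have h4 := Submodule.finrank_mono h3
      omega

end Lagrangian

section QuadraticExtension

variable {F V S : Type} [Field F] [AddCommGroup V] [Module F V]
  [AddCommGroup S] [Module F S] {c : F}

/-- The quadratic extension generated by a root of `X² - X + c`. -/
abbrev QExt (c : F) : Type := QuadraticAlgebra F (-c) 1

namespace QExt

/-- The generator of the quadratic extension. -/
abbrev th (c : F) : QExt c := QuadraticAlgebra.omega

lemma th_mul_th : th c * th c = th c - algebraMap F (QExt c) c := by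
  ext <;> simp [QuadraticAlgebra.algebraMap_eq]

lemma eq_add (x : QExt c) : x = algebraMap F _ x.re + algebraMap F _ x.im * th c := by
  ext <;> simp [QuadraticAlgebra.algebraMap_eq]

lemma fact_of_anisotropic (hc : ∀ x y, nm c x y = 0 → x = 0 ∧ y = 0) :
    Fact (∀ r : F, r ^ 2 ≠ -c + 1 * r) := by
  constructor
  intro r hr
  have := (hc r (-1) (by rw [nm]; linear_combination hr)).2
  simp at this

/-- The real part of an element of a base change. -/
def reT (c : F) : QExt c ⊗[F] V →ₗ[F] V :=
  (TensorProduct.lid F V).toLinearMap ∘ₗ LinearMap.rTensor V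
    { toFun := QuadraticAlgebra.re, map_add' := fun _ _ => rfl, map_smul' := fun _ _ => rfl }

/-- The imaginary part of an element of a base change. -/
def imT (c : F) : QExt c ⊗[F] V →ₗ[F] V :=
  (TensorProduct.lid F V).toLinearMap ∘ₗ LinearMap.rTensor V
    { toFun := QuadraticAlgebra.im, map_add' := fun _ _ => rfl, map_smul' := fun _ _ => rfl }

@[simp] lemma reT_tmul (x : QExt c) (v : V) : reT c (x ⊗ₜ v) = x.re • v := by
  simp [reT]

@[simp] lemma imT_tmul (x : QExt c) (v : V) : imT c (x ⊗ₜ v) = x.im • v := by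
  simp [imT]

lemma tensor_eq (w : QExt c ⊗[F] V) : w = 1 ⊗ₜ reT c w + th c ⊗ₜ imT c w := by
  induction w using TensorProduct.induction_on with
  | zero => simp
  | tmul x v =>
    rw [reT_tmul, imT_tmul, ← TensorProduct.smul_tmul, ← TensorProduct.smul_tmul,
      ← TensorProduct.add_tmul]
    congr 1
    ext <;> simp [QuadraticAlgebra.re_one, QuadraticAlgebra.im_one]
  | add w w' hw hw' =>
    rw [map_add, map_add, TensorProduct.tmul_add, TensorProduct.tmul_add]
    nth_rewrite 1 [hw, hw']
    abel

lemma exists_tensor_eq (w : QExt c ⊗[F] V) : ∃ x y : V, w = 1 ⊗ₜ x + th c ⊗ₜ y :=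
  ⟨_, _, tensor_eq w⟩

end QExt

end QuadraticExtension

section BaseChange

variable {F V S : Type} [Field F] [AddCommGroup V] [Module F V]
  [AddCommGroup S] [Module F S]

lemma adjoin_baseChange_eq_top [FiniteDimensional F S] {K : Type} [Field K] [Algebra F K]
    {G : Set (Module.End F S)} (hG : Algebra.adjoin F G = ⊤)
    (R : Subalgebra K (Module.End K (K ⊗[F] S)))
    (hR : ∀ x ∈ G, LinearMap.baseChange K x ∈ R) : R = ⊤ := by
  have h1 : ∀ x : Module.End F S, LinearMap.baseChange K x ∈ R := by
    intro x
    have hx : x ∈ Algebra.adjoin F G := hG ▸ trivial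
    induction hx using Algebra.adjoin_induction with
    | mem x hx => exact hR x hx
    | algebraMap r =>
      have : LinearMap.baseChange K (algebraMap F (Module.End F S) r) =
          algebraMap K _ (algebraMap F K r) := by
        ext; simp [TensorProduct.smul_tmul', Algebra.smul_def]
      rw [this]; exact R.algebraMap_mem _
    | add x y _ _ hx hy => rw [LinearMap.baseChange_add]; exact R.add_mem hx hy
    | mul x y _ _ hx hy => rw [LinearMap.baseChange_mul]; exact R.mul_mem hx hy
  rw [eq_top_iff]
  intro x _
  let b := Module.finBasis F S
  have h2 : x = ∑ i, ∑ j, ((b.baseChange K).repr (x (1 ⊗ₜ b j)) i) •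
      LinearMap.baseChange K ((b.coord j).smulRight (b i)) := by
    refine (b.baseChange K).ext fun k => ?_
    simp only [LinearMap.sum_apply, LinearMap.smul_apply, Basis.baseChange_apply,
      LinearMap.baseChange_tmul, LinearMap.smulRight_apply, Basis.coord_apply, Basis.repr_self]
    rw [← (b.baseChange K).sum_repr (x (1 ⊗ₜ b k))]
    refine Finset.sum_congr rfl fun i _ => ?_
    rw [Finset.sum_eq_single k]
    · simp
    · intro j _ hj
      simp [hj.symm]
    · simp
  rw [h2]
  exact R.sum_mem fun i _ => R.sum_mem fun j _ => R.smul_mem (h1 _) _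

variable (K : Type) [Field K] [Algebra F K]

/-- Base change of a spin representation. -/
def spinBaseChange (β : V →ₗ[F] V →ₗ[F] Module.End F S) :
    K ⊗[F] V →ₗ[K] K ⊗[F] V →ₗ[K] Module.End K (K ⊗[F] S) :=
  LinearMap.compr₂ (LinearMap.BilinMap.baseChange K β)
    (LinearMap.tensorProductEnd F K S).toLinearMap

@[simp] lemma spinBaseChange_tmul (β : V →ₗ[F] V →ₗ[F] Module.End F S) (a a' : K) (v v' : V) :
    spinBaseChange K β (a ⊗ₜ v) (a' ⊗ₜ v') = (a * a') • LinearMap.baseChange K (β v v') := by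
  simp only [spinBaseChange, LinearMap.compr₂_apply, LinearMap.BilinMap.baseChange_tmul]
  rfl

end BaseChange

section

variable {F V S : Type} [Field F] [AddCommGroup V] [Module F V] [AddCommGroup S] [Module F S]
  {B : V →ₗ[F] V →ₗ[F] F} {β : V →ₗ[F] V →ₗ[F] Module.End F S} {c : F}
  [Fact (∀ r : F, r ^ 2 ≠ -c + 1 * r)]

lemma baseChange_add_th (x y x' y' : V) :
    LinearMap.BilinForm.baseChange (QExt c) B ((1 : QExt c) ⊗ₜ x + QExt.th c ⊗ₜ y)
      ((1 : QExt c) ⊗ₜ x' + QExt.th c ⊗ₜ y') =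
      algebraMap F _ (B x x' - c * B y y') +
        algebraMap F _ (B x y' + B y x' + B y y') * QExt.th c := by
  simp only [map_add, LinearMap.add_apply, LinearMap.BilinForm.baseChange_tmul, mul_one, one_mul,
    QExt.th_mul_th, Algebra.smul_def, map_sub, map_mul]
  ring

theorem IsSpin.baseChange [FiniteDimensional F S] (h : IsSpin B β) :
    IsSpin (LinearMap.BilinForm.baseChange (QExt c) B) (spinBaseChange (QExt c) β) where
  self w := by
    obtain ⟨x, y, rfl⟩ := QExt.exists_tensor_eq w
    have h1 : β y x = pol B x y • 1 - β x y := eq_sub_of_add_eq' (h.anti x y)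
    rw [baseChange_add_th]
    simp only [map_add, LinearMap.add_apply, spinBaseChange_tmul, one_mul, mul_one, h.self x,
      h.self y, h1, LinearMap.baseChange_sub, LinearMap.baseChange_smul, LinearMap.baseChange_one,
      ← algebraMap_smul (QExt c) (_ : F) (1 : Module.End (QExt c) (QExt c ⊗[F] S)),
      QExt.th_mul_th, pol_apply, map_sub, map_mul]
    module
  mul u v w := by
    obtain ⟨x, y, hv⟩ := QExt.exists_tensor_eq v
    induction u using TensorProduct.induction_on with
    | zero => simp
    | add u u' hu hu' =>
      simp only [map_add, LinearMap.add_apply, add_mul, smul_add] at hu hu' ⊢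
      rw [hu, hu']
    | tmul a u =>
      induction w using TensorProduct.induction_on with
      | zero => simp
      | add w w' hw hw' =>
        simp only [map_add, mul_add, smul_add] at hw hw' ⊢
        rw [hw, hw']
      | tmul b w =>
        rw [hv, baseChange_add_th]
        have h1 : β u y * β x w = pol B x y • β u w - β u x * β y w :=
          eq_sub_of_add_eq' (h.mul_add_mul u x y w)
        simp only [map_add, LinearMap.add_apply, spinBaseChange_tmul, one_mul, mul_one, add_mul,
          mul_add, smul_mul_smul_comm, ← LinearMap.baseChange_mul, h.mul u x w, h.mul u y w, h1,
          LinearMap.baseChange_sub, LinearMap.baseChange_smul,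
          ← algebraMap_smul (QExt c) (_ : F) (LinearMap.baseChange (QExt c) (β u w))]
        simp only [pol_apply, map_sub, map_mul, map_add]
        have h2 := QExt.th_mul_th (c := c)
        match_scalars
        · linear_combination (a * b * algebraMap F _ (B y y)) * h2
        · ring
  gen := by
    refine adjoin_baseChange_eq_top h.gen _ ?_
    rintro _ ⟨p, rfl⟩
    refine Algebra.subset_adjoin ⟨((1 : QExt c) ⊗ₜ p.1, (1 : QExt c) ⊗ₜ p.2), ?_⟩
    simp
  nondeg w hw := by
    obtain ⟨x, y, rfl⟩ := QExt.exists_tensor_eq w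
    have h1 : ∀ z, pol B x z = 0 ∧ pol B y z = 0 := by
      intro z
      have := hw ((1 : QExt c) ⊗ₜ z + QExt.th c ⊗ₜ (0 : V))
      rw [pol_apply, baseChange_add_th, baseChange_add_th] at this
      have h2 := congrArg QuadraticAlgebra.re this
      have h3 := congrArg QuadraticAlgebra.im this
      simp [QuadraticAlgebra.algebraMap_eq] at h2 h3
      exact ⟨h2, h3⟩
    rw [h.nondeg x fun z => (h1 z).1, h.nondeg y fun z => (h1 z).2]
    simp

end

lemma IsSpin.exists_lagrangian_of_isotropic {F : Type} [Field F] (m : ℕ)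
    (ih : ∀ (V S : Type) [AddCommGroup V] [Module F V] [AddCommGroup S] [Module F S]
      [FiniteDimensional F V] [FiniteDimensional F S] [Nontrivial S]
      (B : V →ₗ[F] V →ₗ[F] F) (β : V →ₗ[F] V →ₗ[F] Module.End F S),
      IsSpin B β → finrank F V = 2 * m → ∃ W, TotSing B W ∧ m ≤ finrank F W)
    {V S : Type} [AddCommGroup V] [Module F V] [AddCommGroup S] [Module F S]
    [FiniteDimensional F V] [FiniteDimensional F S] [Nontrivial S]
    {B : V →ₗ[F] V →ₗ[F] F} {β : V →ₗ[F] V →ₗ[F] Module.End F S}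
    (h : IsSpin B β) (hV : finrank F V = 2 * (m + 1)) {e : V} (he0 : e ≠ 0) (he : B e e = 0) :
    ∃ W, TotSing B W ∧ m + 1 ≤ finrank F W := by
  obtain ⟨f, hf, hef⟩ := exists_hyperbolic_partner h.nondeg he0 he
  have hV1 := finrank_orthPair he hf hef
  obtain ⟨W, hW, hWm⟩ : ∃ W, TotSing (B.domRestrict₁₂ (orthPair B e f) (orthPair B e f)) W ∧
      m ≤ finrank F W := by
    rcases Nat.eq_zero_or_pos m with rfl | hm
    · refine ⟨⊥, fun w hw => ?_, by simp⟩
      rw [(Submodule.mem_bot _).mp hw]; simp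
    · have : Nontrivial (orthPair B e f) := Module.nontrivial_of_finrank_pos (R := F) (by omega)
      obtain ⟨u, hu⟩ := exists_anisotropic (orthPair_nondeg he hf hef h.nondeg)
      have := h.range_nontrivial he hef u.2 hu
      exact ih _ _ _ _ (h.restr_isSpin he hf hef) (by omega)
  exact ⟨_, hW.map_sup_span he, by rw [finrank_map_sup_span he hef]; omega⟩

/-- In an anisotropic quadratic space of dimension at least two, one finds a two-dimensional
subform which is a multiple of an anisotropic norm form. -/
lemma exists_nm_of_anisotropic {F V : Type} [Field F] [AddCommGroup V] [Module F V]
    [FiniteDimensional F V] {B : V →ₗ[F] V →ₗ[F] F} (hnd : ∀ v, (∀ w, pol B v w = 0) → v = 0)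
    (hB : ∀ v, B v v = 0 → v = 0) (hV : 2 ≤ finrank F V) :
    ∃ v w : V, ∃ c : F, v ≠ 0 ∧ pol B v w = B v v ∧ B w w = c * B v v ∧
      ∀ x y, nm c x y = 0 → x = 0 ∧ y = 0 := by
  have : Nontrivial V := Module.nontrivial_of_finrank_pos (R := F) (by omega)
  obtain ⟨v, hv⟩ := exists_ne (0 : V)
  have ha : B v v ≠ 0 := fun h => hv (hB v h)
  obtain ⟨w, hw, hwv⟩ : ∃ w, pol B v w = B v v ∧ ∀ d : F, w ≠ d • v := by
    obtain ⟨w, hw⟩ : ∃ w, pol B v w = B v v := by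
      obtain ⟨w, hw⟩ : ∃ w, pol B v w ≠ 0 := by
        by_contra! h'
        exact hv (hnd v h')
      exact ⟨(B v v / pol B v w) • w, by rw [map_smul, smul_eq_mul, div_mul_cancel₀ _ hw]⟩
    by_cases h1 : ∀ d : F, w ≠ d • v
    · exact ⟨w, hw, h1⟩
    push Not at h1
    obtain ⟨d, rfl⟩ := h1
    obtain ⟨u, hu, hu0⟩ := Submodule.exists_mem_ne_zero_of_ne_bot
      (LinearMap.ker_ne_bot_of_finrank_lt (f := pol B v) (by rw [finrank_self]; omega))
    rw [LinearMap.mem_ker] at hu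
    refine ⟨d • v + u, by rw [map_add, hw, hu, add_zero], fun d' hd' => hu0 ?_⟩
    have h2 : u = (d' - d) • v := by rw [sub_smul, ← hd']; abel
    rw [map_smul, smul_eq_mul] at hw
    have h3 : pol B v v ≠ 0 := fun h => ha (by rw [← hw, h, mul_zero])
    rw [h2, map_smul, smul_eq_mul] at hu
    rw [h2, (mul_eq_zero.mp hu).resolve_right h3, zero_smul]
  refine ⟨v, w, B w w / B v v, hv, hw, (div_mul_cancel₀ _ ha).symm, fun x y hxy => ?_⟩
  have h1 : B (x • v + y • w) (x • v + y • w) = 0 := by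
    rw [pol_apply] at hw
    rw [nm] at hxy
    have h2 : B w w = B w w / B v v * B v v := (div_mul_cancel₀ _ ha).symm
    simp only [map_add, map_smul, LinearMap.add_apply, LinearMap.smul_apply, smul_eq_mul]
    linear_combination B v v * hxy + x * y * hw + y * y * h2
  have h2 := hB _ h1
  have hy : y = 0 := by
    by_contra hy
    apply hwv (-(y⁻¹ * x))
    have : w = y⁻¹ • (x • v + y • w) - (y⁻¹ * x) • v := by
      rw [smul_add, smul_smul, smul_smul, inv_mul_cancel₀ hy]; module
    rw [this, h2]; module
  subst hy
  rw [zero_smul, add_zero, smul_eq_zero] at h2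
  exact ⟨h2.resolve_right hv, rfl⟩

lemma finrank_restrictScalars_qext {F : Type} [Field F] {c : F}
    [Fact (∀ r : F, r ^ 2 ≠ -c + 1 * r)] {V : Type} [AddCommGroup V] [Module F V]
    [Module (QExt c) V] [IsScalarTower F (QExt c) V] :
    finrank F V = 2 * finrank (QExt c) V := by
  rw [← finrank_mul_finrank F (QExt c) V, QuadraticAlgebra.finrank_eq_two]

lemma isotropic_of_lagrangian_baseChange {F V : Type} [Field F] (hF : PfisterUniversal F)
    [AddCommGroup V] [Module F V] [FiniteDimensional F V] {B : V →ₗ[F] V →ₗ[F] F}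
    (hB : ∀ v, B v v = 0 → v = 0) {c : F} [Fact (∀ r : F, r ^ 2 ≠ -c + 1 * r)]
    (hc : ∀ x y, nm c x y = 0 → x = 0 ∧ y = 0)
    {W : Submodule (QExt c) (QExt c ⊗[F] V)}
    (hW : TotSing (LinearMap.BilinForm.baseChange (QExt c) B) W) :
    finrank (QExt c) W ≤ 2 := by
  by_contra! h3
  have key : ∀ x y : V, (1 : QExt c) ⊗ₜ[F] x + QExt.th c ⊗ₜ y ∈ W →
      B x x = c * B y y ∧ B x y + B y x + B y y = 0 := by
    intro x y hxy
    have := hW _ hxy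
    rw [baseChange_add_th] at this
    have h1 := congrArg QuadraticAlgebra.re this
    have h2 := congrArg QuadraticAlgebra.im this
    simp [QuadraticAlgebra.algebraMap_eq] at h1 h2
    exact ⟨by linear_combination h1, h2⟩
  let im : W →ₗ[F] V := QExt.imT c ∘ₗ (W.subtype.restrictScalars F)
  have him : ∀ w : W, im (QExt.th c • w) = QExt.reT c w.1 + im w := by
    intro w
    change QExt.imT c (QExt.th c • w.1) = _ + QExt.imT c w.1
    conv_lhs => rw [QExt.tensor_eq w.1]
    simp [TensorProduct.smul_tmul']
  have key' : ∀ w : W, B (QExt.reT c w.1) (QExt.reT c w.1) = c * B (im w) (im w) ∧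
      B (QExt.reT c w.1) (im w) + B (im w) (QExt.reT c w.1) + B (im w) (im w) = 0 := by
    intro w
    apply key
    rw [show im w = QExt.imT c w.1 from rfl, ← QExt.tensor_eq]
    exact w.2
  have : Module.Finite F W := Module.Finite.trans (QExt c) W
  obtain ⟨w, hw0, hw⟩ := exists_isotropic_of_hermitian (W := W) hF hc (B.compl₁₂ im im)
    ((LinearMap.lsmul (QExt c) W (QExt.th c)).restrictScalars F)
    (fun w => by
      change B (im (QExt.th c • w)) (im (QExt.th c • w)) = c * B (im w) (im w)
      rw [him]
      obtain ⟨h1, h2⟩ := key' w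
      simp only [map_add, LinearMap.add_apply]
      linear_combination h1 + h2)
    (fun w => by
      change B (im w) (im (QExt.th c • w)) + B (im (QExt.th c • w)) (im w) = B (im w) (im w)
      rw [him]
      obtain ⟨h1, h2⟩ := key' w
      simp only [map_add, LinearMap.add_apply]
      linear_combination h2)
    (by have := finrank_restrictScalars_qext (F := F) (c := c) (V := W); omega)
  apply hw0
  have h1 : im w = 0 := hB _ hw
  have h2 : QExt.reT c w.1 = 0 := hB _ (by rw [(key' w).1, h1]; simp)
  apply Subtype.ext
  rw [QExt.tensor_eq w.1, h2, show QExt.imT c w.1 = im w from rfl, h1]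
  simp

/-- Over a field with `I_q³ = 0`, a quadratic form of trivial discriminant whose even Clifford
algebra has a split component is hyperbolic. -/
theorem IsSpin.exists_lagrangian (m : ℕ) : ∀ (F : Type) [Field F] (_ : PfisterUniversal F)
    (V S : Type) [AddCommGroup V] [Module F V] [AddCommGroup S] [Module F S]
    [FiniteDimensional F V] [FiniteDimensional F S] [Nontrivial S]
    (B : V →ₗ[F] V →ₗ[F] F) (β : V →ₗ[F] V →ₗ[F] Module.End F S)
    (_ : IsSpin B β) (_ : finrank F V = 2 * m), ∃ W, TotSing B W ∧ m ≤ finrank F W := by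
  induction m with
  | zero =>
    intro F _ _ V S _ _ _ _ _ _ _ B β _ _
    refine ⟨⊥, fun w hw => ?_, by simp⟩
    rw [(Submodule.mem_bot _).mp hw]; simp
  | succ m ih =>
    intro F _ hF V S _ _ _ _ _ _ _ B β h hV
    by_cases hB : ∀ v, B v v = 0 → v = 0
    swap
    · push Not at hB
      obtain ⟨e, he, he0⟩ := hB
      exact h.exists_lagrangian_of_isotropic m (ih F hF) hV he0 he
    exfalso
    obtain ⟨v, w, c, hv, hvw, hw, hc⟩ := exists_nm_of_anisotropic h.nondeg hB (by omega)
    have := QExt.fact_of_anisotropic hc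
    have hK : PfisterUniversal (QExt c) := hF.quadExt QExt.th_mul_th fun x => ⟨_, _, QExt.eq_add x⟩
    have hVK : finrank (QExt c) (QExt c ⊗[F] V) = 2 * (m + 1) := by rw [finrank_baseChange, hV]
    have hSK : finrank (QExt c) (QExt c ⊗[F] S) = finrank F S := finrank_baseChange
    have : Nontrivial (QExt c ⊗[F] S) :=
      Module.nontrivial_of_finrank_pos (R := QExt c) (by rw [hSK]; exact finrank_pos)
    have he0 : (1 : QExt c) ⊗ₜ[F] w + QExt.th c ⊗ₜ (-v) ≠ 0 := by
      intro h0
      have := congrArg (QExt.imT c) h0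
      simp [QuadraticAlgebra.im_one] at this
      exact hv this
    have he : LinearMap.BilinForm.baseChange (QExt c) B ((1 : QExt c) ⊗ₜ[F] w + QExt.th c ⊗ₜ (-v))
        ((1 : QExt c) ⊗ₜ[F] w + QExt.th c ⊗ₜ (-v)) = 0 := by
      rw [baseChange_add_th]
      rw [pol_apply] at hvw
      have h1 : B w w - c * B (-v) (-v) = 0 := by simp [hw]
      have h2 : B w (-v) + B (-v) w + B (-v) (-v) = 0 := by
        simp only [map_neg, LinearMap.neg_apply, neg_neg]
        linear_combination -hvw
      rw [h1, h2]; simp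
    obtain ⟨W, hW, hWm⟩ := (h.baseChange (c := c)).exists_lagrangian_of_isotropic m
      (ih _ hK) hVK he0 he
    have hm := isotropic_of_lagrangian_baseChange hF hB hc hW
    have hS : finrank F S ≤ m + 1 := by
      rw [← hSK]
      rcases Nat.eq_zero_or_pos m with rfl | hm0
      · exact (h.baseChange (c := c)).finrank_le_one (by omega) he0 he
      · have : m = 1 := by omega
        subst this
        exact (h.baseChange (c := c)).finrank_le_two (by omega) hW hWm
    obtain ⟨s, hs⟩ := exists_ne (0 : S)
    have : Nontrivial V := ⟨v, 0, hv⟩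
    have h1 := h.finrank_le_spinAnn s
    have h2 : spinAnn β s ≠ ⊥ := by
      intro h'
      rw [h', finrank_bot] at h1; omega
    obtain ⟨u, hu, hu0⟩ := Submodule.exists_mem_ne_zero_of_ne_bot h2
    have h3 := hu u
    rw [h.self, LinearMap.smul_apply, Module.End.one_apply, smul_eq_zero] at h3
    exact hu0 (hB u (h3.resolve_right hs))

section ReducedTrace

variable {F A : Type} [Field F] [Ring A] [Algebra F A] {T : A →ₗ[F] F}

lemma IsReducedTrace.mul_comm (hT : IsReducedTrace F A T) (x y : A) : T (x * y) = T (y * x) := by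
  obtain ⟨E, _, _, n, e, he⟩ := hT
  apply (algebraMap F E).injective
  rw [he, he, ← one_mul (1 : E), ← Algebra.TensorProduct.tmul_mul_tmul, map_mul,
    Matrix.trace_mul_comm, ← map_mul, Algebra.TensorProduct.tmul_mul_tmul]

lemma IsReducedTrace.nondeg (hT : IsReducedTrace F A T) {x : A} (hx : ∀ y, T (x * y) = 0) :
    x = 0 := by
  obtain ⟨E, _, _, n, e, he⟩ := hT
  have h1 : ∀ z : E ⊗[F] A, Matrix.trace (e (1 ⊗ₜ x) * e z) = 0 := by
    intro z
    induction z using TensorProduct.induction_on with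
    | zero => simp
    | add z z' hz hz' => rw [map_add, mul_add, Matrix.trace_add, hz, hz', add_zero]
    | tmul a y =>
      have h2 : (1 : E) ⊗ₜ[F] x * a ⊗ₜ y = a • ((1 : E) ⊗ₜ[F] (x * y)) := by
        simp [TensorProduct.smul_tmul']
      rw [← map_mul, h2, map_smul, Matrix.trace_smul, ← he, hx, map_zero, smul_zero]
  have h2 : e (1 ⊗ₜ x) = 0 := by
    ext i j
    have := h1 (e.symm (Matrix.single j i 1))
    rw [e.apply_symm_apply, Matrix.trace_mul_single] at this
    simpa using this
  have h3 : (1 : E) ⊗ₜ[F] x = 0 := by simpa using h2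
  exact Algebra.TensorProduct.includeRight_injective (R := F) (A := E) (B := A)
    (algebraMap F E).injective (by simpa using h3)

lemma IsReducedTrace.finrank_eq (hT : IsReducedTrace F A T) :
    finrank F A = deg F A * deg F A := by
  obtain ⟨E, _, _, n, e, he⟩ := hT
  have h1 : finrank F A = n * n := by
    rw [← finrank_baseChange (R := E), e.toLinearEquiv.finrank_eq, finrank_matrix]
    simp
  rw [deg, h1, Nat.sqrt_eq]

end ReducedTrace

/-- A representation of a quotient of the Clifford algebra of a quadratic pair. -/
structure CliffRep {F A S : Type} [Field F] [Ring A] [Algebra F A] [AddCommGroup S] [Module F S]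
    (T : A →ₗ[F] F) (σ : A →ₗ[F] A) (ℓ : A) (ρ : A →ₗ[F] Module.End F S) : Prop where
  sym : ∀ s, σ s = s → ρ s = T (ℓ * s) • 1
  deg2 : ∀ c : A ⊗[F] A, (∀ x, sand F A c (σ x) = sand F A c x) →
    LinearMap.mul' F _ (TensorProduct.map ρ ρ c) = ρ (sand F A c ℓ)
  gen : Algebra.adjoin F (Set.range ρ) = ⊤

section CliffRep

variable {F A : Type} [Field F] [Ring A] [Algebra F A] {T : A →ₗ[F] F} {σ : A →ₗ[F] A} {ℓ : A}

lemma CliffRep.of_surjective {S : Type} [AddCommGroup S] [Module F S]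
    (π : CliffordAlg F A T σ ℓ →ₐ[F] Module.End F S) (hπ : Function.Surjective π) :
    ∃ ρ : A →ₗ[F] Module.End F S, CliffRep T σ ℓ ρ := by
  let q : TensorAlgebra F A →ₐ[F] CliffordAlg F A T σ ℓ :=
    RingQuot.mkAlgHom F (CliffordRel F A T σ ℓ)
  have hq : Function.Surjective q := RingQuot.mkAlgHom_surjective F _
  let ρ : A →ₗ[F] Module.End F S := (π.comp q).toLinearMap ∘ₗ TensorAlgebra.ι F
  refine ⟨ρ, fun s hs => ?_, fun c hc => ?_, ?_⟩
  · have : q (TensorAlgebra.ι F s) = q (algebraMap F _ (T (ℓ * s))) :=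
      RingQuot.mkAlgHom_rel F (CliffordRel.sym s hs)
    change π (q (TensorAlgebra.ι F s)) = _
    rw [this, AlgHom.commutes, AlgHom.commutes, Algebra.algebraMap_eq_smul_one]
  · have h1 : q (mu2 F A c) = q (TensorAlgebra.ι F (sand F A c ℓ)) :=
      RingQuot.mkAlgHom_rel F (CliffordRel.deg2 c hc)
    have h2 : LinearMap.mul' F _ (TensorProduct.map ρ ρ c) = π (q (mu2 F A c)) := by
      clear hc h1
      induction c using TensorProduct.induction_on with
      | zero => simp
      | add a b ha hb => simp only [map_add, ha, hb]
      | tmul a b => simp [mu2, ρ]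
    rw [h2, h1]; rfl
  · have h1 : (π.comp q).range = ⊤ := by
      rw [AlgHom.range_eq_top]; exact hπ.comp hq
    rw [← h1, ← Algebra.map_top, ← TensorAlgebra.adjoin_range_ι, AlgHom.map_adjoin]
    congr 1
    rw [← Set.range_comp]; rfl

lemma exists_cliffRep {Cp Cm : Type} [Ring Cp] [Algebra F Cp] [Ring Cm] [Algebra F Cm]
    (hdisc : Nonempty (CliffordAlg F A T σ ℓ ≃ₐ[F] Cp × Cm))
    (hsplit : IsSplit F Cp ∨ IsSplit F Cm) :
    ∃ N : ℕ, 0 < N ∧ ∃ ρ : A →ₗ[F] Module.End F (Fin N → F), CliffRep T σ ℓ ρ := by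
  obtain ⟨φ⟩ := hdisc
  rcases hsplit with ⟨N, hN, ⟨ψ⟩⟩ | ⟨N, hN, ⟨ψ⟩⟩
  · exact ⟨N, hN, CliffRep.of_surjective
      (((ψ.trans Matrix.toLinAlgEquiv').toAlgHom.comp (AlgHom.fst F Cp Cm)).comp φ.toAlgHom)
      ((((ψ.trans Matrix.toLinAlgEquiv').surjective).comp Prod.fst_surjective).comp φ.surjective)⟩
  · exact ⟨N, hN, CliffRep.of_surjective
      (((ψ.trans Matrix.toLinAlgEquiv').toAlgHom.comp (AlgHom.snd F Cp Cm)).comp φ.toAlgHom)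
      ((((ψ.trans Matrix.toLinAlgEquiv').surjective).comp Prod.snd_surjective).comp φ.surjective)⟩

end CliffRep

section QuadraticPair

variable {F A S : Type} [Field F] [Ring A] [Algebra F A] {T : A →ₗ[F] F} {σ : A →ₗ[F] A} {ℓ : A}
  [AddCommGroup S] [Module F S] {ρ : A →ₗ[F] Module.End F S}
  (hT : IsReducedTrace F A T) (hq : IsQuadraticPair F A T σ ℓ)

lemma IsQuadraticPair.map_mul (hq : IsQuadraticPair F A T σ ℓ) (x y : A) :
    σ (x * y) = σ y * σ x := hq.1.1 x y

lemma IsQuadraticPair.invol (hq : IsQuadraticPair F A T σ ℓ) (x : A) : σ (σ x) = x := hq.1.2 x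

lemma IsQuadraticPair.trace_map (hq : IsQuadraticPair F A T σ ℓ) (x : A) : T (σ x) = T x := by
  have := hq.2.2.1 (σ x - x) (by rw [map_sub, hq.invol, neg_sub])
  rwa [map_sub, sub_eq_zero] at this

include hT hq

lemma trace_mul_map (s : A) : T (ℓ * σ s) = T (σ ℓ * s) := by
  rw [← hq.trace_map, hq.map_mul, hq.invol, hT.mul_comm]

lemma trace_mul_add_map (s : A) : T (ℓ * (s + σ s)) = T s := by
  rw [mul_add, map_add, trace_mul_map hT hq, ← map_add, ← add_mul, hq.2.2.2, one_mul]

omit hT hq in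
/-- The right ideal attached to a spinor. -/
lemma exists_spinorIdeal (ρ : A →ₗ[F] Module.End F S) (s : S) :
    ∃ I : Submodule F A, ∀ x, x ∈ I ↔ ∀ a, ρ (a * σ x) s = 0 :=
  ⟨{ carrier := {x | ∀ a, ρ (a * σ x) s = 0}
     zero_mem' := by simp
     add_mem' := fun hx hy a => by
      rw [map_add, mul_add, map_add, LinearMap.add_apply, hx a, hy a, add_zero]
     smul_mem' := fun c x hx a => by
      rw [map_smul, mul_smul_comm, map_smul, LinearMap.smul_apply, hx a, smul_zero] },
    fun _ => Iff.rfl⟩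

lemma isotropic_spinorIdeal (hρ : CliffRep T σ ℓ ρ) {s : S} (hs : s ≠ 0) {I : Submodule F A}
    (hI : ∀ x, x ∈ I ↔ ∀ a, ρ (a * σ x) s = 0) : IsIsotropicIdeal F A T σ ℓ I := by
  refine ⟨fun x hx b => ?_, fun x hx y hy => ?_, fun x hx hσ => ?_⟩
  · rw [hI] at hx ⊢
    intro a
    rw [hq.map_mul, ← mul_assoc]; exact hx _
  · refine hT.nondeg fun a => ?_
    rw [hI] at hx hy
    set z := y * a * σ x with hz
    have hσz : σ z = x * σ a * σ y := by
      rw [hz, hq.map_mul, hq.map_mul, hq.invol, mul_assoc]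
    have h1 : ρ z s = 0 := hx _
    have h2 : ρ (σ z) s = 0 := by rw [hσz]; exact hy _
    have h3 := hρ.sym (z + σ z) (by rw [map_add, hq.invol, add_comm])
    rw [trace_mul_add_map hT hq] at h3
    have h4 := DFunLike.congr_fun h3 s
    rw [map_add, LinearMap.add_apply, h1, h2, add_zero, LinearMap.smul_apply,
      Module.End.one_apply, eq_comm, smul_eq_zero] at h4
    rw [← h4.resolve_right hs, hz, mul_assoc, hT.mul_comm, mul_assoc, hT.mul_comm, mul_assoc]
  · rw [hI] at hx
    have h1 := hx 1
    rw [one_mul, hσ, hρ.sym x hσ, LinearMap.smul_apply, Module.End.one_apply, smul_eq_zero] at h1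
    exact h1.resolve_right hs

lemma two_mul_finrank_le [Module.Finite F A] {I : Submodule F A}
    (hI : ∀ x ∈ I, ∀ y ∈ I, σ x * y = 0) : 2 * finrank F I ≤ finrank F A := by
  let φ : I →ₗ[F] I.dualAnnihilator :=
    LinearMap.codRestrict _ ((LinearMap.compr₂ (LinearMap.mul F A) T) ∘ₗ σ ∘ₗ I.subtype) (by
      intro x
      rw [Submodule.mem_dualAnnihilator]
      intro y hy
      change T (σ x * y) = 0
      rw [hI x x.2 y hy, map_zero])
  have hφ : Function.Injective φ := by
    refine (injective_iff_map_eq_zero φ).mpr fun x hx => ?_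
    have h1 : σ x.1 = 0 := hT.nondeg fun y => by
      have := DFunLike.congr_fun (congrArg Subtype.val hx) y
      exact this
    have h2 : x.1 = 0 := by rw [← hq.invol x.1, h1, map_zero]
    exact Subtype.ext h2
  have h1 := LinearMap.finrank_le_finrank_of_injective hφ
  have h2 := Subspace.finrank_add_finrank_dualAnnihilator_eq I
  omega

lemma hyperbolic_of_spinor [Module.Finite F A] (hρ : CliffRep T σ ℓ ρ) {s : S} (hs : s ≠ 0)
    (h : ∀ I : Submodule F A, (∀ x, x ∈ I ↔ ∀ a, ρ (a * σ x) s = 0) →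
      finrank F A ≤ 2 * finrank F I) : QPHyperbolic F A T σ ℓ := by
  obtain ⟨I, hI⟩ := exists_spinorIdeal (σ := σ) ρ s
  have h1 := isotropic_spinorIdeal hT hq hρ hs hI
  exact ⟨I, h1, le_antisymm (two_mul_finrank_le hT hq h1.2.1) (h I hI)⟩

end QuadraticPair

section Frame

variable (F : Type) {A : Type} [Field F] [Ring A] [Algebra F A]

/-- The Peirce component `e A f`. -/
def corner (e f : A) : Submodule F A where
  carrier := {x | e * x = x ∧ x * f = x}
  zero_mem' := by simp
  add_mem' := fun ⟨h1, h2⟩ ⟨h3, h4⟩ => ⟨by rw [mul_add, h1, h3], by rw [add_mul, h2, h4]⟩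
  smul_mem' := fun c x ⟨h1, h2⟩ => ⟨by rw [mul_smul_comm, h1], by rw [smul_mul_assoc, h2]⟩

variable {F}

/-- An identification of the identity with a sum of `r` orthogonal copies of the
idempotent `e`. -/
structure IsFrame (e : A) {r : ℕ} (u u' : Fin r → A) : Prop where
  idem : e * e = e
  mul_e : ∀ a, u a * e = u a
  e_mul : ∀ a, e * u' a = u' a
  mul : ∀ a b, u' a * u b = if a = b then e else 0
  sum : ∑ a, u a * u' a = 1

namespace IsFrame

variable {e : A} {r : ℕ} {u u' : Fin r → A} (h : IsFrame e u u')

include h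

lemma mul_sum (b : Fin r) (w : Fin r → A) : u' b * ∑ a, u a * w a = e * w b := by
  simp only [Finset.mul_sum, ← mul_assoc, h.mul, ite_mul, zero_mul]
  simp

lemma sum_mul (b : Fin r) (w : Fin r → A) : (∑ a, w a * u' a) * u b = w b * e := by
  simp only [Finset.sum_mul, mul_assoc, h.mul, mul_ite, mul_zero]
  simp

lemma eq_sum (x : A) : x = ∑ a, u a * (u' a * x) := by
  simp only [← mul_assoc, ← Finset.sum_mul, h.sum, one_mul]

lemma finrank_corner (f : A) [Module.Finite F A] :
    finrank F (corner F 1 f) = r * finrank F (corner F e f) := by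
  let φ : corner F 1 f →ₗ[F] (Fin r → corner F e f) := LinearMap.pi fun a =>
    LinearMap.restrict (LinearMap.mulLeft F (u' a)) (q := corner F e f) fun x hx =>
      ⟨by rw [LinearMap.mulLeft_apply, ← mul_assoc, h.e_mul],
        by rw [LinearMap.mulLeft_apply, mul_assoc, hx.2]⟩
  have hφ : ∀ x a, (φ x a : A) = u' a * x := fun _ _ => rfl
  have hi : Function.Injective φ := by
    intro x y hxy
    ext
    rw [h.eq_sum x.1, h.eq_sum y.1]
    simp only [← hφ, hxy]
  have hs : Function.Surjective φ := by
    intro w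
    refine ⟨⟨∑ a, u a * w a, by rw [one_mul], ?_⟩, ?_⟩
    · simp only [Finset.sum_mul, mul_assoc, (w _).2.2]
    · ext b
      rw [hφ, h.mul_sum, (w b).2.1]
  rw [(LinearEquiv.ofBijective φ ⟨hi, hs⟩).finrank_eq, finrank_pi_fintype]
  simp

lemma mul_finrank_le [Module.Finite F A] {I W : Submodule F A} (hI : IsRightIdeal F A I)
    (hW : W ≤ corner F 1 e) (hWI : W ≤ I) : r * finrank F W ≤ finrank F I := by
  let φ : (Fin r → W) →ₗ[F] I := LinearMap.codRestrict I
    (LinearMap.lsum F (fun _ => W) F fun a => (LinearMap.mulRight F (u' a)) ∘ₗ W.subtype)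
    (fun w => by
      rw [LinearMap.lsum_apply, LinearMap.sum_apply]
      exact Submodule.sum_mem _ fun a _ => hI _ (hWI (w a).2) _)
  have hφ : ∀ w, (φ w : A) = ∑ a, (w a : A) * u' a := fun w => by
    simp [φ, LinearMap.lsum_apply]
  have hi : Function.Injective φ := by
    intro w z hwz
    ext b
    rw [← (hW (w b).2).2, ← (hW (z b).2).2, ← h.sum_mul b (fun a => (w a : A)),
      ← h.sum_mul b (fun a => (z a : A)), ← hφ, ← hφ, hwz]
  have := LinearMap.finrank_le_finrank_of_injective hi
  rw [finrank_pi_fintype] at this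
  simpa using this

lemma finrank_symSet_le [Module.Finite F A] {σ : A →ₗ[F] A}
    (hσ : ∀ x y, σ (x * y) = σ y * σ x) (hσ2 : ∀ x, σ (σ x) = x) :
    2 * finrank F (symSet F σ) ≤ r * (r - 1) * finrank F (corner F e (σ e)) +
      2 * r * finrank F ↥(corner F e (σ e) ⊓ symSet F σ) := by
  have hY : ∀ x a b, u' a * x * σ (u' b) ∈ corner F e (σ e) := fun x a b =>
    ⟨by rw [← mul_assoc, ← mul_assoc, h.e_mul], by rw [mul_assoc, ← hσ, h.e_mul]⟩
  have hsym : ∀ x, x ∈ symSet F σ ↔ σ x = x := fun x => by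
    rw [symSet, LinearMap.mem_ker, LinearMap.sub_apply, LinearMap.id_apply, sub_eq_zero]
  let ψ : Fin r → Fin r → A →ₗ[F] A := fun a b =>
    LinearMap.mulRight F (σ (u' b)) ∘ₗ LinearMap.mulLeft F (u' a)
  have hψ : ∀ a b x, ψ a b x = u' a * x * σ (u' b) := fun _ _ _ => rfl
  let φ1 : symSet F σ →ₗ[F] ((p : (a : Fin r) × Fin a) → corner F e (σ e)) :=
    LinearMap.pi fun p => LinearMap.restrict (ψ (Fin.castLE p.1.2.le p.2) p.1)
      fun x _ => hY x _ _
  let φ2 : symSet F σ →ₗ[F] (Fin r → ↥(corner F e (σ e) ⊓ symSet F σ)) :=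
    LinearMap.pi fun a => LinearMap.restrict (ψ a a) fun x hx =>
      ⟨hY x _ _, (hsym _).mpr (by rw [hψ, hσ, hσ, hσ2, (hsym x).mp hx, mul_assoc])⟩
  have hi : Function.Injective (φ1.prod φ2) := by
    refine (injective_iff_map_eq_zero _).mpr fun x hx => ?_
    have h1 : φ1 x = 0 := congrArg Prod.fst hx
    have h2 : φ2 x = 0 := congrArg Prod.snd hx
    have hx' : σ x.1 = x.1 := (hsym _).mp x.2
    have h3 : ∀ a b : Fin r, b < a → u' b * x.1 * σ (u' a) = 0 := fun a b hab =>
      congrArg Subtype.val (congrFun h1 ⟨a, ⟨b, hab⟩⟩)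
    have h4 : ∀ a b : Fin r, u' a * x.1 * σ (u' b) = 0 := by
      intro a b
      rcases lt_trichotomy a b with hab | rfl | hab
      · exact h3 b a hab
      · exact congrArg Subtype.val (congrFun h2 a)
      · have := congrArg σ (h3 a b hab)
        rwa [hσ, hσ, hσ2, hx', map_zero, ← mul_assoc] at this
    have h5 : ∀ a, u' a * x.1 = 0 := by
      intro a
      rw [← hσ2 (u' a * x.1), h.eq_sum (σ (u' a * x.1))]
      rw [Finset.sum_eq_zero, map_zero]
      intro b _
      rw [hσ, hx', ← mul_assoc (u' b)]
      have := congrArg σ (h4 a b)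
      rw [hσ, hσ, hσ2, hx', map_zero, ← mul_assoc] at this
      rw [this, mul_zero]
    ext
    rw [h.eq_sum x.1]
    simp [h5]
  have h1 := LinearMap.finrank_le_finrank_of_injective hi
  rw [finrank_prod, finrank_pi_fintype, finrank_pi_fintype] at h1
  simp only [Finset.sum_const, Finset.card_univ, smul_eq_mul, Fintype.card_sigma,
    Fintype.card_fin, Fin.sum_univ_eq_sum_range (fun i => i) r] at h1
  have h2 := Finset.sum_range_id_mul_two r
  rw [← h2]
  linarith

end IsFrame

/-- An identification of `D` with the Peirce component `e A e`. -/
structure IsCornerIso {D : Type} [Ring D] [Algebra F D] (e : A) (ι : D →ₗ[F] A) : Prop where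
  map_mul : ∀ x y, ι (x * y) = ι x * ι y
  map_one : ι 1 = e
  inj : Function.Injective ι
  surj : ∀ x ∈ corner F e e, ∃ d, ι d = x

namespace IsCornerIso

variable {D : Type} [Ring D] [Algebra F D] {e : A} {ι : D →ₗ[F] A} (h : IsCornerIso e ι)

include h

lemma mem (d : D) : ι d ∈ corner F e e :=
  ⟨by rw [← h.map_one, ← h.map_mul, one_mul], by rw [← h.map_one, ← h.map_mul, mul_one]⟩

lemma finrank_eq : finrank F (corner F e e) = finrank F D := by
  refine (LinearEquiv.ofBijective (LinearMap.codRestrict (corner F e e) ι h.mem)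
    ⟨fun x y hxy => h.inj (congrArg Subtype.val hxy), fun x => ?_⟩).finrank_eq.symm
  obtain ⟨d, hd⟩ := h.surj x.1 x.2
  exact ⟨d, Subtype.ext hd⟩

end IsCornerIso

lemma exists_frame (hA : IsCSA F A) :
    ∃ (D : Type) (_ : DivisionRing D) (_ : Algebra F D) (r : ℕ) (_ : 0 < r)
      (_ : Module.Finite F D) (_ : A ≃ₐ[F] Matrix (Fin r) (Fin r) D)
      (e : A) (ι : D →ₗ[F] A) (u u' : Fin r → A),
      IsFrame e u u' ∧ IsCornerIso e ι ∧ finrank F A = r * r * finrank F D ∧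
      ∀ x : D, (∀ y, x * y = y * x) → ∃ k : F, x = algebraMap F D k := by
  obtain ⟨_, _, _⟩ := hA
  have : IsArtinianRing A := IsArtinianRing.of_finite F A
  obtain ⟨r, hr, D, _, _, _, ⟨φ⟩⟩ := IsSimpleRing.exists_algEquiv_matrix_divisionRing_finite F A
  let o : Fin r := 0
  refine ⟨D, inferInstance, inferInstance, r, Nat.pos_of_ne_zero hr.ne, inferInstance, φ,
    φ.symm (Matrix.single o o 1),
    φ.symm.toLinearMap ∘ₗ Matrix.singleLinearMap F o o,
    fun a => φ.symm (Matrix.single a o 1), fun a => φ.symm (Matrix.single o a 1),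
    ⟨?_, ?_, ?_, ?_, ?_⟩, ⟨?_, ?_, ?_, ?_⟩, ?_, ?_⟩
  · rw [← map_mul]; simp
  · intro a; rw [← map_mul]; simp
  · intro a; rw [← map_mul]; simp
  · intro a b
    rw [← map_mul]
    split_ifs with hab
    · subst hab; simp
    · rw [Matrix.single_mul_single_of_ne _ _ _ _ hab, map_zero]
  · simp only [← map_mul, ← map_sum]
    rw [← map_one φ.symm]
    congr 1
    simp [Matrix.sum_single_one]
  · intro x y
    simp [← map_mul]
  · simp
  · intro x y hxy
    have := congrFun (congrFun (φ.symm.injective hxy) o) o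
    simpa using this
  · rintro x ⟨h1, h2⟩
    refine ⟨φ x o o, φ.injective ?_⟩
    have h3 : Matrix.single o o 1 * φ x * Matrix.single o o 1 = φ x := by
      apply φ.symm.injective
      rw [map_mul, map_mul, φ.symm_apply_apply, h1, h2]
    rw [← h3]
    simp
  · rw [φ.toLinearEquiv.finrank_eq, finrank_matrix]; simp
  · intro x hx
    have : Algebra.IsCentral F (Matrix (Fin r) (Fin r) D) := Algebra.IsCentral.of_algEquiv F A _ φ
    have h1 : Matrix.scalar (Fin r) x ∈ Subalgebra.center F (Matrix (Fin r) (Fin r) D) := by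
      rw [Subalgebra.mem_center_iff]
      intro M
      ext i j
      simp [hx]
    rw [Algebra.IsCentral.center_eq_bot, Algebra.mem_bot] at h1
    obtain ⟨k, hk⟩ := h1
    refine ⟨k, ?_⟩
    have := congrFun (congrFun hk o) o
    simpa [Matrix.algebraMap_eq_diagonal] using this.symm

end Frame

section Index

variable {F : Type} [Field F]

lemma card_le_of_orthogonal_idempotents {D κ ι : Type} [DivisionRing D] [Fintype κ] [Fintype ι]
    [DecidableEq κ] [DecidableEq ι] (f : κ → Matrix ι ι D) (hf : ∀ k, f k ≠ 0)
    (hm : ∀ k l, f k * f l = if k = l then f k else 0) : Fintype.card κ ≤ Fintype.card ι := by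
  have h1 : ∀ k, ∃ x : ι → D, Matrix.vecMul x (f k) ≠ 0 := by
    intro k
    by_contra! h
    apply hf k
    ext i j
    simpa using congrFun (h (Pi.single i 1)) j
  choose x hx using h1
  have h2 : ∀ k l, Matrix.vecMul (Matrix.vecMul (x k) (f k)) (f l) =
      if k = l then Matrix.vecMul (x k) (f k) else 0 := by
    intro k l
    rw [Matrix.vecMul_vecMul, hm]
    split_ifs <;> simp
  have h3 : LinearIndependent D fun k => Matrix.vecMul (x k) (f k) := by
    rw [Fintype.linearIndependent_iff]
    intro g hg l
    have h4 := congrArg (fun y => Matrix.vecMul y (f l)) hg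
    simp only [Matrix.sum_vecMul, Matrix.smul_vecMul, h2, smul_ite, smul_zero, Matrix.zero_vecMul,
      Finset.sum_ite_eq', Finset.mem_univ, if_true] at h4
    exact (smul_eq_zero.mp h4).resolve_right (hx l)
  simpa using h3.fintype_card_le_finrank

lemma finrank_le_of_matrix_algEquiv {A D D' : Type} [Ring A] [Algebra F A] [DivisionRing D]
    [Algebra F D] [Ring D'] [Nontrivial D'] [Algebra F D'] {r n m : ℕ} (hr : 0 < r) (hn : 0 < n)
    (φ : A ≃ₐ[F] Matrix (Fin r) (Fin r) D)
    (ψ : Matrix (Fin n) (Fin n) A ≃ₐ[F] Matrix (Fin m) (Fin m) D') :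
    finrank F D ≤ finrank F D' := by
  let χ : Matrix (Fin n × Fin r) (Fin n × Fin r) D ≃ₐ[F] Matrix (Fin m) (Fin m) D' :=
    ((Matrix.compAlgEquiv (Fin n) (Fin r) D F).symm.trans φ.symm.mapMatrix).trans ψ
  have h1 : m ≤ n * r := by
    have := card_le_of_orthogonal_idempotents
      (fun k : Fin m => χ.symm (Matrix.single k k 1)) (fun k hk => by
        rw [EmbeddingLike.map_eq_zero_iff] at hk
        have := congrFun (congrFun hk k) k
        simp at this) (fun k l => by
        rw [← map_mul]
        split_ifs with hkl
        · subst hkl; simp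
        · rw [Matrix.single_mul_single_of_ne _ _ _ _ hkl, map_zero])
    simpa using this
  have h2 := χ.toLinearEquiv.finrank_eq
  rw [finrank_matrix, finrank_matrix] at h2
  simp only [Fintype.card_prod, Fintype.card_fin] at h2
  have h3 : m * m ≤ (n * r) * (n * r) := Nat.mul_le_mul h1 h1
  have h4 : 0 < (n * r) * (n * r) := by positivity
  refine Nat.le_of_mul_le_mul_left ?_ h4
  rw [h2]
  exact Nat.mul_le_mul_right _ h3

lemma finrank_eq_one_or_four {A D : Type} [Ring A] [Algebra F A] [DivisionRing D] [Algebra F D]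
    [Module.Finite F D] (hA : IsCSA F A) (hdeg : finrank F A = deg F A * deg F A)
    (hind : schurIndex F A ≤ 2) {r : ℕ} (hr : 0 < r) (φ : A ≃ₐ[F] Matrix (Fin r) (Fin r) D) :
    (finrank F D = 1 ∧ deg F A = r) ∨ (finrank F D = 4 ∧ deg F A = 2 * r) := by
  have hA' := hA
  obtain ⟨_, _, _⟩ := hA
  have hpos : 0 < finrank F A := finrank_pos
  have h1 := Nat.sInf_mem (s := { d : ℕ | 0 < d ∧ ∃ (D : Type) (_ : Ring D) (_ : Algebra F D),
    IsCSA F D ∧ Module.finrank F D = d * d ∧ BrauerEquiv F A D })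
    ⟨deg F A, Nat.pos_of_ne_zero fun h => by rw [hdeg, h] at hpos; exact absurd hpos (by simp),
      A, _, _, hA', hdeg, 1, 1, one_pos, one_pos, ⟨AlgEquiv.refl⟩⟩
  obtain ⟨_, D', _, _, ⟨_, _, _⟩, hD', n, m, hn, hm, ⟨ψ⟩⟩ := h1
  have h2 := finrank_le_of_matrix_algEquiv hr hn φ ψ
  rw [hD'] at h2
  have h3 : finrank F D ≤ 4 := h2.trans (Nat.mul_le_mul hind hind)
  have h4 := φ.toLinearEquiv.finrank_eq
  rw [finrank_matrix, Fintype.card_fin, hdeg] at h4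
  have h5 : r ∣ deg F A := by
    rw [← Nat.pow_dvd_pow_iff two_ne_zero, pow_two, pow_two, h4]
    exact Dvd.intro _ rfl
  obtain ⟨q, hq⟩ := h5
  have h6 : finrank F D = q * q := by
    rw [hq] at h4
    refine Nat.eq_of_mul_eq_mul_left (Nat.mul_pos hr hr) ?_
    rw [← h4]; ring
  have h7 : 0 < finrank F D := finrank_pos
  have h8 : q ≤ 2 := by by_contra!; nlinarith
  interval_cases q
  · omega
  · exact Or.inl ⟨h6, by rw [hq, mul_one]⟩
  · exact Or.inr ⟨h6, by rw [hq, mul_comm]⟩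

end Index

section Corner

variable {F A D : Type} [Field F] [Ring A] [Algebra F A] [DivisionRing D] [Algebra F D]
  {T : A →ₗ[F] F} {σ : A →ₗ[F] A} {ℓ e : A} {r : ℕ} {u u' : Fin r → A} {ι : D →ₗ[F] A}

lemma IsCornerIso.exists_inv (hι : IsCornerIso e ι) {x : A} (hx : x ∈ corner F e e) (hx0 : x ≠ 0) :
    ∃ z ∈ corner F e e, z * x = e ∧ x * z = e := by
  obtain ⟨d, rfl⟩ := hι.surj x hx
  have hd : d ≠ 0 := by rintro rfl; exact hx0 (map_zero _)
  exact ⟨ι d⁻¹, hι.mem _, by rw [← hι.map_mul, inv_mul_cancel₀ hd, hι.map_one],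
    by rw [← hι.map_mul, mul_inv_cancel₀ hd, hι.map_one]⟩

lemma IsCornerIso.ne_zero (hι : IsCornerIso e ι) : e ≠ 0 := by
  rw [← hι.map_one, ← map_zero ι]
  exact fun h => one_ne_zero (hι.inj h)

lemma IsFrame.exists_inv (h : IsFrame e u u') (hι : IsCornerIso e ι)
    (hq : IsQuadraticPair F A T σ ℓ) {t : A} (ht : t ∈ corner F (σ e) e) (ht0 : t ≠ 0) :
    ∃ y ∈ corner F e (σ e), y * t = e ∧ t * y = σ e := by
  obtain ⟨a, ha⟩ : ∃ a, u' a * t ≠ 0 := by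
    by_contra! h1
    apply ht0
    rw [h.eq_sum t]
    simp [h1]
  obtain ⟨z, hz, hz1, -⟩ := hι.exists_inv (x := u' a * t)
    ⟨by rw [← mul_assoc, h.e_mul], by rw [mul_assoc, ht.2]⟩ ha
  have hσe : σ e * σ e = σ e := by rw [← hq.map_mul, h.idem]
  have hy : z * u' a * σ e ∈ corner F e (σ e) :=
    ⟨by rw [← mul_assoc, ← mul_assoc, hz.1], by rw [mul_assoc, hσe]⟩
  have hyt : z * u' a * σ e * t = e := by rw [mul_assoc _ (σ e), ht.1, mul_assoc, hz1]
  refine ⟨_, hy, hyt, ?_⟩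
  set y := z * u' a * σ e
  have h1 : σ (t * y) * σ (t * y) = σ (t * y) := by
    rw [← hq.map_mul, mul_assoc t y, ← mul_assoc y t y, hyt, hy.1]
  have h2 : σ (t * y) ∈ corner F e e :=
    ⟨by nth_rw 1 [← hq.invol e]; rw [← hq.map_mul, mul_assoc, hy.2],
      by nth_rw 1 [← hq.invol e]; rw [← hq.map_mul, ← mul_assoc, ht.1]⟩
  have h3 : σ (t * y) ≠ 0 := by
    intro h0
    have h4 : t * y = 0 := by rw [← hq.invol (t * y), h0, map_zero]
    apply ht0
    rw [← ht.2, ← hyt, ← mul_assoc, h4, zero_mul]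
  obtain ⟨w, hw, hw1, -⟩ := hι.exists_inv h2 h3
  have h4 : σ (t * y) = e := by
    rw [← h2.1, ← hw1, mul_assoc, h1]
  rw [← hq.invol (t * y), h4]

lemma IsFrame.hyperbolic_of_annihilator [Module.Finite F A] (h : IsFrame e u u')
    (hT : IsReducedTrace F A T) (hq : IsQuadraticPair F A T σ ℓ)
    {S : Type} [AddCommGroup S] [Module F S] {ρ : A →ₗ[F] Module.End F S}
    (hρ : CliffRep T σ ℓ ρ) {s : S} (hs : s ≠ 0) {W : Submodule F A} (hW : W ≤ corner F 1 e)
    (hWs : ∀ w ∈ W, ∀ a, ρ (a * σ w) s = 0) (hdim : finrank F A ≤ 2 * (r * finrank F W)) :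
    QPHyperbolic F A T σ ℓ := by
  refine hyperbolic_of_spinor hT hq hρ hs fun I hI => ?_
  have h1 := h.mul_finrank_le (isotropic_spinorIdeal hT hq hρ hs hI).1 hW
    (fun w hw => (hI w).mpr (hWs w hw))
  omega

lemma _root_.Submodule.exists_le_finrank_eq {V : Type} [AddCommGroup V] [Module F V]
    [FiniteDimensional F V] (W : Submodule F V) {k : ℕ} (hk : k ≤ finrank F W) :
    ∃ X ≤ W, finrank F X = k := by
  obtain ⟨f, hf⟩ := exists_linearIndependent_of_le_finrank hk
  refine ⟨(Submodule.span F (Set.range f)).map W.subtype, Submodule.map_subtype_le _ _, ?_⟩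
  rw [Submodule.finrank_map_subtype_eq, finrank_span_eq_card hf, Fintype.card_fin]

end Corner

section Split

variable {F A S : Type} [Field F] [Ring A] [Algebra F A] [Module.Finite F A]
  {T : A →ₗ[F] F} {σ : A →ₗ[F] A} {ℓ e g t : A} {r : ℕ} {u u' : Fin r → A}
  [AddCommGroup S] [Module F S] [FiniteDimensional F S] [Nontrivial S]
  {ρ : A →ₗ[F] Module.End F S}

lemma exists_symmetric_generator (hq : IsQuadraticPair F A T σ ℓ) {D : Type} [DivisionRing D]
    [Algebra F D] [Module.Finite F D] (hr : 0 < r) (h : IsFrame e u u') {ι : D →ₗ[F] A}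
    (hι : IsCornerIso e ι) (hD : finrank F D = 1) (hdeg : deg F A = r) :
    (∀ x ∈ corner F e e, ∃ k : F, x = k • e) ∧
    ∃ g ∈ corner F e (σ e), ∃ t ∈ corner F (σ e) e, g * t = e ∧ t * g = σ e ∧ σ g = g := by
  have hc : ∀ x ∈ corner F e e, ∃ k : F, x = k • e := by
    intro x hx
    obtain ⟨d, rfl⟩ := hι.surj x hx
    obtain ⟨k, hk⟩ := (finrank_eq_one_iff_of_nonzero' (1 : D) one_ne_zero).mp hD d
    exact ⟨k, by rw [← hk, map_smul, hι.map_one]⟩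
  refine ⟨hc, ?_⟩
  have hσe : σ e * σ e = σ e := by rw [← hq.map_mul, h.idem]
  have hσe0 : σ e ≠ 0 := fun h0 => hι.ne_zero (by rw [← hq.invol e, h0, map_zero])
  obtain ⟨a, ha⟩ : ∃ a, σ e * u a ≠ 0 := by
    by_contra! h1
    apply hσe0
    rw [← mul_one (σ e), ← h.sum, Finset.mul_sum]
    simp [← mul_assoc, h1]
  have ht : σ e * u a ∈ corner F (σ e) e :=
    ⟨by rw [← mul_assoc, hσe], by rw [mul_assoc, h.mul_e]⟩
  obtain ⟨g, hg, hgt, htg⟩ := h.exists_inv hι hq ht ha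
  refine ⟨g, hg, _, ht, hgt, htg, ?_⟩
  set t := σ e * u a
  have hg0 : g ≠ 0 := by rintro rfl; rw [zero_mul] at hgt; exact hι.ne_zero hgt.symm
  have hY : ∀ y ∈ corner F e (σ e), ∃ k : F, y = k • g := by
    intro y hy
    obtain ⟨k, hk⟩ := hc (y * t) ⟨by rw [← mul_assoc, hy.1], by rw [mul_assoc, ht.2]⟩
    exact ⟨k, by rw [← hy.2, ← htg, ← mul_assoc, hk, smul_mul_assoc, hg.1]⟩
  obtain ⟨ε, hε⟩ := hY (σ g) ⟨by nth_rw 1 [← hq.invol e]; rw [← hq.map_mul, hg.2],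
    by rw [← hq.map_mul, hg.1]⟩
  by_cases hε1 : ε = 1
  · rw [hε, hε1, one_smul]
  exfalso
  have h1 := h.finrank_symSet_le (F := F) hq.map_mul hq.invol
  have h2 : corner F e (σ e) ⊓ symSet F σ = ⊥ := by
    rw [eq_bot_iff]
    rintro y ⟨hy, hy'⟩
    obtain ⟨k, rfl⟩ := hY y hy
    have h3 : σ (k • g) = k • g := by
      rwa [symSet, SetLike.mem_coe, LinearMap.mem_ker, LinearMap.sub_apply, LinearMap.id_apply,
        sub_eq_zero] at hy'
    rw [map_smul, hε, smul_smul, ← sub_eq_zero, ← sub_smul, smul_eq_zero] at h3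
    have h4 : k * (ε - 1) = 0 := by linear_combination h3.resolve_right hg0
    rw [(mul_eq_zero.mp h4).resolve_right (sub_ne_zero.mpr hε1), zero_smul]
    exact Submodule.zero_mem _
  have h3 : finrank F (corner F e (σ e)) ≤ 1 := by
    refine (Submodule.finrank_mono (t := Submodule.span F {g}) fun y hy => ?_).trans
      (finrank_span_singleton hg0).le
    obtain ⟨k, rfl⟩ := hY y hy
    exact Submodule.smul_mem _ _ (Submodule.mem_span_singleton_self _)
  rw [h2, finrank_bot, hq.2.1, hdeg, mul_zero, add_zero] at h1
  have h4 : r * (r - 1) * finrank F (corner F e (σ e)) ≤ r * (r - 1) * 1 :=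
    Nat.mul_le_mul_left _ h3
  have h5 : r * (r - 1) < r * (r + 1) := Nat.mul_lt_mul_of_pos_left (by omega) hr
  omega

theorem hyperbolic_of_finrank_corner_eq_one (hF : PfisterUniversal F)
    (hT : IsReducedTrace F A T) (hq : IsQuadraticPair F A T σ ℓ) (hρ : CliffRep T σ ℓ ρ)
    (h : IsFrame e u u') {k : ℕ} (hrk : r = 2 * k + 4) (he0 : e ≠ 0)
    (hc : ∀ x ∈ corner F e e, ∃ k : F, x = k • e)
    (hg : g ∈ corner F e (σ e)) (ht : t ∈ corner F (σ e) e) (hgt : g * t = e) (htg : t * g = σ e)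
    (hσg : σ g = g) (hA : finrank F A = r * r) : QPHyperbolic F A T σ ℓ := by
  have hσt : σ t = t := by
    have h1 : σ t * g = σ e := by nth_rw 1 [← hσg]; rw [← hq.map_mul, hgt]
    have h2 : σ t * e = σ t := by nth_rw 1 [← hq.invol e]; rw [← hq.map_mul, ht.1]
    rw [← h2, ← hgt, ← mul_assoc, h1, ht.1]
  have hgtg : g * t * g = g := by rw [hgt, hg.1]
  have hcol : finrank F (corner F 1 e) = r := by
    rw [h.finrank_corner]
    have : corner F e e = Submodule.span F {e} := by
      ext x
      rw [Submodule.mem_span_singleton]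
      constructor
      · intro hx; obtain ⟨k, hk⟩ := hc x hx; exact ⟨k, hk.symm⟩
      · rintro ⟨k, rfl⟩; exact Submodule.smul_mem _ _ ⟨h.idem, h.idem⟩
    rw [this, finrank_span_singleton he0, mul_one]
  have hquad : ∀ z ∈ corner F (σ e) e, ∃ k : F, z = k • t := by
    intro z hz
    obtain ⟨k, hk⟩ := hc (g * z) ⟨by rw [← mul_assoc, hg.1], by rw [mul_assoc, hz.2]⟩
    exact ⟨k, by rw [← hz.1, ← htg, mul_assoc, hk, mul_smul_comm, ht.2]⟩
  have hv : ∀ v : corner F 1 e, (v : A) * e = v := fun v => v.2.2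
  have hσv : ∀ v : corner F 1 e, σ e * σ v = σ v := fun v => by rw [← hq.map_mul, hv]
  let G : corner F 1 e →ₗ[F] corner F 1 e →ₗ[F] A :=
    LinearMap.mk₂ F (fun v w => v * g * σ w) (by intros; simp [add_mul])
      (by intros; simp) (by intros; simp [mul_add]) (by intros; simp)
  have hG : ∀ v w, G v w = v * g * σ w := fun _ _ => rfl
  have hσG : ∀ v w, σ (G v w) = G w v := fun v w => by
    rw [hG, hG, hq.map_mul, hq.map_mul, hq.invol, hσg, mul_assoc]
  let B : corner F 1 e →ₗ[F] corner F 1 e →ₗ[F] F :=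
    G.compr₂ (T ∘ₗ LinearMap.mulLeft F ℓ)
  let β : corner F 1 e →ₗ[F] corner F 1 e →ₗ[F] Module.End F S := G.compr₂ ρ
  have hB : ∀ v w, B v w = T (ℓ * G v w) := fun _ _ => rfl
  have hβ : ∀ v w, β v w = ρ (G v w) := fun _ _ => rfl
  have hpol : ∀ v w, pol B v w = T (G v w) := by
    intro v w
    rw [pol_apply, hB, hB, ← map_add, ← mul_add, ← hσG v w, trace_mul_add_map hT hq]
  have hnd : ∀ v, (∀ w, pol B v w = 0) → v = 0 := by
    intro v hvw
    have h1 : (v : A) * g = 0 := hT.nondeg fun a => by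
      have := hvw ⟨σ a * e, by rw [one_mul], by rw [mul_assoc, h.idem]⟩
      rwa [hpol, hG, hq.map_mul, hq.invol, ← mul_assoc, mul_assoc _ g, hg.2] at this
    have h2 : (v : A) * g * t = v := by rw [mul_assoc, hgt, hv]
    rw [h1, zero_mul] at h2
    exact Subtype.ext h2.symm
  have hself : ∀ v, β v v = B v v • (1 : Module.End F S) := fun v =>
    hρ.sym _ (hσG v v)
  have hmul : ∀ v, ∃ k : F, B v v = k * T e ∧ ∀ x y, β x v * β v y = k • β x y := by
    intro v
    have hmem : ∀ x, σ v * x * v ∈ corner F (σ e) e := fun x =>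
      ⟨by rw [← mul_assoc, ← mul_assoc, hσv], by rw [mul_assoc, hv]⟩
    obtain ⟨k, hk⟩ := hquad _ (hmem ℓ)
    refine ⟨k, ?_, fun x y => ?_⟩
    · have h1 : g * σ v * (ℓ * v) = g * (σ v * ℓ * v) := by simp only [mul_assoc]
      rw [hB, hG, mul_assoc, ← mul_assoc ℓ, hT.mul_comm, h1, hk, mul_smul_comm, hgt, map_smul,
        smul_eq_mul]
    · have h1 := hρ.deg2 (G x v ⊗ₜ G v y) (fun z => by
        obtain ⟨m, hm⟩ := hquad _ (hmem z)
        have hm' : σ v * σ z * v = σ v * z * v := by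
          have := congrArg σ hm
          rwa [hq.map_mul, hq.map_mul, hq.invol, map_smul, hσt, ← hm, ← mul_assoc] at this
        change G x v * σ z * G v y = G x v * z * G v y
        have h2 : ∀ z, G x v * z * G v y = x * g * (σ v * z * v) * g * σ y := fun z => by
          simp only [hG, mul_assoc]
        rw [h2, h2, hm'])
      change ρ (G x v) * ρ (G v y) = ρ (G x v * ℓ * G v y) at h1
      have h2 : G x v * ℓ * G v y = k • G x y := by
        have : G x v * ℓ * G v y = x * g * (σ v * ℓ * v) * g * σ y := by
          simp only [hG, mul_assoc]
        rw [this, hk, hG]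
        simp only [mul_smul_comm, smul_mul_assoc]
        rw [mul_assoc (x : A) g t, mul_assoc (x : A), hgtg]
      rw [hβ, hβ, h1, h2, map_smul, hβ]
  have : Nontrivial (corner F 1 e) := Module.nontrivial_of_finrank_pos (R := F) (by omega)
  have hTe : T e = 1 := by
    obtain ⟨v, hv⟩ := exists_anisotropic hnd
    obtain ⟨k, hk1, hk2⟩ := hmul v
    have h1 := hk2 v v
    rw [hself, smul_mul_smul_comm, smul_smul, mul_one, ← sub_eq_zero, ← sub_smul, smul_eq_zero]
      at h1
    have h2 : B v v * (B v v - k) = 0 := by linear_combination h1.resolve_right one_ne_zero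
    have h3 : B v v = k := by
      linear_combination (mul_eq_zero.mp h2).resolve_left hv
    rw [h3] at hk1 hv
    have h4 : k * (T e - 1) = 0 := by linear_combination -hk1
    linear_combination (mul_eq_zero.mp h4).resolve_left hv
  have hspin : IsSpin B β := by
    refine ⟨hself, fun x v y => ?_, ?_, hnd⟩
    · obtain ⟨k, hk1, hk2⟩ := hmul v
      rw [hk2, hk1, hTe, mul_one]
    · rw [← top_le_iff, ← hρ.gen, Algebra.adjoin_le_iff]
      rintro _ ⟨a, rfl⟩
      have h1 : a = ∑ b, G ⟨a * u b, by rw [one_mul], by rw [mul_assoc, h.mul_e]⟩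
          ⟨σ (u' b) * t, by rw [one_mul], by rw [mul_assoc, ht.2]⟩ := by
        simp only [hG]
        nth_rw 1 [← mul_one a, ← h.sum, Finset.mul_sum]
        refine Finset.sum_congr rfl fun b _ => ?_
        rw [hq.map_mul, hσt, hq.invol, mul_assoc _ g, ← mul_assoc g t, hgt, h.e_mul,
          mul_assoc]
      rw [h1, map_sum]
      exact Subalgebra.sum_mem _ fun b _ => Algebra.subset_adjoin ⟨(_, _), rfl⟩
  obtain ⟨W, hW, hWdim⟩ := hspin.exists_lagrangian (k + 2) F hF _ _ _ _ (by omega)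
  obtain ⟨X, hXW, hX⟩ := W.exists_le_finrank_eq (k := k) (by omega)
  obtain ⟨⟨s, hs, hs0⟩, hp⟩ := IsSpin.pure k _ _ _ _ hspin (by omega) W X hW hWdim hXW hX
  refine h.hyperbolic_of_annihilator hT hq hρ hs0 (W := (spinAnn β s).map (Submodule.subtype _))
    (Submodule.map_subtype_le _ _) ?_ ?_
  · rintro _ ⟨w, hw, rfl⟩ a
    have := mem_spinAnn.mp hw ⟨a * t, by rw [one_mul], by rw [mul_assoc, ht.2]⟩
    rwa [hβ, hG, mul_assoc a, htg, mul_assoc, hσv] at this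
  · rw [Submodule.finrank_map_subtype_eq, hA]
    have := hp s hs hs0
    nlinarith

end Split

section Quaternion

/-- A quaternion basis `1, i, j, i j` with unit `e`, adapted to the involution `τ`. -/
structure QuatBasis {F A : Type} [Field F] [Ring A] [Algebra F A] (τ : A →ₗ[F] A) (e i j : A)
    (c b : F) : Prop where
  map_i : i + τ i = e
  map_j : τ j = j
  i_mul_i : i * i = i - c • e
  j_mul_i : j * i = (e - i) * j
  j_mul_j : j * j = b • e
  ne_zero : b ≠ 0
  aniso : ∀ x y, nm c x y = 0 → x = 0 ∧ y = 0

variable {F D : Type} [Field F] [DivisionRing D] [Algebra F D] {τ : D →ₗ[F] D}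

lemma exists_add_map_eq_one (hD : finrank F D = 4)
    (hcen : ∀ x : D, (∀ y, x * y = y * x) → ∃ k : F, x = algebraMap F D k)
    (hτ : ∀ x y, τ (x * y) = τ y * τ x) {l : D} (hl : l + τ l = 1) (hτ2 : ∀ x, τ (τ x) = x) :
    ∃ i, i + τ i = 1 ∧ ∀ k : F, i ≠ k • (1 : D) := by
  by_cases h : ∀ k : F, l ≠ k • (1 : D)
  · exact ⟨l, hl, h⟩
  push Not at h
  obtain ⟨k, rfl⟩ := h
  obtain ⟨x, hx⟩ : ∃ x, τ x ≠ x := by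
    by_contra! h1
    have h2 : ∀ x : D, ∃ k : F, k • (1 : D) = x := fun x => by
      obtain ⟨k, hk⟩ := hcen x fun y => by rw [← h1 (x * y), hτ, h1, h1]
      exact ⟨k, by rw [hk, Algebra.algebraMap_eq_smul_one]⟩
    have := finrank_le_one (1 : D) h2
    omega
  have hτ1 : τ 1 = 1 := by
    have h1 := hτ 1 (τ 1)
    rwa [one_mul, hτ2, one_mul, eq_comm] at h1
  rw [map_smul, hτ1] at hl
  refine ⟨k • 1 + (x - τ x), by
    rw [map_add, map_sub, hτ2, map_smul, hτ1]
    linear_combination (norm := module) (1 : F) • hl, fun m hm => ?_⟩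
  have h1 : x - τ x = (m - k) • (1 : D) := by rw [sub_smul, ← hm]; abel
  have h2 : τ x - x = (m - k) • (1 : D) := by
    have := congrArg τ h1
    rwa [map_sub, hτ2, map_smul, hτ1] at this
  have h3 : (2 * (m - k)) • (1 : D) = 0 := by
    linear_combination (norm := module) -(1 : F) • h1 - (1 : F) • h2
  have h4 : (2 * k - 1) • (1 : D) = 0 := by
    linear_combination (norm := module) (1 : F) • hl
  have h3' := (smul_eq_zero.mp h3).resolve_right one_ne_zero
  have h4' := (smul_eq_zero.mp h4).resolve_right one_ne_zero
  have h5 : m - k = 0 := by linear_combination k * h3' - (m - k) * h4'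
  rw [h5, zero_smul, sub_eq_zero] at h1
  exact hx h1.symm

theorem exists_quatBasis (hD : finrank F D = 4)
    (hcen : ∀ x : D, (∀ y, x * y = y * x) → ∃ k : F, x = algebraMap F D k)
    (hτ : ∀ x y, τ (x * y) = τ y * τ x) (hτ2 : ∀ x, τ (τ x) = x) {l : D} (hl : l + τ l = 1)
    (hsym : (2 : F) ≠ 0 → ∃ s, τ s = s ∧ ∀ k : F, s ≠ k • (1 : D)) :
    ∃ (i j : D) (c b : F), QuatBasis τ 1 i j c b ∧
      ∀ d : D, ∃ x y z w : F, d = x • 1 + y • i + z • j + w • (i * j) := by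
  have : FiniteDimensional F D := FiniteDimensional.of_finrank_pos (by omega)
  obtain ⟨i, hi, hiF⟩ := exists_add_map_eq_one hD hcen hτ hl hτ2
  have hτ1 : τ 1 = 1 := by
    have h1 := hτ 1 (τ 1)
    rwa [one_mul, hτ2, one_mul, eq_comm] at h1
  have hτi : τ i = 1 - i := by rw [← hi]; abel
  have hind : ∀ x y : F, x • (1 : D) + y • i = 0 → x = 0 ∧ y = 0 := by
    intro x y hxy
    by_cases hy : y = 0
    · subst hy
      exact ⟨by simpa using hxy, rfl⟩
    · refine absurd ?_ (hiF (-(y⁻¹ * x)))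
      have h1 : y • (i - -(y⁻¹ * x) • (1 : D)) = 0 := by
        rw [← hxy, smul_sub, smul_smul, mul_neg, mul_inv_cancel_left₀ hy, neg_smul]
        abel
      exact sub_eq_zero.mp ((smul_eq_zero.mp h1).resolve_left hy)
  let C : Submodule F D :=
    LinearMap.ker (LinearMap.mulLeft F i - LinearMap.mulRight F i)
  have hC : ∀ x, x ∈ C ↔ i * x = x * i := fun x => by
    rw [LinearMap.mem_ker, LinearMap.sub_apply, sub_eq_zero]; rfl
  obtain ⟨x₀, hx₀⟩ : ∃ x, x ∉ C := by
    by_contra! h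
    obtain ⟨k, hk⟩ := hcen i fun y => (hC y).mp (h y)
    exact hiF k (by rw [hk, Algebra.algebraMap_eq_smul_one])
  have hCinv : ∀ a b x, a ∈ C → b ∈ C → b ≠ 0 → a + b * x = 0 → x ∈ C := by
    intro a b x ha hb hb0 h
    rw [hC] at ha hb ⊢
    have h1 : b * x = -a := by rw [← add_eq_zero_iff_eq_neg, add_comm]; exact h
    apply mul_left_cancel₀ hb0
    rw [← mul_assoc, ← hb, mul_assoc, h1, ← mul_assoc, h1, mul_neg, ha, neg_mul]
  have hCdim : finrank F C ≤ 2 := by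
    let φ : C × C →ₗ[F] D := LinearMap.coprod C.subtype (LinearMap.mulRight F x₀ ∘ₗ C.subtype)
    have hφ : Function.Injective φ := by
      refine (injective_iff_map_eq_zero φ).mpr fun ⟨a, b⟩ hab => ?_
      have h1 : (a : D) + b * x₀ = 0 := hab
      by_cases hb : (b : D) = 0
      · rw [hb, zero_mul, add_zero] at h1
        exact Prod.ext (Subtype.ext h1) (Subtype.ext hb)
      · exact absurd (hCinv _ _ _ a.2 b.2 hb h1) hx₀
    have := LinearMap.finrank_le_finrank_of_injective hφ
    rw [finrank_prod, hD] at this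
    omega
  have hCspan : ∀ y ∈ C, ∃ a b : F, y = a • (1 : D) + b • i := by
    let φ : F × F →ₗ[F] D :=
      LinearMap.coprod (LinearMap.toSpanSingleton F D 1) (LinearMap.toSpanSingleton F D i)
    have hφ : Function.Injective φ := by
      refine (injective_iff_map_eq_zero φ).mpr fun ⟨a, b⟩ hab => ?_
      obtain ⟨h1, h2⟩ := hind a b hab
      exact Prod.ext h1 h2
    have h1 : LinearMap.range φ = C := by
      refine Submodule.eq_of_le_of_finrank_le ?_ ?_
      · rintro _ ⟨⟨a, b⟩, rfl⟩
        rw [hC]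
        simp [φ, mul_add, add_mul]
      · rw [LinearMap.finrank_range_of_inj hφ, finrank_prod, finrank_self]
        exact hCdim
    intro y hy
    rw [← h1] at hy
    obtain ⟨⟨a, b⟩, rfl⟩ := hy
    exact ⟨a, b, rfl⟩
  have h2i : (1 : D) - (2 : F) • i ≠ 0 := by
    intro h
    obtain ⟨h1, -⟩ := hind 1 (-2) (by rw [← h]; module)
    exact one_ne_zero h1
  have hCsym : ∀ y ∈ C, τ y = y → ∃ a : F, y = a • (1 : D) := by
    intro y hy hτy
    obtain ⟨a, b, rfl⟩ := hCspan y hy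
    rw [map_add, map_smul, map_smul, hτ1, hτi] at hτy
    obtain ⟨h1, -⟩ := hind b (-2 * b) (by linear_combination (norm := module) (1 : F) • hτy)
    exact ⟨a, by rw [h1, zero_smul, add_zero]⟩
  obtain ⟨a, b, hii⟩ := hCspan (i * i) ((hC _).mpr (mul_assoc _ _ _).symm)
  have hb1 : b = 1 := by
    have h1 := congrArg τ hii
    have h0 : (1 - i) * (1 - i) = 1 - i - i + i * i := by noncomm_ring
    rw [hτ, map_add, map_smul, map_smul, hτ1, hτi, h0, hii] at h1
    obtain ⟨h2, -⟩ := hind (1 - b) (-2 * (1 - b))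
      (by linear_combination (norm := module) (1 : F) • h1)
    linear_combination -h2
  rw [hb1, one_smul] at hii
  have hτcomm : ∀ y, τ (i * y - y * i) = i * τ y - τ y * i := by
    intro y
    rw [map_sub, hτ, hτ, hτi]; noncomm_ring
  obtain ⟨y, hy0, hyτ⟩ : ∃ y, i * y - y * i ≠ 0 ∧ τ (i * y - y * i) = i * y - y * i := by
    by_cases h : ∃ y, y + τ y ∉ C
    · obtain ⟨y, hy⟩ := h
      refine ⟨y + τ y, fun h0 => hy ((hC _).mpr (sub_eq_zero.mp h0)), ?_⟩
      rw [hτcomm, map_add, hτ2, add_comm]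
    · push Not at h
      by_cases h2 : (2 : F) = 0
      · refine ⟨x₀, fun h0 => hx₀ ((hC _).mpr (sub_eq_zero.mp h0)), ?_⟩
        have h3 := (hC _).mp (h x₀)
        have h4 : (2 : F) • (i * x₀ - x₀ * i) = 0 := by rw [h2, zero_smul]
        rw [hτcomm]
        rw [mul_add, add_mul] at h3
        linear_combination (norm := module) (1 : F) • h3 - (1 : F) • h4
      · obtain ⟨s, hs, hsF⟩ := hsym h2
        have h3 := h s
        rw [hs, ← two_smul F s, Submodule.smul_mem_iff _ h2] at h3
        obtain ⟨k, hk⟩ := hCsym s h3 hs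
        exact absurd hk (hsF k)
  set j := i * y - y * i with hj
  have hji : j * i = (1 - i) * j := by
    have h1 : j * i - (1 - i) * j = i * i * y - i * y - (y * (i * i) - y * i) := by
      rw [hj]; noncomm_ring
    rw [← sub_eq_zero, h1, hii]
    simp [mul_add, add_mul]
  have hjj : j * j ∈ C := by
    rw [hC]
    have h2 : j * (j * i) = i * (j * j) := by
      rw [hji, ← mul_assoc, mul_sub j 1 i, mul_one, hji, sub_mul (1 : D), one_mul, sub_sub_cancel,
        mul_assoc]
    rw [mul_assoc j j i, h2]
  obtain ⟨b', hb'⟩ := hCsym _ hjj (by rw [hτ, hyτ])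
  refine ⟨i, j, -a, b', ⟨hi, hyτ, by rw [hii]; module, hji, hb', ?_, fun x y hxy => ?_⟩, ?_⟩
  · rintro rfl
    rw [zero_smul, mul_self_eq_zero] at hb'
    exact hy0 hb'
  · have h1 : (x • (1 : D) + y • i) * ((x + y) • (1 : D) + (-y) • i) = 0 := by
      have : (x • (1 : D) + y • i) * ((x + y) • (1 : D) + (-y) • i) =
          (x * (x + y)) • (1 : D) + (y * y) • i - (y * y) • (i * i) := by
        simp only [add_mul, mul_add, smul_mul_smul_comm, mul_one, one_mul]
        module
      rw [this, hii, ← zero_smul F (1 : D), ← hxy, nm]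
      module
    rcases mul_eq_zero.mp h1 with h2 | h2
    · exact hind x y h2
    · obtain ⟨h3, h4⟩ := hind _ _ h2
      rw [neg_eq_zero] at h4
      rw [h4, add_zero] at h3
      exact ⟨h3, h4⟩
  · let ψ : (F × F) × (F × F) →ₗ[F] D := LinearMap.coprod
      (LinearMap.coprod (LinearMap.toSpanSingleton F D 1) (LinearMap.toSpanSingleton F D i))
      (LinearMap.coprod (LinearMap.toSpanSingleton F D j) (LinearMap.toSpanSingleton F D (i * j)))
    have hψ : ∀ x y z w, ψ ((x, y), (z, w)) = x • 1 + y • i + (z • j + w • (i * j)) :=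
      fun _ _ _ _ => rfl
    have hinj : Function.Injective ψ := by
      refine (injective_iff_map_eq_zero ψ).mpr ?_
      rintro ⟨⟨x, y⟩, ⟨z, w⟩⟩ h
      rw [hψ] at h
      have hmem : ∀ x y : F, x • (1 : D) + y • i ∈ C := fun x y => by
        rw [hC]; simp [mul_add, add_mul]
      have h1 : z • (1 : D) + w • i = 0 := by
        by_contra h0
        have h1 := (hC j).mp (hCinv _ _ j (hmem x y) (hmem z w) h0 (by
          rw [add_mul, smul_mul_assoc, smul_mul_assoc, one_mul, h]))
        have h2 : (1 - (2 : F) • i) * j = 0 := by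
          rw [hji, sub_mul, one_mul] at h1
          rw [sub_mul, one_mul, smul_mul_assoc]
          linear_combination (norm := module) -(1 : F) • h1
        exact (mul_eq_zero.mp h2).elim h2i hy0
      obtain ⟨rfl, rfl⟩ := hind _ _ h1
      obtain ⟨rfl, rfl⟩ := hind x y (by simpa using h)
      rfl
    have hsurj := (LinearMap.injective_iff_surjective_of_finrank_eq_finrank
      (by simp [hD])).mp hinj
    intro d
    obtain ⟨⟨⟨x, y⟩, ⟨z, w⟩⟩, rfl⟩ := hsurj d
    exact ⟨x, y, z, w, by rw [hψ, add_assoc (x • 1 + y • i)]⟩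

end Quaternion

section ThLift

variable {F : Type} [Field F] {c : F} {V N : Type} [AddCommGroup V] [Module F V]
  [Module (QExt c) V] [IsScalarTower F (QExt c) V] [AddCommGroup N] [Module F N]
  [Module (QExt c) N] [IsScalarTower F (QExt c) N]

lemma QExt.smul_eq (x : QExt c) (v : V) : x • v = x.re • v + x.im • QExt.th c • v := by
  conv_lhs => rw [QExt.eq_add x]
  rw [add_smul, mul_smul, algebraMap_smul, algebraMap_smul]

lemma QExt.th_smul_th_smul (v : V) : QExt.th c • QExt.th c • v = QExt.th c • v - c • v := by
  rw [smul_smul, QExt.th_mul_th, sub_smul, algebraMap_smul]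

lemma QExt.map_smul_of_th (φ : V → N) (hadd : ∀ v w, φ (v + w) = φ v + φ w)
    (hsmul : ∀ (a : F) v, φ (a • v) = a • φ v)
    (hφ : ∀ v, φ (QExt.th c • v) = QExt.th c • φ v) (x : QExt c) (v : V) :
    φ (x • v) = x • φ v := by
  rw [QExt.smul_eq, hadd, hsmul, hsmul, hφ, QExt.smul_eq x (φ v)]

/-- The bilinear map over the quadratic extension `F(θ)` with `θ`-coordinate `g`. -/
def thLift (g : V →ₗ[F] V →ₗ[F] N) (hg : ∀ v w, g (QExt.th c • v) w = g v (QExt.th c • w)) :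
    V →ₗ[QExt c] V →ₗ[QExt c] N :=
  have hadd : ∀ w v v', g (QExt.th c • (v + v')) w - g (v + v') w + QExt.th c • g (v + v') w =
      (g (QExt.th c • v) w - g v w + QExt.th c • g v w) +
      (g (QExt.th c • v') w - g v' w + QExt.th c • g v' w) := fun w v v' => by
    simp only [smul_add, map_add, LinearMap.add_apply]; abel
  have hadd' : ∀ v w w', g (QExt.th c • v) (w + w') - g v (w + w') + QExt.th c • g v (w + w') =
      (g (QExt.th c • v) w - g v w + QExt.th c • g v w) +
      (g (QExt.th c • v) w' - g v w' + QExt.th c • g v w') := fun w v v' => by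
    simp only [smul_add, map_add]; abel
  LinearMap.mk₂ (QExt c) (fun v w => g (QExt.th c • v) w - g v w + QExt.th c • g v w)
    (fun v v' w => hadd w v v')
    (fun x v w => QExt.map_smul_of_th
      (fun v => g (QExt.th c • v) w - g v w + QExt.th c • g v w) (hadd w) (fun a v => by
        rw [smul_comm (QExt.th c) a v]
        simp only [map_smul, LinearMap.smul_apply, smul_sub, smul_add, smul_comm (QExt.th c) a])
      (fun v => by
        rw [QExt.th_smul_th_smul, smul_add, smul_sub, QExt.th_smul_th_smul]
        simp only [map_sub, LinearMap.sub_apply, map_smul, LinearMap.smul_apply]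
        abel) x v)
    hadd'
    (fun x v w => QExt.map_smul_of_th
      (fun w => g (QExt.th c • v) w - g v w + QExt.th c • g v w) (hadd' v) (fun a v => by
        simp only [map_smul, smul_sub, smul_add, smul_comm (QExt.th c) a])
      (fun w => by
        rw [← hg, ← hg, QExt.th_smul_th_smul, smul_add, smul_sub, QExt.th_smul_th_smul]
        simp only [map_sub, LinearMap.sub_apply, map_smul, LinearMap.smul_apply]
        abel) x w)

end ThLift

/-- A `σ`-stable corner `e A e` which is spanned by a quaternion basis. -/
structure QuatCorner {F A : Type} [Field F] [Ring A] [Algebra F A] (σ : A →ₗ[F] A) (e i j : A)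
    (c b : F) : Prop extends QuatBasis σ e i j c b where
  idem : e * e = e
  map_e : σ e = e
  e_i : e * i = i
  i_e : i * e = i
  e_j : e * j = j
  j_e : j * e = j
  span : ∀ x ∈ corner F e e, ∃ p q y z : F, x = p • e + q • i + y • j + z • (i * j)

/-- An identification of the left ideal `A e` with a vector space over `F(θ)`, in which `θ` acts
through right multiplication by `i`. -/
structure IsColumn {F A V : Type} [Field F] [Ring A] [Algebra F A] [AddCommGroup V] [Module F V]
    (e i : A) (c : F) [Module (QExt c) V] (κ : V →ₗ[F] A) : Prop where
  inj : Function.Injective κ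
  mul_e : ∀ v, κ v * e = κ v
  surj : ∀ x, x * e = x → ∃ v, κ v = x
  th_smul : ∀ v, κ (QExt.th c • v) = κ v * i

section Spin

variable {F A S V : Type} [Field F] [Ring A] [Algebra F A]
  {T : A →ₗ[F] F} {σ : A →ₗ[F] A} {ℓ e i j : A} {c b : F}

namespace QuatCorner

variable (hQ : QuatCorner σ e i j c b)
include hQ

lemma map_i_eq : σ i = e - i := by rw [← hQ.map_i]; abel

lemma i_i_mul (x : A) : i * (i * x) = i * x - c • (e * x) := by
  rw [← mul_assoc, hQ.i_mul_i, sub_mul, smul_mul_assoc]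

lemma j_i_mul (x : A) : j * (i * x) = j * x - i * (j * x) := by
  rw [← mul_assoc, hQ.j_mul_i, sub_mul, sub_mul, ← mul_assoc, hQ.e_j, mul_assoc]

lemma j_j_mul (x : A) : j * (j * x) = b • (e * x) := by
  rw [← mul_assoc, hQ.j_mul_j, smul_mul_assoc]

lemma e_i_mul (x : A) : e * (i * x) = i * x := by rw [← mul_assoc, hQ.e_i]
lemma e_j_mul (x : A) : e * (j * x) = j * x := by rw [← mul_assoc, hQ.e_j]
lemma j_e_mul (x : A) : j * (e * x) = j * x := by rw [← mul_assoc, hQ.j_e]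
lemma j_mul_i' : j * i = j - i * j := by rw [hQ.j_mul_i, sub_mul, hQ.e_j]

lemma one_sub_four_mul_ne_zero : 1 - 4 * c ≠ 0 := fun h => by
  have h1 := (hQ.aniso (-2) 4 (by simp only [nm]; linear_combination (-4) * h)).1
  have e : (2 : F) = 0 := by linear_combination -h1
  exact one_ne_zero (α := F) (by linear_combination h + 2 * c * e)

lemma trace (hT : IsReducedTrace F A T) (hq : IsQuadraticPair F A T σ ℓ) :
    T e = 2 * T i ∧ T j = 0 ∧ T (i * j) = 0 := by
  have h1 : T j = 2 * T (i * j) := by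
    have := hT.mul_comm j i
    rw [hQ.j_mul_i', map_sub] at this
    linear_combination this
  have h2 : T (i * j) - c * T j = c * T j := by
    have := hT.mul_comm i (i * j)
    rw [hQ.i_i_mul, hQ.e_j, mul_assoc, hQ.j_mul_i', mul_sub, hQ.i_i_mul, hQ.e_j] at this
    simp only [map_sub, map_smul, smul_eq_mul] at this
    linear_combination this
  have h3 : T (i * j) = 0 := by
    refine (mul_eq_zero.mp (?_ : (1 - 4 * c) * T (i * j) = 0)).resolve_left
      hQ.one_sub_four_mul_ne_zero
    linear_combination h2 + 2 * c * h1
  refine ⟨?_, by rw [h1, h3, mul_zero], h3⟩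
  have := hq.trace_map i
  rw [hQ.map_i_eq, map_sub] at this
  linear_combination this

end QuatCorner

variable [AddCommGroup V] [Module F V]
  [Module (QExt c) V] [IsScalarTower F (QExt c) V] {κ : V →ₗ[F] A}

/-- The bilinear map `v, w ↦ v j σ(w)` on the left ideal `A e`. -/
def colMul (κ : V →ₗ[F] A) (σ : A →ₗ[F] A) (j : A) : V →ₗ[F] V →ₗ[F] A :=
  LinearMap.mk₂ F (fun v w => κ v * j * σ (κ w)) (by intros; simp [add_mul])
    (by intros; simp) (by intros; simp [mul_add]) (by intros; simp)

lemma colMul_apply (v w : V) : colMul κ σ j v w = κ v * j * σ (κ w) := rfl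

omit [IsScalarTower F (QExt c) V] in
lemma colMul_th_smul_left (hκ : IsColumn e i c κ) (v w : V) :
    colMul κ σ j (QExt.th c • v) w = κ v * (i * j) * σ (κ w) := by
  rw [colMul_apply, hκ.th_smul, mul_assoc (κ v)]

omit [IsScalarTower F (QExt c) V] in
lemma colMul_th_smul (hq : IsQuadraticPair F A T σ ℓ) (hQ : QuatCorner σ e i j c b)
    (hκ : IsColumn e i c κ) (v w : V) :
    colMul κ σ j (QExt.th c • v) w = colMul κ σ j v (QExt.th c • w) := by
  rw [colMul_th_smul_left hκ, colMul_apply, hκ.th_smul, hq.map_mul, hQ.map_i_eq]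
  simp only [mul_assoc, sub_mul, mul_sub, hQ.j_e_mul, hQ.j_i_mul]
  abel

section Lift

variable {N : Type} [AddCommGroup N] [Module F N] [Module (QExt c) N] [IsScalarTower F (QExt c) N]

/-- The bilinear map over `F(θ)` with `θ`-coordinate `v, w ↦ R (v j σ(w))`. -/
def quatLift (R : A →ₗ[F] N) (hq : IsQuadraticPair F A T σ ℓ)
    (hQ : QuatCorner σ e i j c b) (hκ : IsColumn e i c κ) : V →ₗ[QExt c] V →ₗ[QExt c] N :=
  thLift ((colMul κ σ j).compr₂ R) fun v w => congrArg R (colMul_th_smul hq hQ hκ v w)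

lemma quatLift_apply (R : A →ₗ[F] N) (hq : IsQuadraticPair F A T σ ℓ)
    (hQ : QuatCorner σ e i j c b) (hκ : IsColumn e i c κ) (v w : V) :
    quatLift R hq hQ hκ v w = R (κ v * (i * j) * σ (κ w)) - R (κ v * j * σ (κ w)) +
      QExt.th c • R (κ v * j * σ (κ w)) := by
  rw [← colMul_th_smul_left hκ]
  rfl

end Lift

variable [AddCommGroup S] [Module F S] {ρ : A →ₗ[F] Module.End F S}

/-- A quadratic form over `F(θ)` attached to a quaternionic quadratic pair. -/
def quatForm (hq : IsQuadraticPair F A T σ ℓ)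
    (hQ : QuatCorner σ e i j c b) (hκ : IsColumn e i c κ) : V →ₗ[QExt c] V →ₗ[QExt c] QExt c :=
  quatLift (Algebra.linearMap F (QExt c) ∘ₗ T ∘ₗ LinearMap.mulLeft F ℓ) hq hQ hκ

/-- The spin representation over `F(θ)` attached to a quaternionic quadratic pair. -/
def quatSpin (ρ : A →ₗ[F] Module.End F S) (hq : IsQuadraticPair F A T σ ℓ)
    (hQ : QuatCorner σ e i j c b) (hκ : IsColumn e i c κ) :
    V →ₗ[QExt c] V →ₗ[QExt c] Module.End (QExt c) (QExt c ⊗[F] S) :=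
  quatLift (N := Module.End (QExt c) (QExt c ⊗[F] S))
    (LinearMap.baseChangeHom F (QExt c) S S ∘ₗ ρ) hq hQ hκ

lemma quatForm_apply (hq : IsQuadraticPair F A T σ ℓ)
    (hQ : QuatCorner σ e i j c b) (hκ : IsColumn e i c κ) (v w : V) :
    quatForm hq hQ hκ v w =
      algebraMap F (QExt c) (T (ℓ * (κ v * (i * j) * σ (κ w)))) -
      algebraMap F (QExt c) (T (ℓ * (κ v * j * σ (κ w)))) +
      QExt.th c * algebraMap F (QExt c) (T (ℓ * (κ v * j * σ (κ w)))) :=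
  quatLift_apply _ hq hQ hκ v w

lemma quatSpin_apply (hq : IsQuadraticPair F A T σ ℓ)
    (hQ : QuatCorner σ e i j c b) (hκ : IsColumn e i c κ) (v w : V) :
    quatSpin ρ hq hQ hκ v w =
      (ρ (κ v * (i * j) * σ (κ w))).baseChange (QExt c) -
      (ρ (κ v * j * σ (κ w))).baseChange (QExt c) +
      QExt.th c • (ρ (κ v * j * σ (κ w))).baseChange (QExt c) :=
  quatLift_apply (N := Module.End (QExt c) (QExt c ⊗[F] S)) _ hq hQ hκ v w

end Spin

section QuatSpin

variable {F A S V : Type} [Field F] [Ring A] [Algebra F A]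
  {T : A →ₗ[F] F} {σ : A →ₗ[F] A} {ℓ e i j : A} {c b : F}

namespace QuatCorner

variable (hQ : QuatCorner σ e i j c b)
include hQ

lemma e_mul_map (hq : IsQuadraticPair F A T σ ℓ) {v : A} (hv : v * e = v) :
    e * σ v = σ v := by
  nth_rw 1 [← hQ.map_e]; rw [← hq.map_mul, hv]

lemma exists_coeff (hq : IsQuadraticPair F A T σ ℓ) {v : A} (hv : v * e = v) (x : A) :
    ∃ p q y z : F, σ v * x * v = p • e + q • i + y • j + z • (i * j) :=
  hQ.span _ ⟨by rw [← mul_assoc, ← mul_assoc, hQ.e_mul_map hq hv], by rw [mul_assoc, hv]⟩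

lemma sandwich_first (p q y z : F) :
    i * j * (p • e + q • i + y • j + z • (i * j)) * (i * j) -
      c • (j * (p • e + q • i + y • j + z • (i * j)) * j) =
    (b * (y + 2 * c * z)) • (i * j) - (b * c * (2 * y + z)) • j := by
  simp only [mul_assoc, mul_add, add_mul, mul_sub, sub_mul, smul_mul_assoc, mul_smul_comm,
    hQ.i_i_mul, hQ.j_i_mul, hQ.e_i_mul,
    hQ.e_j, hQ.i_e, hQ.j_e, hQ.i_mul_i, hQ.j_mul_j, hQ.j_mul_i',
    smul_sub, smul_add]
  module

lemma sandwich_second (p q y z : F) :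
    i * j * (p • e + q • i + y • j + z • (i * j)) * j +
      j * (p • e + q • i + y • j + z • (i * j)) * (i * j) -
      j * (p • e + q • i + y • j + z • (i * j)) * j =
    (b * (2 * y + z)) • (i * j) + (b * (2 * c * z - y - z)) • j := by
  simp only [mul_assoc, mul_add, add_mul, mul_sub, sub_mul, smul_mul_assoc, mul_smul_comm,
    hQ.i_i_mul, hQ.j_i_mul, hQ.e_i_mul,
    hQ.e_j, hQ.i_e, hQ.j_e, hQ.i_mul_i, hQ.j_mul_j, hQ.j_mul_i',
    smul_sub]
  module

lemma trace_mul_i_mul_j (hT : IsReducedTrace F A T) (hq : IsQuadraticPair F A T σ ℓ)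
    (p q y z : F) :
    T ((p • e + q • i + y • j + z • (i * j)) * (i * j)) = b * (y + 2 * c * z) * T i := by
  obtain ⟨h1, h2, h3⟩ := hQ.trace hT hq
  simp only [mul_assoc, mul_add, add_mul, mul_sub, smul_mul_assoc, mul_smul_comm,
    hQ.i_i_mul, hQ.j_i_mul, hQ.e_i_mul,
    hQ.e_j, hQ.i_e, hQ.i_mul_i, hQ.j_mul_j,
    smul_sub, map_add, map_sub, map_smul, smul_eq_mul, h1, h2, h3]
  ring

lemma trace_mul_j (hT : IsReducedTrace F A T) (hq : IsQuadraticPair F A T σ ℓ)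
    (p q y z : F) :
    T ((p • e + q • i + y • j + z • (i * j)) * j) = b * (2 * y + z) * T i := by
  obtain ⟨h1, h2, h3⟩ := hQ.trace hT hq
  simp only [mul_assoc, mul_add, add_mul, smul_mul_assoc, mul_smul_comm,
    hQ.e_j, hQ.i_e, hQ.j_mul_j,
    map_add, map_smul, smul_eq_mul, h1, h2, h3]
  ring

lemma map_coeff (hq : IsQuadraticPair F A T σ ℓ) (p q y z : F) :
    σ (p • e + q • i + y • j + z • (i * j)) = (p + q) • e + (-q) • i + y • j + z • (i * j) := by
  simp only [map_add, map_smul, hq.map_mul, hQ.map_e, hQ.map_i_eq, hQ.map_j, mul_sub, hQ.j_e,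
    hQ.j_mul_i']
  module

variable [AddCommGroup S] [Module F S] {ρ : A →ₗ[F] Module.End F S}

lemma mul_first (hq : IsQuadraticPair F A T σ ℓ) (hρ : CliffRep T σ ℓ ρ) {v : A} (hv : v * e = v)
    {p q y z : F} (hY : σ v * ℓ * v = p • e + q • i + y • j + z • (i * j)) (u w : A) :
    ρ (u * (i * j) * σ v) * ρ (v * (i * j) * w) - c • (ρ (u * j * σ v) * ρ (v * j * w)) =
      (b * (y + 2 * c * z)) • ρ (u * (i * j) * w) - (b * c * (2 * y + z)) • ρ (u * j * w) := by
  have hs : ∀ x, sand F A ((u * (i * j) * σ v) ⊗ₜ (v * (i * j) * w) -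
      c • ((u * j * σ v) ⊗ₜ (v * j * w))) x =
      u * (i * j * (σ v * x * v) * (i * j) - c • (j * (σ v * x * v) * j)) * w := fun x => by
    rw [map_sub, map_smul, LinearMap.sub_apply, LinearMap.smul_apply, mul_sub, sub_mul,
      mul_smul_comm, smul_mul_assoc]
    change u * (i * j) * σ v * x * (v * (i * j) * w) -
      c • (u * j * σ v * x * (v * j * w)) = _
    simp only [mul_assoc]
  have h := hρ.deg2 ((u * (i * j) * σ v) ⊗ₜ (v * (i * j) * w) -
      c • ((u * j * σ v) ⊗ₜ (v * j * w))) fun x => by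
    obtain ⟨p, q, y, z, h1⟩ := hQ.exists_coeff hq hv x
    have h2 : σ v * σ x * v = σ (σ v * x * v) := by
      rw [hq.map_mul, hq.map_mul, hq.invol, mul_assoc]
    rw [hs, hs, h2, h1, hQ.map_coeff hq, hQ.sandwich_first, hQ.sandwich_first]
  rw [hs, hY, hQ.sandwich_first] at h
  simp only [map_sub, map_smul, TensorProduct.map_tmul, LinearMap.mul'_apply, mul_sub, sub_mul,
    mul_smul_comm, smul_mul_assoc] at h
  exact h

lemma mul_second (hq : IsQuadraticPair F A T σ ℓ) (hρ : CliffRep T σ ℓ ρ) {v : A} (hv : v * e = v)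
    {p q y z : F} (hY : σ v * ℓ * v = p • e + q • i + y • j + z • (i * j)) (u w : A) :
    ρ (u * (i * j) * σ v) * ρ (v * j * w) + ρ (u * j * σ v) * ρ (v * (i * j) * w) -
      ρ (u * j * σ v) * ρ (v * j * w) =
      (b * (2 * y + z)) • ρ (u * (i * j) * w) + (b * (2 * c * z - y - z)) • ρ (u * j * w) := by
  have hs : ∀ x, sand F A ((u * (i * j) * σ v) ⊗ₜ (v * j * w) +
      (u * j * σ v) ⊗ₜ (v * (i * j) * w) - (u * j * σ v) ⊗ₜ (v * j * w)) x =
      u * (i * j * (σ v * x * v) * j + j * (σ v * x * v) * (i * j) - j * (σ v * x * v) * j) * w :=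
    fun x => by
      rw [map_sub, map_add, LinearMap.sub_apply, LinearMap.add_apply, mul_sub, sub_mul, mul_add,
        add_mul]
      change u * (i * j) * σ v * x * (v * j * w) + u * j * σ v * x * (v * (i * j) * w) -
        u * j * σ v * x * (v * j * w) = _
      simp only [mul_assoc]
  have h := hρ.deg2 ((u * (i * j) * σ v) ⊗ₜ (v * j * w) +
      (u * j * σ v) ⊗ₜ (v * (i * j) * w) - (u * j * σ v) ⊗ₜ (v * j * w)) fun x => by
    obtain ⟨p, q, y, z, h1⟩ := hQ.exists_coeff hq hv x
    have h2 : σ v * σ x * v = σ (σ v * x * v) := by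
      rw [hq.map_mul, hq.map_mul, hq.invol, mul_assoc]
    rw [hs, hs, h2, h1, hQ.map_coeff hq, hQ.sandwich_second, hQ.sandwich_second]
  rw [hs, hY, hQ.sandwich_second] at h
  simp only [map_sub, map_add, map_smul, TensorProduct.map_tmul, LinearMap.mul'_apply, mul_add,
    add_mul, mul_smul_comm, smul_mul_assoc] at h
  linear_combination (norm := module) h

end QuatCorner

end QuatSpin

section QuatSpin

variable {F A S V : Type} [Field F] [Ring A] [Algebra F A]
  {T : A →ₗ[F] F} {σ : A →ₗ[F] A} {ℓ e i j : A} {c b : F}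
  [AddCommGroup V] [Module F V]
  [Module (QExt c) V] [IsScalarTower F (QExt c) V] {κ : V →ₗ[F] A}
  [AddCommGroup S] [Module F S] {ρ : A →ₗ[F] Module.End F S}

lemma baseChange_smul_eq (k : F) (x : Module.End F S) :
    (k • x).baseChange (QExt c) = algebraMap F (QExt c) k • x.baseChange (QExt c) := by
  rw [LinearMap.baseChange_smul, algebraMap_smul]

lemma mul_of_theta {K E : Type} [CommRing K] [Ring E] [Algebra K E] {t c b y z : K}
    {P Q P₁ Q₁ P₂ Q₂ : E} (ht : t * t = t - c)
    (h₁ : P₁ * P₂ - c • (Q₁ * Q₂) =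
      (b * (y + 2 * c * z)) • P - (b * c * (2 * y + z)) • Q)
    (h₂ : P₁ * Q₂ + Q₁ * P₂ - Q₁ * Q₂ =
      (b * (2 * y + z)) • P + (b * (2 * c * z - y - z)) • Q) :
    (P₁ - Q₁ + t • Q₁) * (P₂ - Q₂ + t • Q₂) =
      (b * (y + 2 * c * z) - b * (2 * y + z) + t * (b * (2 * y + z))) • (P - Q + t • Q) := by
  have h₃ : ∀ x : E, (t * t) • x = (t - c) • x := fun x => by rw [ht]
  simp only [mul_add, mul_sub, add_mul, sub_mul, smul_mul_assoc, mul_smul_comm] at h₁ h₂ ⊢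
  linear_combination (norm := module) h₁ + (t - 1) • h₂ + h₃ (Q₁ * Q₂) -
    (b * (2 * y + z)) • h₃ Q

lemma quatSpin_mul (hT : IsReducedTrace F A T) (hq : IsQuadraticPair F A T σ ℓ)
    (hρ : CliffRep T σ ℓ ρ) (hQ : QuatCorner σ e i j c b) (hκ : IsColumn e i c κ) (v : V) :
    ∃ k : QExt c, quatForm hq hQ hκ v v = k * algebraMap F (QExt c) (T i) ∧
      ∀ u w, quatSpin ρ hq hQ hκ u v * quatSpin ρ hq hQ hκ v w = k • quatSpin ρ hq hQ hκ u w := by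
  obtain ⟨p, q, y, z, hY⟩ := hQ.exists_coeff hq (hκ.mul_e v) ℓ
  refine ⟨algebraMap F _ (b * (y + 2 * c * z)) - algebraMap F _ (b * (2 * y + z)) +
    QExt.th c * algebraMap F _ (b * (2 * y + z)), ?_, fun u w => ?_⟩
  · have h1 : ∀ x, T (ℓ * (κ v * x * σ (κ v))) = T (σ (κ v) * ℓ * κ v * x) := fun x => by
      rw [← mul_assoc, hT.mul_comm, ← mul_assoc, ← mul_assoc]
    rw [quatForm_apply, h1, h1, hY, hQ.trace_mul_i_mul_j hT hq, hQ.trace_mul_j hT hq,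
      map_mul _ _ (T i), map_mul _ _ (T i)]
    ring
  · have h1 := congrArg (LinearMap.baseChange (QExt c))
      (hQ.mul_first hq hρ (hκ.mul_e v) hY (κ u) (σ (κ w)))
    have h2 := congrArg (LinearMap.baseChange (QExt c))
      (hQ.mul_second hq hρ (hκ.mul_e v) hY (κ u) (σ (κ w)))
    simp only [LinearMap.baseChange_sub, LinearMap.baseChange_add, baseChange_smul_eq,
      LinearMap.baseChange_mul, map_mul, map_sub, map_add, map_ofNat] at h1 h2
    rw [quatSpin_apply, quatSpin_apply, quatSpin_apply]
    simp only [map_mul, map_add, map_ofNat]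
    exact mul_of_theta (E := Module.End (QExt c) (QExt c ⊗[F] S)) QExt.th_mul_th h1 h2

lemma pol_quatForm (hT : IsReducedTrace F A T) (hq : IsQuadraticPair F A T σ ℓ)
    (hQ : QuatCorner σ e i j c b) (hκ : IsColumn e i c κ)
    [Fact (∀ r : F, r ^ 2 ≠ -c + 1 * r)] (v w : V) :
    pol (quatForm hq hQ hκ) v w = algebraMap F (QExt c) (T (κ v * (i * j) * σ (κ w))) -
      algebraMap F (QExt c) (T (κ v * j * σ (κ w))) +
      QExt.th c * algebraMap F (QExt c) (T (κ v * j * σ (κ w))) := by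
  have h1 : ∀ x, σ x = x → T (ℓ * (κ v * x * σ (κ w))) + T (ℓ * (κ w * x * σ (κ v))) =
      T (κ v * x * σ (κ w)) := fun x hx => by
    have h2 := trace_mul_add_map hT hq (κ v * x * σ (κ w))
    rwa [hq.map_mul, hq.map_mul, hq.invol, hx, ← mul_assoc (κ w), mul_add, map_add] at h2
  have h2 : σ (i * j) = i * j := by
    rw [hq.map_mul, hQ.map_j, hQ.map_i_eq, mul_sub, hQ.j_e, hQ.j_mul_i', sub_sub_cancel]
  rw [pol_apply, quatForm_apply, quatForm_apply, ← h1 _ h2, ← h1 _ hQ.map_j, map_add, map_add]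
  ring

lemma QExt.eq_zero_of_add_th {x y : F}
    (h : algebraMap F (QExt c) x - algebraMap F (QExt c) y +
      QExt.th c * algebraMap F (QExt c) y = 0) :
    x = 0 ∧ y = 0 := by
  have h1 := congrArg QuadraticAlgebra.im h
  have h2 := congrArg QuadraticAlgebra.re h
  simp [QuadraticAlgebra.algebraMap_eq] at h1 h2
  subst h1
  simpa using h2

lemma quatSpin_add_eq_smul (hq : IsQuadraticPair F A T σ ℓ) (hQ : QuatCorner σ e i j c b)
    (hκ : IsColumn e i c κ) [Fact (∀ r : F, r ^ 2 ≠ -c + 1 * r)] :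
    ∃ k : QExt c, k ≠ 0 ∧ ∀ v w v' w', κ v' = κ v * j → κ w' = κ w * j →
      quatSpin ρ hq hQ hκ v' w + quatSpin ρ hq hQ hκ v w' =
        k • (ρ (κ v * σ (κ w))).baseChange (QExt c) := by
  refine ⟨algebraMap F (QExt c) b * (2 * QExt.th c - 1), ?_, fun v w v' w' hv' hw' => ?_⟩
  · refine mul_ne_zero ((map_ne_zero _).mpr hQ.ne_zero) fun h0 => ?_
    apply hQ.one_sub_four_mul_ne_zero
    apply (algebraMap F (QExt c)).injective
    simp only [map_sub, map_one, map_mul, map_ofNat, map_zero]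
    linear_combination (2 * QExt.th c - 1) * h0 - 4 * QExt.th_mul_th (c := c)
  · have he := hQ.e_mul_map hq (hκ.mul_e w)
    have h2 : κ v * j * (i * j) * σ (κ w) = b • (κ v * σ (κ w) - κ v * (i * σ (κ w))) := by
      simp only [mul_assoc, hQ.j_i_mul, mul_sub, sub_mul, mul_smul_comm,
        smul_mul_assoc, he, smul_sub, hQ.j_mul_j, hQ.i_e]
    have h3 : κ v * j * j * σ (κ w) = b • (κ v * σ (κ w)) := by
      simp only [mul_assoc, hQ.j_j_mul, mul_smul_comm, he]
    have h4 : κ v * (i * j) * (j * σ (κ w)) = b • (κ v * (i * σ (κ w))) := by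
      simp only [mul_assoc, hQ.j_j_mul, mul_smul_comm, he]
    have h5 : κ v * j * (j * σ (κ w)) = b • (κ v * σ (κ w)) := by
      rw [← mul_assoc, h3]
    rw [quatSpin_apply, quatSpin_apply, hv', hw', hq.map_mul, hQ.map_j, h2, h3, h4, h5]
    simp only [map_smul, map_sub, baseChange_smul_eq, LinearMap.baseChange_sub]
    module

theorem isSpin_quatSpin [FiniteDimensional F S] [Nontrivial S] [Nontrivial V]
    (hT : IsReducedTrace F A T) (hq : IsQuadraticPair F A T σ ℓ)
    (hρ : CliffRep T σ ℓ ρ) (hQ : QuatCorner σ e i j c b) (hκ : IsColumn e i c κ)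
    [Fact (∀ r : F, r ^ 2 ≠ -c + 1 * r)] {r : ℕ} {u u' : Fin r → A} (h : IsFrame e u u') :
    T i = 1 ∧ IsSpin (quatForm hq hQ hκ) (quatSpin ρ hq hQ hκ) := by
  have hnd : ∀ v, (∀ w, pol (quatForm hq hQ hκ) v w = 0) → v = 0 := by
    intro v hvw
    have h1 : κ v * j = 0 := hT.nondeg fun a => by
      obtain ⟨w, hw⟩ := hκ.surj (σ a * e) (by rw [mul_assoc, hQ.idem])
      have := hvw w
      rw [pol_quatForm hT, hw, hq.map_mul, hq.invol, hQ.map_e] at this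
      have := (QExt.eq_zero_of_add_th this).2
      rwa [← mul_assoc, mul_assoc (κ v), hQ.j_e] at this
    have h2 : b • κ v = 0 := by
      rw [← hκ.mul_e v, ← mul_smul_comm, ← hQ.j_mul_j, ← mul_assoc, h1, zero_mul]
    exact hκ.inj (by rw [(smul_eq_zero.mp h2).resolve_left hQ.ne_zero, map_zero])
  have hself : ∀ v, quatSpin ρ hq hQ hκ v v =
      quatForm hq hQ hκ v v • (1 : Module.End (QExt c) (QExt c ⊗[F] S)) := by
    intro v
    have h2 : σ (i * j) = i * j := by
      rw [hq.map_mul, hQ.map_j, hQ.map_i_eq, mul_sub, hQ.j_e, hQ.j_mul_i', sub_sub_cancel]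
    have h1 : ∀ x, σ x = x → σ (κ v * x * σ (κ v)) = κ v * x * σ (κ v) := fun x hx => by
      rw [hq.map_mul, hq.map_mul, hq.invol, hx, mul_assoc]
    rw [quatSpin_apply, quatForm_apply, hρ.sym _ (h1 _ h2), hρ.sym _ (h1 _ hQ.map_j),
      baseChange_smul_eq, baseChange_smul_eq, LinearMap.baseChange_one]
    module
  have hTi : T i = 1 := by
    obtain ⟨v, hv⟩ := exists_anisotropic hnd
    obtain ⟨k, hk1, hk2⟩ := quatSpin_mul hT hq hρ hQ hκ v
    have h1 := hk2 v v
    rw [hself, smul_mul_smul_comm, smul_smul, mul_one] at h1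
    have h2 : quatForm hq hQ hκ v v * (quatForm hq hQ hκ v v - k) = 0 := by
      linear_combination (FaithfulSMul.algebraMap_injective (QExt c)
        (Module.End (QExt c) (QExt c ⊗[F] S)))
          (by simpa only [Algebra.algebraMap_eq_smul_one] using h1)
    have h3 : quatForm hq hQ hκ v v = k := by
      linear_combination (mul_eq_zero.mp h2).resolve_left hv
    rw [h3] at hk1 hv
    have h4 : k * (algebraMap F (QExt c) (T i) - 1) = 0 := by linear_combination -hk1
    apply (algebraMap F (QExt c)).injective
    rw [map_one]
    linear_combination (mul_eq_zero.mp h4).resolve_left hv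
  refine ⟨hTi, hself, fun x v y => ?_, ?_, hnd⟩
  · obtain ⟨k, hk1, hk2⟩ := quatSpin_mul hT hq hρ hQ hκ v
    rw [hk2, hk1, hTi, map_one, mul_one]
  · refine adjoin_baseChange_eq_top hρ.gen _ ?_
    rintro _ ⟨a, rfl⟩
    set R := Algebra.adjoin (QExt c) (Set.range fun p : V × V => quatSpin ρ hq hQ hκ p.1 p.2)
    have hR : ∀ v w, quatSpin ρ hq hQ hκ v w ∈ R := fun v w =>
      Algebra.subset_adjoin ⟨(v, w), rfl⟩
    obtain ⟨k, hk, hk'⟩ := quatSpin_add_eq_smul (ρ := ρ) hq hQ hκ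
    have key : ∀ v w, (ρ (κ v * σ (κ w))).baseChange (QExt c) ∈ R := by
      intro v w
      obtain ⟨v', hv'⟩ := hκ.surj (κ v * j) (by rw [mul_assoc, hQ.j_e])
      obtain ⟨w', hw'⟩ := hκ.surj (κ w * j) (by rw [mul_assoc, hQ.j_e])
      have h1 := R.smul_mem (R.add_mem (hR v' w) (hR v w')) k⁻¹
      rwa [hk' v w v' w' hv' hw', inv_smul_smul₀ hk] at h1
    choose v hv using fun a' : Fin r => hκ.surj (a * u a') (by rw [mul_assoc, h.mul_e])
    choose w hw using fun a' : Fin r => hκ.surj (σ (u' a'))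
      (by nth_rw 1 [← hQ.map_e]; rw [← hq.map_mul, h.e_mul])
    have h1 : a = ∑ a', κ (v a') * σ (κ (w a')) := by
      simp only [hv, hw, hq.invol, mul_assoc, ← Finset.mul_sum, h.sum, mul_one]
    rw [h1, map_sum]
    have : LinearMap.baseChange (QExt c) (∑ a', ρ (κ (v a') * σ (κ (w a')))) =
        ∑ a', (ρ (κ (v a') * σ (κ (w a')))).baseChange (QExt c) :=
      map_sum (LinearMap.baseChangeHom F (QExt c) S S) _ _
    rw [this]
    exact Subalgebra.sum_mem _ fun _ _ => key _ _

end QuatSpin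

section Lagrangian

variable {K V : Type} [Field K] [AddCommGroup V] [Module K V] {B : V →ₗ[K] V →ₗ[K] K}

lemma mem_sup_span_singleton {W : Submodule K V} {u x : V}
    (hx : x ∈ W ⊔ Submodule.span K {u}) : ∃ w ∈ W, ∃ k : K, w + k • u = x := by
  obtain ⟨w, hw, y, hy, rfl⟩ := Submodule.mem_sup.mp hx
  obtain ⟨k, rfl⟩ := Submodule.mem_span_singleton.mp hy
  exact ⟨w, hw, k, rfl⟩

lemma TotSing.sup_span_singleton {W : Submodule K V} (hW : TotSing B W) {u : V} (hu : B u u = 0)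
    (hWu : ∀ w ∈ W, pol B w u = 0) : TotSing B (W ⊔ Submodule.span K {u}) := by
  intro x hx
  obtain ⟨w, hw, k, rfl⟩ := mem_sup_span_singleton hx
  have h1 := hWu w hw
  rw [pol_apply] at h1
  simp only [map_add, LinearMap.add_apply, map_smul, LinearMap.smul_apply, smul_eq_mul, hW w hw,
    hu]
  linear_combination k * h1

/-- A totally singular subspace can be moved, without decreasing its dimension, so as to contain
a given singular vector. -/
lemma TotSing.exists_le_mem [FiniteDimensional K V] {X W : Submodule K V} (hW : TotSing B W)
    (hXW : X ≤ W) {u : V} (hu : B u u = 0) (hXu : ∀ x ∈ X, pol B x u = 0) :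
    ∃ W', TotSing B W' ∧ X ≤ W' ∧ u ∈ W' ∧ finrank K W ≤ finrank K W' := by
  by_cases huW : u ∈ W
  · exact ⟨W, hW, hXW, huW, le_rfl⟩
  let Z := W ⊓ LinearMap.ker (pol B u)
  have hZ : TotSing B Z := fun x hx => hW x hx.1
  refine ⟨Z ⊔ Submodule.span K {u}, hZ.sup_span_singleton hu fun w hw => ?_,
    (le_inf hXW fun x hx => ?_).trans le_sup_left,
    Submodule.mem_sup_right (Submodule.mem_span_singleton_self u), ?_⟩
  · rw [pol_comm]; exact hw.2
  · rw [LinearMap.mem_ker, pol_comm]; exact hXu x hx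
  · rw [Submodule.finrank_sup_span_singleton (p := Z) fun h => huW h.1]
    have h1 := Submodule.finrank_sup_add_finrank_inf_eq W (LinearMap.ker (pol B u))
    have h2 := Submodule.finrank_le (W ⊔ LinearMap.ker (pol B u))
    have h3 := LinearMap.finrank_range_add_finrank_ker (pol B u)
    have h4 := Submodule.finrank_le (LinearMap.range (pol B u))
    rw [finrank_self] at h4
    change finrank K W ≤ finrank K ↥(W ⊓ LinearMap.ker (pol B u)) + 1
    omega

lemma _root_.Submodule.exists_disjoint_le [FiniteDimensional K V] (X W : Submodule K V) :
    ∃ Y ≤ W, Disjoint X Y ∧ finrank K W ≤ finrank K X + finrank K Y := by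
  obtain ⟨X', hX'⟩ := X.exists_isCompl
  refine ⟨W ⊓ X', inf_le_left, hX'.disjoint.mono_right inf_le_right, ?_⟩
  have h1 := Submodule.finrank_sup_add_finrank_inf_eq W X'
  have h2 := Submodule.finrank_le (W ⊔ X')
  have h3 := Submodule.finrank_add_eq_of_isCompl hX'
  omega

end Lagrangian

section Stable

variable {F V : Type} [Field F] {c b : F} [Fact (∀ r : F, r ^ 2 ≠ -c + 1 * r)]
  [AddCommGroup V] [Module F V] [Module (QExt c) V] [IsScalarTower F (QExt c) V]
  {J : V →ₗ[F] V} {X : Submodule (QExt c) V}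

lemma semilinear_smul (hJθ : ∀ v, J (QExt.th c • v) = J v - QExt.th c • J v) (k : QExt c) (v : V) :
    J (k • v) = (algebraMap F (QExt c) (k.re + k.im) - algebraMap F (QExt c) k.im * QExt.th c) •
      J v := by
  rw [QExt.smul_eq, map_add, map_smul, map_smul, hJθ, sub_smul, mul_smul, algebraMap_smul,
    algebraMap_smul, add_smul, smul_sub]
  abel

lemma map_notMem_sup_span_singleton (hJθ : ∀ v, J (QExt.th c • v) = J v - QExt.th c • J v)
    (hJJ : ∀ v, J (J v) = b • v) (hb : ∀ p q, nm c p q ≠ b) (hJX : ∀ x ∈ X, J x ∈ X) {w : V}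
    (hw : w ∉ X) : J w ∉ X ⊔ Submodule.span (QExt c) {w} := by
  intro h
  obtain ⟨x, hx, k, hk⟩ := mem_sup_span_singleton h
  have h1 := hJJ w
  rw [← hk, map_add, semilinear_smul hJθ, ← hk, ← algebraMap_smul (QExt c) b] at h1
  set k' := algebraMap F (QExt c) (k.re + k.im) - algebraMap F (QExt c) k.im * QExt.th c
  have h2 : k' * k = algebraMap F (QExt c) (nm c k.re k.im) := by
    conv_lhs => rw [QExt.eq_add k]
    simp only [k', nm, map_add, map_mul]
    linear_combination (-(algebraMap F (QExt c) k.im) ^ 2) * QExt.th_mul_th (c := c)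
  have h3 : (algebraMap F (QExt c) (b - nm c k.re k.im)) • w = J x + k' • x := by
    rw [map_sub, sub_smul, ← h1, ← h2]
    module
  refine hw ((Submodule.smul_mem_iff _ ?_).mp (h3 ▸ X.add_mem (hJX x hx) (X.smul_mem _ hx)))
  exact (map_ne_zero _).mpr (sub_ne_zero.mpr (hb _ _).symm)

variable {B : V →ₗ[QExt c] V →ₗ[QExt c] QExt c} {P : V →ₗ[F] V →ₗ[F] F} {m : ℕ}

/-- A Lagrangian can be chosen to contain a large totally singular subspace stable under a
quaternionic structure. -/
theorem exists_stable_le_lagrangian [FiniteDimensional (QExt c) V] (hF : PfisterUniversal F)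
    (hc : ∀ x y, nm c x y = 0 → x = 0 ∧ y = 0)
    (hJθ : ∀ v, J (QExt.th c • v) = J v - QExt.th c • J v)
    (hJJ : ∀ v, J (J v) = b • v) (hb : ∀ p q, nm c p q ≠ b)
    (hJB : ∀ v, B v v = 0 → B (J v) (J v) = 0) (hJP : ∀ v, P v v = 0 → pol B v (J v) = 0)
    (hP : ∀ w, P (QExt.th c • w) (QExt.th c • w) = c * P w w)
    (hP' : ∀ w, P w (QExt.th c • w) + P (QExt.th c • w) w = P w w)
    {W₀ : Submodule (QExt c) V} (hW₀ : TotSing B W₀) (hm : m ≤ finrank (QExt c) W₀) (t : ℕ)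
    (ht : 2 * t + 2 ≤ m) :
    ∃ X W : Submodule (QExt c) V, X ≤ W ∧ TotSing B W ∧ m ≤ finrank (QExt c) W ∧
      finrank (QExt c) X = 2 * t ∧ ∀ x ∈ X, J x ∈ X := by
  induction t with
  | zero => exact ⟨⊥, W₀, bot_le, hW₀, hm, by simp, by simp⟩
  | succ t ih =>
    obtain ⟨X, W, hXW, hW, hmW, hX, hJX⟩ := ih (by omega)
    obtain ⟨Y, hYW, hXY, hY⟩ := X.exists_disjoint_le W
    have hY' : 6 ≤ finrank F Y := by
      rw [finrank_restrictScalars_qext (c := c)]; omega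
    have : FiniteDimensional F Y := Module.Finite.trans (QExt c) Y
    let ι : Y →ₗ[F] V := Y.subtype.restrictScalars F
    obtain ⟨⟨w, hwY⟩, hw0, hw⟩ := exists_isotropic_of_hermitian hF hc (P.compl₁₂ ι ι)
      (Algebra.lsmul F F Y (QExt.th c)) (fun y => hP y) (fun y => hP' y) hY'
    have hwX : w ∉ X := fun h => hw0 (Subtype.ext (Submodule.disjoint_def.mp hXY w h hwY))
    have hw1 : P w w = 0 := hw
    have hwW := hYW hwY
    have hJw := map_notMem_sup_span_singleton hJθ hJJ hb hJX hwX
    set X₁ := X ⊔ Submodule.span (QExt c) {w}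
    have hX₁ : X₁ ≤ W := sup_le hXW ((Submodule.span_singleton_le_iff_mem _ _).mpr hwW)
    have hJw' : B (J w) (J w) = 0 := hJB w (hW w hwW)
    have hX₁J : ∀ x ∈ X₁, pol B x (J w) = 0 := by
      intro y hy
      obtain ⟨x, hx, k, rfl⟩ := mem_sup_span_singleton hy
      have hx' : x = (algebraMap F (QExt c) b⁻¹) • J (J x) := by
        rw [hJJ, algebraMap_smul, smul_smul, inv_mul_cancel₀, one_smul]
        exact fun h0 => hb 0 0 (by rw [h0, nm]; ring)
      have h2 := hJB (J x + w) (hW _ (W.add_mem (hXW (hJX x hx)) hwW))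
      rw [map_add] at h2
      simp only [map_add, LinearMap.add_apply, hJw', hJB _ (hW _ (hXW (hJX x hx)))] at h2
      rw [map_add, map_smul, LinearMap.add_apply, LinearMap.smul_apply, hJP w hw1, hx', map_smul,
        LinearMap.smul_apply, pol_apply]
      simp only [smul_eq_mul]
      linear_combination (algebraMap F (QExt c) b⁻¹) * h2
    obtain ⟨W', hW', hXW', hJW', hfin⟩ := hW.exists_le_mem hX₁ hJw' hX₁J
    refine ⟨X₁ ⊔ Submodule.span (QExt c) {J w}, W',
      sup_le hXW' ((Submodule.span_singleton_le_iff_mem _ _).mpr hJW'), hW', hmW.trans hfin, ?_, ?_⟩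
    · rw [Submodule.finrank_sup_span_singleton hJw, Submodule.finrank_sup_span_singleton hwX, hX]
      ring
    · intro y hy
      obtain ⟨z, hz, k, rfl⟩ := mem_sup_span_singleton hy
      obtain ⟨x, hx, k', rfl⟩ := mem_sup_span_singleton hz
      simp only [map_add, semilinear_smul hJθ, hJJ]
      refine Submodule.add_mem _ (Submodule.add_mem _ ?_ ?_) ?_
      · exact Submodule.mem_sup_left (Submodule.mem_sup_left (hJX x hx))
      · exact Submodule.mem_sup_right (Submodule.smul_mem _ _ (Submodule.mem_span_singleton_self _))
      · rw [← algebraMap_smul (QExt c) b]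
        exact Submodule.mem_sup_left (Submodule.mem_sup_right (Submodule.smul_mem _ _
          (Submodule.smul_mem _ _ (Submodule.mem_span_singleton_self _))))

end Stable

section QuatHyperbolic

variable {F A S V : Type} [Field F] [Ring A] [Algebra F A]
  {T : A →ₗ[F] F} {σ : A →ₗ[F] A} {ℓ e i j : A} {c b : F}
  [AddCommGroup V] [Module F V]
  [Module (QExt c) V] [IsScalarTower F (QExt c) V] {κ : V →ₗ[F] A}
  [AddCommGroup S] [Module F S] {ρ : A →ₗ[F] Module.End F S}

omit [IsScalarTower F (QExt c) V] in
lemma IsColumn.exists_mul_right (hκ : IsColumn e i c κ) {d : A} (hd : d * e = d) :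
    ∃ J : V →ₗ[F] V, ∀ v, κ (J v) = κ v * d := by
  choose J hJ using fun v => hκ.surj (κ v * d) (by rw [mul_assoc, hd])
  exact ⟨{ toFun := J
           map_add' := fun v w => hκ.inj (by rw [hJ, map_add, map_add, hJ, hJ, add_mul])
           map_smul' := fun k v => hκ.inj (by
            rw [hJ, map_smul, RingHom.id_apply, map_smul, hJ, smul_mul_assoc]) }, hJ⟩

lemma QuatCorner.nm_ne (hQ : QuatCorner σ e i j c b) (he : e ≠ 0)
    (hdiv : ∀ x ∈ corner F e e, ∀ y ∈ corner F e e, x * y = 0 → x = 0 ∨ y = 0) (p q : F) :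
    nm c p q ≠ b := by
  intro hpq
  have hj : ∀ p q : F, j ≠ p • e + q • i := by
    intro p q h
    have h1 : j * i = i * j := by
      rw [h]
      simp only [add_mul, mul_add, smul_mul_assoc, mul_smul_comm, hQ.e_i, hQ.i_e]
    have h2 : j = (2 : F) • (i * j) := by
      rw [hQ.j_mul_i'] at h1
      linear_combination (norm := module) h1
    have h3 : i * j = (2 : F) • (i * j) - (2 * c) • j := by
      nth_rw 1 [h2]
      rw [mul_smul_comm, hQ.i_i_mul, hQ.e_j]
      module
    have h4 : (1 - 4 * c) • j = 0 := by
      linear_combination (norm := module) h2 - (2 : F) • h3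
    have h5 := (smul_eq_zero.mp h4).resolve_left hQ.one_sub_four_mul_ne_zero
    have h6 : b • e = 0 := by rw [← hQ.j_mul_j, h5, mul_zero]
    exact he ((smul_eq_zero.mp h6).resolve_left hQ.ne_zero)
  have hmem : ∀ p q : F, j - (p • e + q • i) ∈ corner F e e := fun p q => by
    have h1 : j ∈ corner F e e := ⟨hQ.e_j, hQ.j_e⟩
    have h2 : e ∈ corner F e e := ⟨hQ.idem, hQ.idem⟩
    have h3 : i ∈ corner F e e := ⟨hQ.e_i, hQ.i_e⟩
    exact sub_mem h1 (add_mem (Submodule.smul_mem _ _ h2) (Submodule.smul_mem _ _ h3))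
  have h0 : (j - (p • e + q • i)) * (j - ((-p - q) • e + q • i)) = 0 := by
    simp only [sub_mul, mul_sub, add_mul, mul_add, smul_mul_assoc, mul_smul_comm, hQ.j_mul_j,
      hQ.e_j, hQ.j_e, hQ.j_mul_i', hQ.idem, hQ.e_i, hQ.i_e, hQ.i_mul_i, ← hpq, nm]
    module
  rcases hdiv _ (hmem _ _) _ (hmem _ _) h0 with h | h
  · exact hj _ _ (sub_eq_zero.mp h)
  · exact hj _ _ (sub_eq_zero.mp h)

lemma baseChange_one_tmul_add (f : Module.End F S) {x y : S}
    (h : f.baseChange (QExt c) ((1 : QExt c) ⊗ₜ x + QExt.th c ⊗ₜ y) = 0) : f x = 0 ∧ f y = 0 := by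
  rw [map_add, LinearMap.baseChange_tmul, LinearMap.baseChange_tmul] at h
  exact ⟨by simpa [QuadraticAlgebra.re_one] using congrArg (QExt.reT c) h,
    by simpa [QuadraticAlgebra.im_one] using congrArg (QExt.imT c) h⟩

theorem hyperbolic_of_quatCorner [Module.Finite F A] [FiniteDimensional F S] [Nontrivial S]
    [Nontrivial V] (hF : PfisterUniversal F) (hT : IsReducedTrace F A T)
    (hq : IsQuadraticPair F A T σ ℓ) (hρ : CliffRep T σ ℓ ρ) (hQ : QuatCorner σ e i j c b)
    (hκ : IsColumn e i c κ) (he : e ≠ 0)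
    (hdiv : ∀ x ∈ corner F e e, ∀ y ∈ corner F e e, x * y = 0 → x = 0 ∨ y = 0)
    {t : ℕ} {u u' : Fin (2 * t + 2) → A} (h : IsFrame e u u')
    (hA : finrank F A = 4 * (2 * t + 2) ^ 2) (hV : finrank F V = 4 * (2 * t + 2)) :
    QPHyperbolic F A T σ ℓ := by
  have := QExt.fact_of_anisotropic hQ.aniso
  have : FiniteDimensional F V := FiniteDimensional.of_finrank_pos (by omega)
  have : FiniteDimensional (QExt c) V := Module.Finite.of_restrictScalars_finite F _ _
  obtain ⟨hTi, hspin⟩ := isSpin_quatSpin hT hq hρ hQ hκ h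
  have hV' : finrank (QExt c) V = 2 * (2 * t) + 4 := by
    have := finrank_restrictScalars_qext (c := c) (V := V)
    omega
  obtain ⟨J, hJ⟩ := hκ.exists_mul_right hQ.j_e
  have hFK : PfisterUniversal (QExt c) :=
    hF.quadExt QExt.th_mul_th fun x => ⟨x.re, x.im, QExt.eq_add x⟩
  obtain ⟨W₀, hW₀, hm⟩ := hspin.exists_lagrangian (2 * t + 2) _ hFK _ _ _ _ (by omega)
  let P : V →ₗ[F] V →ₗ[F] F := LinearMap.mk₂ F (fun v w => T (ℓ * (κ v * σ (κ w))))
    (by intros; simp [add_mul, mul_add]) (by intros; simp) (by intros; simp [mul_add])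
    (by intros; simp)
  have hP : ∀ v w, P v w = T (ℓ * (κ v * σ (κ w))) := fun _ _ => rfl
  clear_value P
  have hPθ : ∀ w, P (QExt.th c • w) (QExt.th c • w) = c * P w w := by
    intro w
    have he' := hQ.e_mul_map hq (hκ.mul_e w)
    rw [hP, hP, hκ.th_smul, hq.map_mul, hQ.map_i_eq, mul_assoc (κ w), sub_mul, mul_sub, he',
      hQ.i_i_mul, he', sub_sub_cancel, mul_smul_comm, mul_smul_comm, map_smul, smul_eq_mul]
  have hPθ' : ∀ w, P w (QExt.th c • w) + P (QExt.th c • w) w = P w w := by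
    intro w
    have he' := hQ.e_mul_map hq (hκ.mul_e w)
    rw [hP, hP, hP, hκ.th_smul, hq.map_mul, hQ.map_i_eq, sub_mul, he', mul_sub, mul_sub, map_sub,
      mul_assoc (κ w)]
    ring
  have hJθ : ∀ v, J (QExt.th c • v) = J v - QExt.th c • J v := by
    intro v
    apply hκ.inj
    rw [map_sub, hκ.th_smul, hJ, hJ, hκ.th_smul, mul_assoc, mul_assoc, hQ.j_mul_i', mul_sub]
    abel
  have hJJ : ∀ v, J (J v) = b • v := by
    intro v
    apply hκ.inj
    rw [hJ, hJ, map_smul, mul_assoc, hQ.j_mul_j, mul_smul_comm, hκ.mul_e]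
  have hJB : ∀ v, quatForm hq hQ hκ v v = 0 → quatForm hq hQ hκ (J v) (J v) = 0 := by
    intro v hv
    have he' := hQ.e_mul_map hq (hκ.mul_e v)
    rw [quatForm_apply] at hv
    obtain ⟨h1, h2⟩ := QExt.eq_zero_of_add_th hv
    have h3 : κ v * j * (i * j) * (j * σ (κ v)) =
        b • (κ v * j * σ (κ v) - κ v * (i * j) * σ (κ v)) := by
      simp only [mul_assoc, hQ.j_mul_j, hQ.i_e, mul_smul_comm, smul_mul_assoc, hQ.e_j_mul,
        hQ.j_i_mul, mul_sub, sub_mul, smul_sub]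
    have h4 : κ v * j * j * (j * σ (κ v)) = b • (κ v * j * σ (κ v)) := by
      simp only [mul_assoc, hQ.j_j_mul, mul_smul_comm, he']
    rw [quatForm_apply, hJ, hq.map_mul, hQ.map_j, h3, h4]
    simp [mul_sub, h1, h2]
  have hJP : ∀ v, P v v = 0 → pol (quatForm hq hQ hκ) v (J v) = 0 := by
    intro v hv
    have he' := hQ.e_mul_map hq (hκ.mul_e v)
    rw [hP] at hv
    have h1 : T (κ v * σ (κ v)) = 0 := by
      rw [← trace_mul_add_map hT hq, hq.map_mul, hq.invol, mul_add, map_add, hv, add_zero]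
    have h2 : T (κ v * (i * σ (κ v))) = 0 := by
      rw [← trace_mul_add_map hT hq, hq.map_mul, hq.map_mul, hq.invol, hQ.map_i_eq, mul_assoc,
        ← mul_add, ← add_mul, add_sub_cancel, he', hv]
    have h3 : κ v * (i * j) * (j * σ (κ v)) = b • (κ v * (i * σ (κ v))) := by
      simp only [mul_assoc, hQ.j_j_mul, mul_smul_comm, he']
    have h4 : κ v * j * (j * σ (κ v)) = b • (κ v * σ (κ v)) := by
      simp only [mul_assoc, hQ.j_j_mul, mul_smul_comm, he']
    rw [pol_quatForm hT, hJ, hq.map_mul, hQ.map_j, h3, h4]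
    simp [h1, h2]
  obtain ⟨X, W, hXW, hW, hmW, hX, hJX⟩ := exists_stable_le_lagrangian hF hQ.aniso hJθ hJJ
    (hQ.nm_ne he hdiv) hJB hJP hPθ hPθ' hW₀ hm t le_rfl
  obtain ⟨k, hk, hk'⟩ := quatSpin_add_eq_smul (ρ := ρ) hq hQ hκ
  obtain ⟨⟨s, hs, hs0⟩, hpure⟩ := hspin.pure (2 * t) _ _ _ _ hV' W X hW hmW hXW hX
  obtain ⟨s₀, s₁, rfl⟩ := QExt.exists_tensor_eq s
  have h1 : ∀ a, ∀ x ∈ X, ρ (a * σ (κ x)) s₀ = 0 ∧ ρ (a * σ (κ x)) s₁ = 0 := by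
    intro a x hx
    obtain ⟨v, hv⟩ := hκ.surj (a * e) (by rw [mul_assoc, hQ.idem])
    refine baseChange_one_tmul_add (c := c) _ ((smul_eq_zero.mp ?_).resolve_left hk)
    have h2 := DFunLike.congr_fun (hk' v x (J v) (J x) (hJ v) (hJ x))
      ((1 : QExt c) ⊗ₜ s₀ + QExt.th c ⊗ₜ s₁)
    rw [LinearMap.add_apply, hs _ _ hx, hs _ _ (hJX x hx), add_zero, hv, mul_assoc,
      hQ.e_mul_map hq (hκ.mul_e x)] at h2
    exact h2.symm
  obtain ⟨s, hs, hs'⟩ : ∃ s : S, s ≠ 0 ∧ ∀ a, ∀ x ∈ X, ρ (a * σ (κ x)) s = 0 := by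
    by_cases h2 : s₀ = 0
    · refine ⟨s₁, ?_, fun a x hx => (h1 a x hx).2⟩
      rintro rfl
      exact hs0 (by rw [h2]; simp)
    · exact ⟨s₀, h2, fun a x hx => (h1 a x hx).1⟩
  have hs₁ : (1 : QExt c) ⊗ₜ[F] s ∈ spinKer (quatSpin ρ hq hQ hκ) X := fun v x hx => by
    rw [quatSpin_apply]
    simp [hs' _ x hx]
  have hs₂ : (1 : QExt c) ⊗ₜ[F] s ≠ 0 := fun h0 => hs (by
    simpa [QuadraticAlgebra.re_one] using congrArg (QExt.reT c) h0)
  have hW₁ := hpure _ hs₁ hs₂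
  set W₁ := spinAnn (quatSpin ρ hq hQ hκ) ((1 : QExt c) ⊗ₜ[F] s)
  refine h.hyperbolic_of_annihilator hT hq hρ hs
    (W := (W₁.restrictScalars F).map κ) ?_ ?_ ?_
  · rintro _ ⟨w, -, rfl⟩
    exact ⟨one_mul _, hκ.mul_e w⟩
  · rintro _ ⟨w, hw, rfl⟩ a
    obtain ⟨v, hv⟩ := hκ.surj (a * e) (by rw [mul_assoc, hQ.idem])
    have h2 : ρ (κ (J v) * j * σ (κ w)) s = 0 := by
      have h3 := congrArg (QExt.imT c) (hw (J v))
      rw [quatSpin_apply] at h3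
      simpa [QuadraticAlgebra.im_one, TensorProduct.smul_tmul'] using h3
    have he' := hQ.e_mul_map hq (hκ.mul_e w)
    rw [hJ, mul_assoc (κ v), hQ.j_mul_j, hv, mul_smul_comm, smul_mul_assoc, mul_assoc a,
      mul_assoc a, hQ.idem, he', map_smul, LinearMap.smul_apply] at h2
    exact (smul_eq_zero.mp h2).resolve_left hQ.ne_zero
  · have h2 : finrank F ((W₁.restrictScalars F).map κ) = finrank F W₁ :=
      (Submodule.equivMapOfInjective κ hκ.inj _).finrank_eq.symm
    rw [h2, finrank_restrictScalars_qext (c := c) (V := W₁), hA]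
    nlinarith

end QuatHyperbolic

section Column

variable {F A S : Type} [Field F] [Ring A] [Algebra F A]
  {T : A →ₗ[F] F} {σ : A →ₗ[F] A} {ℓ e i j : A} {c b : F}

lemma QuatCorner.exists_column (hQ : QuatCorner σ e i j c b) :
    ∃ (_ : Module (QExt c) (corner F 1 e)) (_ : IsScalarTower F (QExt c) (corner F 1 e)),
      IsColumn e i c (corner F 1 e).subtype := by
  have hi : ∀ x ∈ corner F 1 e, LinearMap.mulRight F i x ∈ corner F 1 e := fun x _ =>
    ⟨one_mul _, by rw [LinearMap.mulRight_apply, mul_assoc, hQ.i_e]⟩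
  let m : Module.End F (corner F 1 e) := (LinearMap.mulRight F i).restrict hi
  have hm : m * m = (-c) • 1 + (1 : F) • m := by
    ext x
    have h1 : (x : A) * i * i = -(c • (x : A)) + x * i := by
      rw [mul_assoc, hQ.i_mul_i, mul_sub, mul_smul_comm, x.2.2]
      abel
    simpa [m] using h1
  let φ : QExt c →ₐ[F] Module.End F (corner F 1 e) := QuadraticAlgebra.lift ⟨m, hm⟩
  let _ : Module (QExt c) (corner F 1 e) := Module.compHom _ φ.toRingHom
  have hφ : ∀ (k : QExt c) (v : corner F 1 e), k • v = φ k v := fun _ _ => rfl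
  have hth : φ (QExt.th c) = m := by
    simp [φ, QuadraticAlgebra.lift, QExt.th]
  refine ⟨inferInstance, ⟨fun x k v => ?_⟩, Subtype.val_injective, fun v => v.2.2,
    fun x hx => ⟨⟨x, one_mul x, hx⟩, rfl⟩, fun v => ?_⟩
  · rw [hφ, hφ, map_smul, LinearMap.smul_apply]
  · rw [hφ, hth]
    rfl

theorem hyperbolic_of_quaternion {D : Type} [DivisionRing D] [Algebra F D] [Module.Finite F A]
    [AddCommGroup S] [Module F S] [FiniteDimensional F S] [Nontrivial S]
    {ρ : A →ₗ[F] Module.End F S} (hF : PfisterUniversal F) (hT : IsReducedTrace F A T)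
    (hq : IsQuadraticPair F A T σ ℓ) (hρ : CliffRep T σ ℓ ρ) (hQ : QuatCorner σ e i j c b)
    {t : ℕ} {u u' : Fin (2 * t + 2) → A} (h : IsFrame e u u') {ι : D →ₗ[F] A}
    (hι : IsCornerIso e ι) (hD : finrank F D = 4)
    (hA : finrank F A = (2 * t + 2) * (2 * t + 2) * 4) : QPHyperbolic F A T σ ℓ := by
  obtain ⟨_, _, hκ⟩ := hQ.exists_column
  have hV : finrank F (corner F 1 e) = 4 * (2 * t + 2) := by
    rw [h.finrank_corner, hι.finrank_eq, hD, mul_comm]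
  have : Nontrivial (corner F 1 e) := Module.nontrivial_of_finrank_pos (R := F) (by omega)
  refine hyperbolic_of_quatCorner hF hT hq hρ hQ hκ hι.ne_zero (fun x hx y hy hxy => ?_) h
    (by rw [hA]; ring) hV
  obtain ⟨d, rfl⟩ := hι.surj x hx
  obtain ⟨d', rfl⟩ := hι.surj y hy
  rw [← hι.map_mul, ← map_zero ι] at hxy
  rcases mul_eq_zero.mp (hι.inj hxy) with rfl | rfl
  · exact Or.inl (map_zero ι)
  · exact Or.inr (map_zero ι)

end Column

section StableFrame

variable {F A D : Type} [Field F] [Ring A] [Algebra F A] [DivisionRing D] [Algebra F D]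
  {T : A →ₗ[F] F} {σ : A →ₗ[F] A} {ℓ e : A} {r : ℕ} {u u' : Fin r → A} {ι : D →ₗ[F] A}

lemma exists_map_mul_ne_zero (hq : IsQuadraticPair F A T σ ℓ)
    (h : IsFrame e u u') (hι : IsCornerIso e ι) (hD : finrank F D ≠ 1)
    (hcen : ∀ x : D, (∀ y, x * y = y * x) → ∃ k : F, x = algebraMap F D k) :
    ∃ v, v * e = v ∧ σ v * v ≠ 0 := by
  by_contra! h0
  have hpol : ∀ v w, v * e = v → w * e = w → σ v * w + σ w * v = 0 := fun v w hv hw => by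
    have h1 := h0 (v + w) (by rw [add_mul, hv, hw])
    rw [map_add, add_mul, mul_add, mul_add, h0 v hv, h0 w hw] at h1
    simpa using h1
  obtain ⟨w, hw, hw0⟩ : ∃ w, w * e = w ∧ σ e * w ≠ 0 := by
    by_contra! h1
    have h2 : ∀ a, σ e * u a = 0 := fun a => h1 _ (h.mul_e a)
    refine hι.ne_zero ?_
    rw [← hq.invol e]
    have : σ e = 0 := by
      rw [← mul_one (σ e), ← h.sum, Finset.mul_sum]
      simp [← mul_assoc, h2]
    rw [this, map_zero]
  have hσe : σ e * σ e = σ e := by rw [← hq.map_mul, h.idem]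
  have ht : σ e * w ∈ corner F (σ e) e := ⟨by rw [← mul_assoc, hσe], by rw [mul_assoc, hw]⟩
  obtain ⟨y, hy, hyt, hty⟩ := h.exists_inv hι hq ht hw0
  set t := σ e * w
  clear_value t
  have hte : t * e = t := ht.2
  have hσt : ∀ z ∈ corner F e e, t * z = σ z * t := fun z hz => by
    have h1 := hpol z t hz.2 hte
    have h4 := hpol e t h.idem hte
    have h5 : σ t * e = σ t := by rw [← ht.1, hq.map_mul, hq.invol, mul_assoc, h.idem]
    rw [ht.1, h5, add_comm, add_eq_zero_iff_eq_neg] at h4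
    rwa [h4, neg_mul, ← sub_eq_add_neg, sub_eq_zero, eq_comm] at h1
  have hcomm : ∀ x ∈ corner F e e, ∀ z ∈ corner F e e, x * z = z * x := fun x hx z hz => by
    have h1 : t * (x * z) = t * (z * x) := by
      rw [hσt (x * z) ⟨by rw [← mul_assoc, hx.1], by rw [mul_assoc, hz.2]⟩, hq.map_mul, mul_assoc,
        ← hσt x hx, ← mul_assoc, ← hσt z hz, mul_assoc]
    have h2 := congrArg (y * ·) h1
    simp only [← mul_assoc, hyt] at h2
    rwa [hx.1, hz.1] at h2
  refine hD ((finrank_eq_one_iff_of_nonzero' (1 : D) one_ne_zero).mpr fun d => ?_)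
  obtain ⟨k, rfl⟩ := hcen d fun d' => hι.inj (by
    rw [hι.map_mul, hι.map_mul, hcomm _ (hι.mem d) _ (hι.mem d')])
  exact ⟨k, (Algebra.algebraMap_eq_smul_one k).symm⟩

lemma exists_stable_frame (hq : IsQuadraticPair F A T σ ℓ)
    (h : IsFrame e u u') (hι : IsCornerIso e ι) (hD : finrank F D ≠ 1)
    (hcen : ∀ x : D, (∀ y, x * y = y * x) → ∃ k : F, x = algebraMap F D k) :
    ∃ (e : A) (ι : D →ₗ[F] A) (u u' : Fin r → A),
      σ e = e ∧ IsFrame e u u' ∧ IsCornerIso e ι := by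
  obtain ⟨v, hv, hv0⟩ := exists_map_mul_ne_zero hq h hι hD hcen
  have hσv : σ e * σ v = σ v := by rw [← hq.map_mul, hv]
  have ht : σ v * v ∈ corner F (σ e) e := ⟨by rw [← mul_assoc, hσv], by rw [mul_assoc, hv]⟩
  obtain ⟨y, hy, hyt, hty⟩ := h.exists_inv hι hq ht hv0
  set w := y * σ v with hw
  have hwv : w * v = e := by rw [hw, mul_assoc, hyt]
  have hew : e * w = w := by rw [hw, ← mul_assoc, hy.1]
  have hσy : σ y = y := by
    have h1 : σ y * σ e = σ y := by rw [← hq.map_mul, hy.1]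
    have h2 : σ (σ v * v) = σ v * v := by rw [hq.map_mul, hq.invol]
    have h3 : σ v * v * σ y = σ e := by rw [← h2, ← hq.map_mul, hyt]
    have h4 : e * σ y = σ y := by nth_rw 1 [← hq.invol e]; rw [← hq.map_mul, hy.2]
    rw [← h4, ← hyt, mul_assoc, h3, hy.2]
  refine ⟨v * w, LinearMap.mulLeft F v ∘ₗ LinearMap.mulRight F w ∘ₗ ι, fun a => u a * w,
    fun a => v * u' a, ?_, ⟨?_, fun a => ?_, fun a => ?_, fun a b => ?_, ?_⟩,
    ⟨fun x z => ?_, ?_, fun x z hxz => ?_, fun x hx => ?_⟩⟩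
  · rw [hw, hq.map_mul, hq.map_mul, hq.invol, hσy, mul_assoc]
  · rw [mul_assoc, ← mul_assoc w, hwv, hew]
  · rw [mul_assoc, ← mul_assoc w, hwv, hew]
  · rw [mul_assoc, ← mul_assoc w, hwv, h.e_mul]
  · rw [mul_assoc, ← mul_assoc (u' a), h.mul]
    split_ifs
    · rw [hew]
    · rw [zero_mul, mul_zero]
  · rw [← h.sum]
    refine Finset.sum_congr rfl fun a _ => ?_
    rw [mul_assoc, ← mul_assoc w, hwv, h.e_mul]
  · have h1 := (hι.mem z).1
    simp only [LinearMap.comp_apply, LinearMap.mulLeft_apply, LinearMap.mulRight_apply, hι.map_mul]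
    calc v * (ι x * ι z * w) = v * (ι x * (e * ι z) * w) := by rw [h1]
      _ = _ := by rw [← hwv]; noncomm_ring
  · simp only [LinearMap.comp_apply, LinearMap.mulLeft_apply, LinearMap.mulRight_apply, hι.map_one,
      hew]
  · apply hι.inj
    have h1 := congrArg (fun x => w * x * v) hxz
    simp only [LinearMap.comp_apply, LinearMap.mulLeft_apply, LinearMap.mulRight_apply] at h1
    have h2 : ∀ x, w * (v * (ι x * w)) * v = ι x := fun x => by
      rw [← mul_assoc w, hwv, mul_assoc, mul_assoc, hwv, (hι.mem x).2, (hι.mem x).1]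
    rwa [h2, h2] at h1
  · obtain ⟨d, hd⟩ := hι.surj (w * x * v)
      ⟨by rw [← mul_assoc, ← mul_assoc, hew], by rw [mul_assoc, hv]⟩
    refine ⟨d, ?_⟩
    simp only [LinearMap.comp_apply, LinearMap.mulLeft_apply, LinearMap.mulRight_apply, hd]
    calc v * (w * x * v * w) = v * w * x * (v * w) := by noncomm_ring
      _ = x := by rw [hx.1, hx.2]

end StableFrame

section Quaternion

variable {F A D : Type} [Field F] [Ring A] [Algebra F A] [DivisionRing D] [Algebra F D]
  {T : A →ₗ[F] F} {σ : A →ₗ[F] A} {ℓ e : A} {r : ℕ} {u u' : Fin r → A} {ι : D →ₗ[F] A}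

lemma IsCornerIso.exists_involution (hι : IsCornerIso e ι) (hq : IsQuadraticPair F A T σ ℓ)
    (he : σ e = e) : ∃ τ : D →ₗ[F] D, ∀ d, ι (τ d) = σ (ι d) := by
  have h1 : ∀ d, ∃ d', ι d' = σ (ι d) := fun d => hι.surj _
    ⟨by nth_rw 1 [← he]; rw [← hq.map_mul, (hι.mem d).2],
      by nth_rw 1 [← he]; rw [← hq.map_mul, (hι.mem d).1]⟩
  choose τ hτ using h1
  exact ⟨{ toFun := τ
           map_add' := fun x y => hι.inj (by simp [hτ])
           map_smul' := fun k x => hι.inj (by simp [hτ]) }, hτ⟩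

lemma exists_map_eq_self [Module.Finite F A] (hq : IsQuadraticPair F A T σ ℓ) (hr : 0 < r)
    (h : IsFrame e u u') (hι : IsCornerIso e ι) (he : σ e = e) (hD : finrank F D = 4)
    (hdeg : deg F A = 2 * r) : ∃ x ∈ corner F e e, σ x = x ∧ ∀ k : F, x ≠ k • e := by
  by_contra! h0
  have h1 := h.finrank_symSet_le (F := F) hq.map_mul hq.invol
  rw [he, hι.finrank_eq, hD, hq.2.1, hdeg] at h1
  have h2 : finrank F ↥(corner F e e ⊓ symSet F σ) ≤ 1 := by
    refine (Submodule.finrank_mono (t := Submodule.span F {e}) fun y hy => ?_).trans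
      (finrank_span_singleton hι.ne_zero).le
    have h3 : σ y = y := by
      simpa [symSet, sub_eq_zero] using hy.2
    obtain ⟨k, rfl⟩ := h0 y hy.1 h3
    exact Submodule.smul_mem _ _ (Submodule.mem_span_singleton_self _)
  obtain ⟨s, rfl⟩ : ∃ s, r = s + 1 := ⟨r - 1, by omega⟩
  simp only [Nat.add_sub_cancel] at h1
  nlinarith

lemma exists_quatCorner [Module.Finite F A] (hq : IsQuadraticPair F A T σ ℓ) (hr : 0 < r)
    (h : IsFrame e u u') (hι : IsCornerIso e ι) (he : σ e = e) (hD : finrank F D = 4)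
    (hdeg : deg F A = 2 * r)
    (hcen : ∀ x : D, (∀ y, x * y = y * x) → ∃ k : F, x = algebraMap F D k) :
    ∃ (i j : A) (c b : F), QuatCorner σ e i j c b := by
  obtain ⟨τ, hτ⟩ := hι.exists_involution hq he
  obtain ⟨l, hl⟩ := hι.surj (e * ℓ * e)
    ⟨by rw [← mul_assoc, ← mul_assoc, h.idem], by rw [mul_assoc, h.idem]⟩
  have hl1 : l + τ l = 1 := hι.inj (by
    rw [map_add, hτ, hl, hι.map_one, hq.map_mul, hq.map_mul, he, ← mul_assoc, ← add_mul,
      ← mul_add, hq.2.2.2, mul_one, h.idem])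
  obtain ⟨i, j, c, b, hB, hspan⟩ := exists_quatBasis (τ := τ) hD hcen
    (fun x y => hι.inj (by rw [hτ, hι.map_mul, hq.map_mul, hι.map_mul, hτ, hτ]))
    (fun x => hι.inj (by rw [hτ, hτ, hq.invol])) hl1
    (fun _ => by
      obtain ⟨x, hx, hσx, hxe⟩ := exists_map_eq_self hq hr h hι he hD hdeg
      obtain ⟨s, rfl⟩ := hι.surj x hx
      exact ⟨s, hι.inj (by rw [hτ, hσx]), fun k hk => hxe k (by rw [hk, map_smul, hι.map_one])⟩)
  refine ⟨ι i, ι j, c, b, ⟨⟨?_, ?_, ?_, ?_, ?_, hB.ne_zero, hB.aniso⟩, h.idem, he, (hι.mem i).1,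
    (hι.mem i).2, (hι.mem j).1, (hι.mem j).2, fun x hx => ?_⟩⟩
  · rw [← hτ, ← map_add, hB.map_i, hι.map_one]
  · rw [← hτ, hB.map_j]
  · rw [← hι.map_mul, hB.i_mul_i, map_sub, map_smul, hι.map_one]
  · rw [← hι.map_mul, hB.j_mul_i, hι.map_mul, map_sub, hι.map_one]
  · rw [← hι.map_mul, hB.j_mul_j, map_smul, hι.map_one]
  · obtain ⟨d, rfl⟩ := hι.surj x hx
    obtain ⟨p, q, y, z, rfl⟩ := hspan d
    exact ⟨p, q, y, z, by simp only [map_add, map_smul, hι.map_mul, hι.map_one]⟩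

end Quaternion

/-- Proposition 4.2 (2) of the paper.  Assume `I_q³F = 0`.  Let
`(A, σ, f)` be an `F`-algebra with quadratic pair such that `deg A` is divisible by 4,
`ind A ≤ 2` and `disc(σ, f)` is trivial, with Clifford algebra `C(A,σ,f) ≅ C⁺ × C⁻`.
If `C⁺` or `C⁻` is split, then `(A, σ, f)` is hyperbolic. -/
theorem qp_hyperbolic_of_split_component (F : Type) [Field F] (h3 : I3Trivial F)
    (A : Type) [Ring A] [Algebra F A] (hA : IsCSA F A)
    (T : A →ₗ[F] F) (hT : IsReducedTrace F A T)
    (σ : A →ₗ[F] A) (ℓ : A) (hqp : IsQuadraticPair F A T σ ℓ)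
    (hdvd : 4 ∣ deg F A)
    (hindA : schurIndex F A ≤ 2)
    (Cp Cm : Type) [Ring Cp] [Algebra F Cp] [Ring Cm] [Algebra F Cm]
    (hCp : IsCSA F Cp) (hCm : IsCSA F Cm)
    (hdisc : Nonempty (CliffordAlg F A T σ ℓ ≃ₐ[F] Cp × Cm))
    (hsplit : IsSplit F Cp ∨ IsSplit F Cm) :
    QPHyperbolic F A T σ ℓ := by
  have hfin : Module.Finite F A := hA.2.2
  obtain ⟨N, hN, ρ, hρ⟩ := exists_cliffRep hdisc hsplit
  have : Nonempty (Fin N) := ⟨⟨0, hN⟩⟩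
  have hF := h3.pfisterUniversal
  obtain ⟨D, _, _, r, hr, _, φ, e, ι, u, u', h, hι, hdim, hcen⟩ := exists_frame hA
  rcases finrank_eq_one_or_four hA hT.finrank_eq hindA hr φ with ⟨hD, hdeg⟩ | ⟨hD, hdeg⟩
  · obtain ⟨hc, g, hg, t, ht, hgt, htg, hσg⟩ := exists_symmetric_generator hqp hr h hι hD hdeg
    exact hyperbolic_of_finrank_corner_eq_one hF hT hqp hρ h (k := (r - 4) / 2) (by omega)
      hι.ne_zero hc hg ht hgt htg hσg (by rw [hdim, hD, mul_one])
  · obtain ⟨e, ι, u, u', he, h, hι⟩ := exists_stable_frame hqp h hι (by omega) hcen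
    obtain ⟨i, j, c, b, hQ⟩ := exists_quatCorner hqp hr h hι he hD hdeg hcen
    obtain ⟨t, rfl⟩ : ∃ t, r = 2 * t + 2 := ⟨(r - 2) / 2, by omega⟩
    exact hyperbolic_of_quaternion hF hT hqp hρ hQ h hι hD (by rw [hdim, hD])

end Triality
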